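/- Asymptotic formula for skew doubled shifted plane partitions: let m ≥ 2 and let δ=(δ_j)_{1≤j≤m−1} be a profile, with W_1(δ), W_2(δ) the multisets W_1(δ) = {m} ∪ {i : δ_i=−1} ∪ {m−i : δ_i=1} and W_2(δ) = {i+j : i<j, δ_i=δ_j=−1} ∪ {2m−i−j : i<j, δ_i=δ_j=1} ∪ {2m+i−j : i<j, δ_i<δ_j} ∪ {j−i : i<j, δ_i>δ_j}, and let ε(δ) = −Σ_i δ_i·i and |δ|_1 the number of +1's in δ. Then the number DSPP_δ(n) of skew doubled shifted plane partitions with profile δ and size n satisfies, as n → ∞, DSPP_δ(n) ~ C_1(δ) C_2(m) · (1/n) · exp(π √((m²+m+2)n/(6m))), where C_1(δ) = 2^{−ε(δ)/m − |δ|_1} ∏_{t∈W_1(δ)} Γ(t/m) ∏_{t∈W_2(δ)} Γ(t/(2m)) and C_2(m) = (2^{m²−3m+14} π^{m²−m})^{−1/4} √((m²+m+2)/3). -/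

import Mathlib

open scoped BigOperators

/-- An integer partition: a weakly decreasing, finitely supported sequence of
nonnegative integers. -/
structure Ptn where
  toFun : ℕ →₀ ℕ
  antitone' : ∀ ⦃i j : ℕ⦄, i ≤ j → toFun j ≤ toFun i

namespace Ptn
/-- the `i`-th part (0-indexed) -/
def part (lam : Ptn) (i : ℕ) : ℕ := lam.toFun i
/-- the size `|λ|` -/
def size (lam : Ptn) : ℕ := lam.toFun.sum fun _ k => k
end Ptn

/-- `HStrip μ λ` means `μ ≺ λ`, i.e. `λ/μ` is a horizontal strip:
`λ_i ≥ μ_i ≥ λ_{i+1}` for all `i`. -/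
def HStrip (mu lam : Ptn) : Prop :=
  ∀ i : ℕ, mu.part i ≤ lam.part i ∧ lam.part (i + 1) ≤ mu.part i
/-- `δ` is a `±1`-profile on the indices `1, …, h` -/
def IsProfile (h : ℕ) (δ : ℕ → ℤ) : Prop := ∀ i, 1 ≤ i → i ≤ h → δ i = 1 ∨ δ i = -1

/-- A skew doubled shifted plane partition `ω = (λ^0, …, λ^{m-1})` with profile
`(δ_1, …, δ_{m-1})`: if `δ_{i+1} = 1` then `λ^i ≺ λ^{i+1}`, and if
`δ_{i+1} = -1` then `λ^i ≻ λ^{i+1}`. -/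
def IsDSPP (m : ℕ) (δ : ℕ → ℤ) (L : Fin m → Ptn) : Prop :=
  ∀ (i : ℕ) (hi : i + 1 < m),
    if δ (i + 1) = 1 then HStrip (L ⟨i, Nat.lt_of_succ_lt hi⟩) (L ⟨i + 1, hi⟩)
    else HStrip (L ⟨i + 1, hi⟩) (L ⟨i, Nat.lt_of_succ_lt hi⟩)

/-- the multiset `W_1(δ) = {m} ∪ {i : δ_i = -1} ∪ {m - i : δ_i = 1}` -/
def W1 (m : ℕ) (δ : ℕ → ℤ) : Multiset ℕ :=
  m ::ₘ (Finset.Icc 1 (m - 1)).val.map (fun i => if δ i = -1 then i else m - i)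

/-- the multiset
`W_2(δ) = {i+j : i<j, δ_i=δ_j=-1} ∪ {2m-i-j : i<j, δ_i=δ_j=1}
          ∪ {2m+i-j : i<j, δ_i<δ_j} ∪ {j-i : i<j, δ_i>δ_j}`,
where `1 ≤ i < j ≤ m-1` -/
def W2 (m : ℕ) (δ : ℕ → ℤ) : Multiset ℕ :=
  ((((Finset.Icc 1 (m - 1)) ×ˢ (Finset.Icc 1 (m - 1))).filter
      (fun q => q.1 < q.2)).val).map
    (fun q =>
      if δ q.1 = -1 ∧ δ q.2 = -1 then q.1 + q.2
      else if δ q.1 = 1 ∧ δ q.2 = 1 then 2 * m - q.1 - q.2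
      else if δ q.1 < δ q.2 then 2 * m + q.1 - q.2
      else q.2 - q.1)

/-- `DSPPcount m δ n` is the number of skew doubled shifted plane partitions
with profile `δ = (δ_1, …, δ_{m-1})` and size `n` -/
noncomputable def DSPPcount (m : ℕ) (δ : ℕ → ℤ) (n : ℕ) : ℕ :=
  Nat.card {L : Fin m → Ptn // IsDSPP m δ L ∧ ∑ i, (L i).size = n}

/-- `ε(δ) = -Σ_i δ_i · i` -/
def epsProfile (m : ℕ) (δ : ℕ → ℤ) : ℤ := -∑ i ∈ Finset.Icc 1 (m - 1), δ i * (i : ℤ)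

/-- `|δ|_1`, the number of `+1` letters in `δ` -/
def onesProfile (m : ℕ) (δ : ℕ → ℤ) : ℕ :=
  ((Finset.Icc 1 (m - 1)).filter (fun i => δ i = 1)).card

/-- the constant
`C_1(δ) = 2^{-ε(δ)/m - |δ|_1} ∏_{t ∈ W_1(δ)} Γ(t/m) ∏_{t ∈ W_2(δ)} Γ(t/(2m))` -/
noncomputable def C1 (m : ℕ) (δ : ℕ → ℤ) : ℝ :=
  (2 : ℝ) ^ (-(epsProfile m δ : ℝ) / m - (onesProfile m δ : ℝ)) *
    ((W1 m δ).map (fun t => Real.Gamma ((t : ℝ) / m))).prod *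
    ((W2 m δ).map (fun t => Real.Gamma ((t : ℝ) / (2 * m)))).prod

/-- the constant `C_2(m) = (2^{m²-3m+14} π^{m²-m})^{-1/4} √((m²+m+2)/3)` -/
noncomputable def C2 (m : ℕ) : ℝ :=
  ((2 : ℝ) ^ ((m : ℝ) ^ 2 - 3 * m + 14) * Real.pi ^ ((m : ℝ) ^ 2 - m)) ^ (-(1 : ℝ) / 4) *
    Real.sqrt (((m : ℝ) ^ 2 + m + 2) / 3)

namespace Ptn

@[ext] theorem ext_part {a b : Ptn} (h : ∀ i, a.part i = b.part i) : a = b := by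
  cases a; cases b
  congr 1
  exact Finsupp.ext h

theorem part_anti (a : Ptn) {i j : ℕ} (h : i ≤ j) : a.part j ≤ a.part i := a.antitone' h

theorem exists_part_eq_zero (a : Ptn) : ∃ N, ∀ i, N ≤ i → a.part i = 0 := by
  refine ⟨a.toFun.support.sup id + 1, fun i hi => ?_⟩
  by_contra h
  have : i ≤ a.toFun.support.sup id :=
    Finset.le_sup (f := id) (Finsupp.mem_support_iff.2 h)
  omega

theorem size_eq (a : Ptn) {N : ℕ} (h : ∀ i, N ≤ i → a.part i = 0) :
    a.size = ∑ i ∈ Finset.range N, a.part i := by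
  unfold size Finsupp.sum
  refine Finset.sum_subset (fun i hi => ?_) (fun i _ hi => ?_)
  · rw [Finset.mem_range]
    by_contra hN
    exact (Finsupp.mem_support_iff.1 hi) (h i (not_lt.1 hN))
  · simpa using hi

/-- The partition with a given eventually vanishing antitone sequence of parts. -/
noncomputable def ofFun (f : ℕ → ℕ) (hf : Antitone f) (h : ∃ N, ∀ i, N ≤ i → f i = 0) : Ptn where
  toFun := Finsupp.ofSupportFinite f (by
    obtain ⟨N, hN⟩ := h
    refine (Set.finite_Iio N).subset fun i hi => ?_
    by_contra hc
    exact hi (hN i (not_lt.1 hc)))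
  antitone' := fun _ _ hij => hf hij

@[simp] theorem part_ofFun (f : ℕ → ℕ) (hf : Antitone f) (h) (i : ℕ) :
    (ofFun f hf h).part i = f i := rfl

theorem eq_of_size_eq {a b : Ptn} (hab : HStrip a b) (h : a.size = b.size) : a = b := by
  obtain ⟨N, hN⟩ := a.exists_part_eq_zero
  obtain ⟨N', hN'⟩ := b.exists_part_eq_zero
  rw [a.size_eq (N := max N N') (fun i hi => hN i (le_trans (le_max_left _ _) hi)),
    b.size_eq (N := max N N') (fun i hi => hN' i (le_trans (le_max_right _ _) hi))] at h
  have := (Finset.sum_eq_sum_iff_of_le (fun i _ => (hab i).1)).1 h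
  ext i
  by_cases hi : i < max N N'
  · exact this i (Finset.mem_range.2 hi)
  · rw [hN i (le_trans (le_max_left _ _) (not_lt.1 hi)),
      hN' i (le_trans (le_max_right _ _) (not_lt.1 hi))]

theorem size_le {a b : Ptn} (hab : HStrip a b) : a.size ≤ b.size := by
  obtain ⟨N, hN⟩ := a.exists_part_eq_zero
  obtain ⟨N', hN'⟩ := b.exists_part_eq_zero
  rw [a.size_eq (N := max N N') (fun i hi => hN i (le_trans (le_max_left _ _) hi)),
    b.size_eq (N := max N N') (fun i hi => hN' i (le_trans (le_max_right _ _) hi))]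
  exact Finset.sum_le_sum fun i _ => (hab i).1

theorem hStrip_refl (a : Ptn) : HStrip a a := fun i => ⟨le_rfl, a.part_anti (Nat.le_succ i)⟩

/-- The parts of the partition obtained from the valley `c` between `a` and `b` by toggling,
with first part exceeding its minimum by `k`. -/
def peakFun (a b c : Ptn) (k : ℕ) : ℕ → ℕ
  | 0 => max (a.part 0) (b.part 0) + k
  | i + 1 => min (a.part i) (b.part i) + max (a.part (i + 1)) (b.part (i + 1)) - c.part i

theorem valley_bounds {a b c : Ptn} (ha : HStrip c a) (hb : HStrip c b) (i : ℕ) :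
    max (a.part (i + 1)) (b.part (i + 1)) ≤ c.part i ∧ c.part i ≤ min (a.part i) (b.part i) :=
  ⟨max_le (ha i).2 (hb i).2, le_min (ha i).1 (hb i).1⟩

theorem peak_bounds {a b c : Ptn} (ha : HStrip a c) (hb : HStrip b c) (i : ℕ) :
    max (a.part i) (b.part i) ≤ c.part i ∧ c.part (i + 1) ≤ min (a.part i) (b.part i) :=
  ⟨max_le (ha i).1 (hb i).1, le_min (ha i).2 (hb i).2⟩

theorem peakFun_bounds {a b c : Ptn} (ha : HStrip c a) (hb : HStrip c b) (k i : ℕ) :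
    max (a.part i) (b.part i) ≤ peakFun a b c k i ∧
      peakFun a b c k (i + 1) ≤ min (a.part i) (b.part i) := by
  have h1 := valley_bounds ha hb i
  constructor
  · cases i with
    | zero => simp [peakFun]
    | succ j =>
      have := valley_bounds ha hb j
      simp only [peakFun]
      omega
  · simp only [peakFun]
    omega

/-- The peak above `a` and `b` obtained from the valley `c` by toggling. -/
noncomputable def peak (a b c : Ptn) (k : ℕ) (ha : HStrip c a) (hb : HStrip c b) : Ptn :=
  ofFun (peakFun a b c k)
    (antitone_nat_of_succ_le fun i => by
      have := peakFun_bounds ha hb k i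
      omega)
    (by
      obtain ⟨N, hN⟩ := a.exists_part_eq_zero
      refine ⟨N + 1, fun i hi => ?_⟩
      obtain ⟨j, rfl⟩ : ∃ j, i = j + 1 := ⟨i - 1, by omega⟩
      have := (peakFun_bounds ha hb k j).2
      have := hN j (by omega)
      omega)

/-- The valley below `a` and `b` obtained from the peak `c` by toggling. -/
noncomputable def valley (a b c : Ptn) (ha : HStrip a c) (hb : HStrip b c) : Ptn :=
  ofFun (fun i => min (a.part i) (b.part i) + max (a.part (i + 1)) (b.part (i + 1)) -
      c.part (i + 1))
    (antitone_nat_of_succ_le fun i => by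
      have h1 := peak_bounds ha hb i
      have h2 := peak_bounds ha hb (i + 1)
      have h3 := peak_bounds ha hb (i + 1 + 1)
      omega)
    (by
      obtain ⟨N, hN⟩ := a.exists_part_eq_zero
      refine ⟨N, fun i hi => ?_⟩
      have h2 := peak_bounds ha hb (i + 1)
      have := hN i hi
      omega)

/-- Toggling: peaks above `a` and `b` correspond to valleys below `a` and `b` together with a
natural number. -/
noncomputable def peakEquiv (a b : Ptn) :
    {c : Ptn // HStrip a c ∧ HStrip b c} ≃ ℕ × {c : Ptn // HStrip c a ∧ HStrip c b} where
  toFun c := ⟨c.1.part 0 - max (a.part 0) (b.part 0), valley a b c.1 c.2.1 c.2.2, by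
    constructor <;> intro i <;>
    · have h1 := peak_bounds c.2.1 c.2.2 i
      have h2 := peak_bounds c.2.1 c.2.2 (i + 1)
      simp only [valley, part_ofFun]
      omega⟩
  invFun p := ⟨peak a b p.2.1 p.1 p.2.2.1 p.2.2.2, by
    constructor <;> intro i <;>
    · have h1 := peakFun_bounds p.2.2.1 p.2.2.2 p.1 i
      simp only [peak, part_ofFun]
      omega⟩
  left_inv c := by
    obtain ⟨c, hc⟩ := c
    refine Subtype.ext (ext_part fun i => ?_)
    cases i with
    | zero =>
      have h1 := peak_bounds hc.1 hc.2 0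
      simp only [peak, part_ofFun, peakFun]
      omega
    | succ i =>
      have h1 := peak_bounds hc.1 hc.2 i
      have h2 := peak_bounds hc.1 hc.2 (i + 1)
      simp only [peak, part_ofFun, peakFun, valley]
      omega
  right_inv p := by
    obtain ⟨k, c, hc⟩ := p
    refine Prod.ext ?_ (Subtype.ext (ext_part fun i => ?_))
    · simp [peak, peakFun]
    · have h1 := valley_bounds hc.1 hc.2 i
      simp only [peak, part_ofFun, peakFun, valley]
      omega

theorem size_peak (a b : Ptn) (p : ℕ × {c : Ptn // HStrip c a ∧ HStrip c b}) :
    ((peakEquiv a b).symm p).1.size + p.2.1.size = a.size + b.size + p.1 := by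
  obtain ⟨k, c, hc⟩ := p
  obtain ⟨N, hN⟩ := a.exists_part_eq_zero
  obtain ⟨N', hN'⟩ := b.exists_part_eq_zero
  set n := max N N'
  have ha : ∀ i, n ≤ i → a.part i = 0 := fun i hi => hN i (le_trans (le_max_left _ _) hi)
  have hb : ∀ i, n ≤ i → b.part i = 0 := fun i hi => hN' i (le_trans (le_max_right _ _) hi)
  have hcc : ∀ i, n ≤ i → c.part i = 0 := fun i hi => by
    have := (hc.1 i).1
    have := ha i hi
    omega
  have hpart : ∀ i, ((peakEquiv a b).symm (k, ⟨c, hc⟩)).1.part i = peakFun a b c k i :=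
    fun i => rfl
  have hp : ∀ i, n + 1 ≤ i → ((peakEquiv a b).symm (k, ⟨c, hc⟩)).1.part i = 0 := fun i hi => by
    obtain ⟨j, rfl⟩ : ∃ j, i = j + 1 := ⟨i - 1, by omega⟩
    rw [hpart]
    have := (peakFun_bounds hc.1 hc.2 k j).2
    have := ha j (by omega)
    omega
  rw [size_eq _ hp, a.size_eq ha, b.size_eq hb, c.size_eq hcc, Finset.sum_range_succ']
  simp only [hpart]
  have key : ∑ i ∈ Finset.range n, peakFun a b c k (i + 1) + ∑ i ∈ Finset.range n, c.part i =
      ∑ i ∈ Finset.range n, min (a.part i) (b.part i) +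
        ∑ i ∈ Finset.range n, max (a.part (i + 1)) (b.part (i + 1)) := by
    rw [← Finset.sum_add_distrib, ← Finset.sum_add_distrib]
    refine Finset.sum_congr rfl fun i _ => ?_
    have h1 := valley_bounds hc.1 hc.2 i
    simp only [peakFun]
    omega
  have hmax : ∑ i ∈ Finset.range n, max (a.part (i + 1)) (b.part (i + 1)) +
      max (a.part 0) (b.part 0) = ∑ i ∈ Finset.range n, max (a.part i) (b.part i) := by
    rw [← Finset.sum_range_succ' (fun i => max (a.part i) (b.part i)), Finset.sum_range_succ,
      ha n le_rfl, hb n le_rfl]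
    simp
  have hsum : ∑ i ∈ Finset.range n, min (a.part i) (b.part i) +
      ∑ i ∈ Finset.range n, max (a.part i) (b.part i) =
      ∑ i ∈ Finset.range n, a.part i + ∑ i ∈ Finset.range n, b.part i := by
    rw [← Finset.sum_add_distrib, ← Finset.sum_add_distrib]
    exact Finset.sum_congr rfl fun i _ => min_add_max _ _
  simp only [peakFun] at key ⊢
  omega

open Classical in
theorem tsum_peak (a b : Ptn) (F : ℤ → ENNReal) :
    ∑' c : Ptn, (if HStrip a c ∧ HStrip b c then F c.size else 0) =
      ∑' k : ℕ, ∑' c : Ptn,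
        (if HStrip c a ∧ HStrip c b then F (a.size + b.size + k - c.size) else 0) := by
  have h1 : ∑' c : Ptn, (if HStrip a c ∧ HStrip b c then F c.size else 0) =
      ∑' c : {c : Ptn // HStrip a c ∧ HStrip b c}, F c.1.size :=
    ((tsum_subtype {c : Ptn | HStrip a c ∧ HStrip b c} (fun c => F c.size)).trans
      (tsum_congr fun c => by simp [Set.indicator_apply])).symm
  have h2 : ∀ k : ℕ, ∑' c : Ptn,
      (if HStrip c a ∧ HStrip c b then F (a.size + b.size + k - c.size) else 0) =
      ∑' c : {c : Ptn // HStrip c a ∧ HStrip c b}, F (a.size + b.size + k - c.1.size) := fun k =>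
    ((tsum_subtype {c : Ptn | HStrip c a ∧ HStrip c b}
      (fun c => F (a.size + b.size + k - c.size))).trans
      (tsum_congr fun c => by simp [Set.indicator_apply])).symm
  simp_rw [h1, h2]
  rw [← (peakEquiv a b).symm.tsum_eq, ENNReal.tsum_prod']
  refine tsum_congr fun k => tsum_congr fun c => congrArg F ?_
  have := size_peak a b (k, c)
  push_cast [← @Nat.cast_inj ℤ] at this
  linarith

end Ptn

namespace Ptn

/-- One step of a chain: upward for `true`, downward for `false`. -/
def Step (σ : Bool) (a b : Ptn) : Prop := if σ then HStrip a b else HStrip b a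

@[simp] theorem step_true {a b : Ptn} : Step true a b ↔ HStrip a b := by simp [Step]

@[simp] theorem step_false {a b : Ptn} : Step false a b ↔ HStrip b a := by simp [Step]

open Classical in
/-- The generating function of chains of partitions starting at a given partition, where each
step carries a direction and a position. -/
noncomputable def transfer (x : ENNReal) (T : ℤ) : List (Bool × ℤ) → Ptn → ENNReal
  | [], a => x ^ (T * a.size)
  | s :: l, a => ∑' b : Ptn,
      if Step s.1 a b then x ^ (s.2 * (a.size - b.size)) * transfer x T l b else 0

/-- The generating function of chains of partitions with free ends. -/
noncomputable def chainSum (x : ENNReal) (T : ℤ) (l : List (Bool × ℤ)) : ENNReal :=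
  ∑' a : Ptn, transfer x T l a

/-- The geometric series `1 / (1 - x ^ e)`. -/
noncomputable def geo (x : ENNReal) (e : ℤ) : ENNReal := (1 - x ^ e)⁻¹

variable {x : ENNReal}

theorem zpow_natCast_mul (h0 : x ≠ 0) (ht : x ≠ ⊤) (k : ℕ) (e : ℤ) :
    x ^ ((k : ℤ) * e) = (x ^ e) ^ k := by
  induction k with
  | zero => simp
  | succ k ih => rw [pow_succ, ← ih, ← ENNReal.zpow_add h0 ht]; congr 1; push_cast; ring

theorem tsum_zpow_natCast_mul (h0 : x ≠ 0) (ht : x ≠ ⊤) (e : ℤ) :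
    ∑' k : ℕ, x ^ ((k : ℤ) * e) = geo x e := by
  rw [geo, ← ENNReal.tsum_geometric]
  exact tsum_congr fun k => zpow_natCast_mul h0 ht k e

theorem transfer_congr {T : ℤ} {l l' : List (Bool × ℤ)} {c : ENNReal}
    (h : ∀ a, transfer x T l a = c * transfer x T l' a) (s : Bool × ℤ) (a : Ptn) :
    transfer x T (s :: l) a = c * transfer x T (s :: l') a := by
  simp only [transfer]
  rw [← ENNReal.tsum_mul_left]
  refine tsum_congr fun b => ?_
  split_ifs
  · rw [h, mul_left_comm]
  · simp

theorem transfer_peak (h0 : x ≠ 0) (ht : x ≠ ⊤) (T p q : ℤ) (l : List (Bool × ℤ)) (a : Ptn) :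
    transfer x T ((true, p) :: (false, q) :: l) a =
      geo x (q - p) * transfer x T ((false, q) :: (true, p) :: l) a := by
  classical
  simp only [transfer, step_true, step_false]
  have hL : ∀ c b : Ptn, (if HStrip a c then x ^ (p * (a.size - c.size : ℤ)) *
      (if HStrip b c then x ^ (q * (c.size - b.size : ℤ)) * transfer x T l b else 0) else 0) =
      transfer x T l b * (if HStrip a c ∧ HStrip b c then
        x ^ (p * (a.size - c.size : ℤ) + q * (c.size - b.size)) else 0) := by
    intro c b
    by_cases h1 : HStrip a c <;> by_cases h2 : HStrip b c <;> simp [h1, h2]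
    rw [ENNReal.zpow_add h0 ht]
    ring
  have hR : ∀ c b : Ptn, (if HStrip c a then x ^ (q * (a.size - c.size : ℤ)) *
      (if HStrip c b then x ^ (p * (c.size - b.size : ℤ)) * transfer x T l b else 0) else 0) =
      transfer x T l b * (if HStrip c a ∧ HStrip c b then
        x ^ (q * (a.size - c.size : ℤ) + p * (c.size - b.size)) else 0) := by
    intro c b
    by_cases h1 : HStrip c a <;> by_cases h2 : HStrip c b <;> simp [h1, h2]
    rw [ENNReal.zpow_add h0 ht]
    ring
  have expand : ∀ (P : Ptn → Prop) (f : Ptn → ENNReal) (g : Ptn → Ptn → ENNReal),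
      ∑' c, (if P c then f c * ∑' b, g c b else 0) =
        ∑' b, ∑' c, (if P c then f c * g c b else 0) := by
    intro P f g
    rw [ENNReal.tsum_comm]
    refine tsum_congr fun c => ?_
    split_ifs
    · rw [ENNReal.tsum_mul_left]
    · simp
  rw [expand, expand]
  simp_rw [hL, hR]
  rw [← ENNReal.tsum_mul_left]
  refine tsum_congr fun b => ?_
  rw [ENNReal.tsum_mul_left, ENNReal.tsum_mul_left, 
    tsum_peak a b (fun n : ℤ => x ^ (p * (a.size - n) + q * (n - b.size))),
    ← tsum_zpow_natCast_mul h0 ht,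
    mul_left_comm, ← ENNReal.tsum_mul_right]
  congr 1
  refine tsum_congr fun k => ?_
  rw [← ENNReal.tsum_mul_left]
  refine tsum_congr fun c => ?_
  split_ifs
  · rw [← ENNReal.zpow_add h0 ht]
    congr 1
    ring
  · simp

theorem chainSum_reflect_left (h0 : x ≠ 0) (ht : x ≠ ⊤) (T p : ℤ) (l : List (Bool × ℤ)) :
    chainSum x T ((false, p) :: l) = geo x p * chainSum x T ((true, -p) :: l) := by
  classical
  simp only [chainSum, transfer, step_true, step_false]
  conv_lhs => rw [ENNReal.tsum_comm]
  conv_rhs => rw [ENNReal.tsum_comm]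
  rw [← ENNReal.tsum_mul_left]
  refine tsum_congr fun b => ?_
  have hL : ∀ a : Ptn, (if HStrip b a then x ^ (p * (a.size - b.size : ℤ)) * transfer x T l b
      else 0) = transfer x T l b * (if HStrip b a ∧ HStrip b a then
        x ^ (p * (a.size - b.size : ℤ)) else 0) := by
    intro a
    split_ifs <;> simp_all [mul_comm]
  have hR : ∀ a : Ptn, (if HStrip a b then x ^ (-p * (a.size - b.size : ℤ)) * transfer x T l b
      else 0) = transfer x T l b * (if HStrip a b ∧ HStrip a b then
        x ^ (-p * (a.size - b.size : ℤ)) else 0) := by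
    intro a
    split_ifs <;> simp_all [mul_comm]
  simp_rw [hL, hR]
  rw [ENNReal.tsum_mul_left, ENNReal.tsum_mul_left,
    tsum_peak b b (fun n : ℤ => x ^ (p * (n - b.size))), ← tsum_zpow_natCast_mul h0 ht,
    mul_left_comm, ← ENNReal.tsum_mul_right]
  congr 1
  refine tsum_congr fun k => ?_
  rw [← ENNReal.tsum_mul_left]
  refine tsum_congr fun c => ?_
  split_ifs
  · rw [← ENNReal.zpow_add h0 ht]
    congr 1
    ring
  · simp

theorem transfer_reflect_right (h0 : x ≠ 0) (ht : x ≠ ⊤) (T p : ℤ) (a : Ptn) :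
    transfer x T [(true, p)] a = geo x (T - p) * transfer x T [(false, 2 * T - p)] a := by
  classical
  simp only [transfer, step_true, step_false]
  have hL : ∀ b : Ptn, (if HStrip a b then x ^ (p * (a.size - b.size : ℤ)) * x ^ (T * b.size)
      else 0) = (if HStrip a b ∧ HStrip a b then
        x ^ (p * (a.size - b.size : ℤ) + T * b.size) else 0) := by
    intro b
    simp [ENNReal.zpow_add h0 ht]
  simp_rw [hL]
  rw [tsum_peak a a (fun n : ℤ => x ^ (p * (a.size - n) + T * n)),
    ← tsum_zpow_natCast_mul h0 ht, ← ENNReal.tsum_mul_right]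
  refine tsum_congr fun k => ?_
  rw [← ENNReal.tsum_mul_left]
  refine tsum_congr fun c => ?_
  by_cases h : HStrip c a
  · simp only [h, and_self, if_true]
    rw [← ENNReal.zpow_add h0 ht, ← ENNReal.zpow_add h0 ht]
    congr 1
    ring
  · simp [h]

/-- The list of downward steps with given positions. -/
def downs (l : List ℤ) : List (Bool × ℤ) := l.map fun p => (false, p)

theorem transfer_up_downs (h0 : x ≠ 0) (ht : x ≠ ⊤) (T p : ℤ) (l : List ℤ) (a : Ptn) :
    transfer x T ((true, p) :: downs l) a =
      ((l.map fun q => geo x (q - p)).prod * geo x (T - p)) *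
        transfer x T (downs (l ++ [2 * T - p])) a := by
  induction l generalizing a with
  | nil => simpa [downs] using transfer_reflect_right h0 ht T p a
  | cons q l ih =>
    have h := transfer_congr ih (false, q) a
    simp only [downs, List.map_cons, List.cons_append, List.prod_cons] at h ⊢
    rw [transfer_peak h0 ht, h]
    ring

/-- The positions of the downward steps into which a chain can be turned. -/
def canon (T : ℤ) : List (Bool × ℤ) → List ℤ
  | [] => []
  | (false, p) :: l => p :: canon T l
  | (true, p) :: l => canon T l ++ [2 * T - p]

/-- The factor arising when turning all steps into downward ones. -/
noncomputable def canonFactor (x : ENNReal) (T : ℤ) : List (Bool × ℤ) → ENNReal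
  | [] => 1
  | (false, _) :: l => canonFactor x T l
  | (true, p) :: l =>
      canonFactor x T l * (((canon T l).map fun q => geo x (q - p)).prod * geo x (T - p))

theorem transfer_canon (h0 : x ≠ 0) (ht : x ≠ ⊤) (T : ℤ) (l : List (Bool × ℤ)) (a : Ptn) :
    transfer x T l a = canonFactor x T l * transfer x T (downs (canon T l)) a := by
  induction l generalizing a with
  | nil => simp [canonFactor, canon, downs]
  | cons s l ih =>
    obtain ⟨σ, p⟩ := s
    rw [transfer_congr ih]
    cases σ with
    | false => simp [canonFactor, canon, downs]
    | true => rw [transfer_up_downs h0 ht, canonFactor, canon, mul_assoc, mul_assoc,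
        mul_assoc]

theorem chainSum_canon (h0 : x ≠ 0) (ht : x ≠ ⊤) (T : ℤ) (l : List (Bool × ℤ)) :
    chainSum x T l = canonFactor x T l * chainSum x T (downs (canon T l)) := by
  rw [chainSum, chainSum, ← ENNReal.tsum_mul_left]
  exact tsum_congr fun a => transfer_canon h0 ht T l a

theorem chainSum_downs_cons (h0 : x ≠ 0) (ht : x ≠ ⊤) (T p : ℤ) (l : List ℤ) :
    chainSum x T (downs (p :: l)) =
      (geo x p * geo x (T + p) * (l.map fun q => geo x (p + q)).prod) *
        chainSum x T (downs (l ++ [2 * T + p])) := by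
  have h : chainSum x T ((true, -p) :: downs l) = ((l.map fun q => geo x (q - -p)).prod *
      geo x (T - -p)) * chainSum x T (downs (l ++ [2 * T - -p])) := by
    rw [chainSum, chainSum, ← ENNReal.tsum_mul_left]
    exact tsum_congr fun a => transfer_up_downs h0 ht T (-p) l a
  have h2 := chainSum_reflect_left h0 ht T p (downs l)
  simp only [downs, List.map_cons] at h h2 ⊢
  rw [h2, h]
  simp only [sub_neg_eq_add]
  simp_rw [add_comm _ p]
  rw [add_comm p T, add_comm p (2 * T)]
  ring

/-- The product of `f (p + q)` over pairs of entries of a list. -/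
noncomputable def pairProd (f : ℤ → ENNReal) : List ℤ → ENNReal
  | [] => 1
  | p :: l => (l.map fun q => f (p + q)).prod * pairProd f l

theorem chainSum_downs_rotate (h0 : x ≠ 0) (ht : x ≠ ⊤) (T : ℤ) (l l' : List ℤ) :
    chainSum x T (downs (l ++ l')) =
      (l.map fun p => geo x p * geo x (T + p)).prod * pairProd (geo x) l *
        pairProd (fun e => geo x (2 * T + e)) l *
        (l.map fun p => (l'.map fun q => geo x (p + q)).prod).prod *
        chainSum x T (downs (l' ++ l.map fun p => 2 * T + p)) := by
  induction l generalizing l' with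
  | nil => simp [pairProd]
  | cons p l ih =>
    rw [List.cons_append, chainSum_downs_cons h0 ht, List.append_assoc, ih]
    simp only [List.map_append, List.prod_append, List.map_cons, List.prod_cons, List.map_nil,
      List.prod_nil, mul_one, List.prod_map_mul, pairProd, List.append_assoc, List.singleton_append]
    have : ∀ q, q + (2 * T + p) = 2 * T + (p + q) := fun q => by ring
    simp_rw [this]
    ring

theorem chainSum_downs_shift (h0 : x ≠ 0) (ht : x ≠ ⊤) (T : ℤ) (l : List ℤ) :
    chainSum x T (downs l) =
      ((l.map fun p => geo x p * geo x (T + p)).prod * pairProd (geo x) l *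
        pairProd (fun e => geo x (2 * T + e)) l) *
        chainSum x T (downs (l.map fun p => 2 * T + p)) := by
  simpa using chainSum_downs_rotate h0 ht T l []

end Ptn

namespace Ptn

/-- Removing the full columns of height `N + 1` from a partition with at most `N + 1` parts. -/
noncomputable def columnEquiv (N : ℕ) :
    {a : Ptn // a.part (N + 1) = 0} ≃ ℕ × {a : Ptn // a.part N = 0} where
  toFun a := ⟨a.1.part N, ofFun (fun i => a.1.part i - a.1.part N)
    (by intro i j hij; exact Nat.sub_le_sub_right (a.1.part_anti hij) _)
    ⟨N, fun _ hi => Nat.sub_eq_zero_of_le (a.1.part_anti hi)⟩, Nat.sub_self _⟩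
  invFun p := ⟨ofFun (fun i => if i ≤ N then p.2.1.part i + p.1 else 0)
    (by
      intro i j hij
      have := p.2.1.part_anti hij
      dsimp only
      split_ifs <;> omega)
    ⟨N + 1, fun i hi => if_neg (by omega)⟩, if_neg (by omega)⟩
  left_inv a := by
    refine Subtype.ext (ext_part fun i => ?_)
    simp only [part_ofFun]
    split_ifs with h
    · exact Nat.sub_add_cancel (a.1.part_anti h)
    · have := a.1.part_anti (show N + 1 ≤ i by omega)
      have := a.2
      omega
  right_inv p := by
    obtain ⟨c, a, ha⟩ := p
    refine Prod.ext (by simp [ha]) (Subtype.ext (ext_part fun i => ?_))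
    simp only [part_ofFun, le_refl, if_true, ha]
    split_ifs with h
    · omega
    · have := a.part_anti (show N ≤ i by omega)
      omega

theorem size_columnEquiv_symm (N : ℕ) (p : ℕ × {a : Ptn // a.part N = 0}) :
    ((columnEquiv N).symm p).1.size = p.2.1.size + (N + 1) * p.1 := by
  obtain ⟨c, a, ha⟩ := p
  have h1 : ∀ i, N ≤ i → a.part i = 0 := fun i hi => by
    have := a.part_anti hi
    omega
  have hpart : ∀ i, ((columnEquiv N).symm (c, ⟨a, ha⟩)).1.part i =
      if i ≤ N then a.part i + c else 0 := fun i => rfl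
  rw [size_eq _ (N := N + 1) (fun i hi => by rw [hpart]; exact if_neg (by omega)),
    a.size_eq (N := N + 1) (fun i hi => h1 i (by omega))]
  simp_rw [hpart]
  rw [Finset.sum_congr rfl (g := fun i => a.part i + c) fun i hi =>
    if_pos (by have := Finset.mem_range.1 hi; omega)]
  rw [Finset.sum_add_distrib]
  simp

theorem tsum_pow_size_le (x : ENNReal) (N : ℕ) :
    ∑' a : {a : Ptn // a.part N = 0}, x ^ a.1.size =
      ∏ i ∈ Finset.range N, (1 - x ^ (i + 1))⁻¹ := by
  induction N with
  | zero =>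
    have : ∀ a : {a : Ptn // a.part 0 = 0}, x ^ a.1.size = 1 := fun a => by
      rw [a.1.size_eq (N := 0) (fun i hi => by have := a.1.part_anti hi; have := a.2; omega)]
      simp
    let z : {a : Ptn // a.part 0 = 0} := ⟨ofFun 0 (fun _ _ _ => le_rfl) ⟨0, fun _ _ => rfl⟩, rfl⟩
    have hu : ∀ a, a = z := fun a => Subtype.ext (ext_part fun i => by
      have := a.1.part_anti (Nat.zero_le i)
      have := a.2
      change a.1.part i = 0
      omega)
    rw [tsum_eq_single z fun b hb => absurd (hu b) hb, this]
    simp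
  | succ N ih =>
    rw [← (columnEquiv N).symm.tsum_eq, ENNReal.tsum_prod', Finset.prod_range_succ, ← ih,
      mul_comm, ← ENNReal.tsum_geometric, ← ENNReal.tsum_mul_right]
    refine tsum_congr fun k => ?_
    rw [← ENNReal.tsum_mul_left]
    refine tsum_congr fun a => ?_
    rw [size_columnEquiv_symm, pow_add, ← pow_mul, mul_comm]

theorem tsum_pow_size (x : ENNReal) :
    ∑' a : Ptn, x ^ a.size = ⨆ N, ∏ i ∈ Finset.range N, (1 - x ^ (i + 1))⁻¹ := by
  apply le_antisymm
  · rw [ENNReal.tsum_eq_iSup_sum]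
    refine iSup_le fun s => ?_
    choose f hf using fun a : Ptn => a.exists_part_eq_zero
    refine le_iSup_of_le (s.sup f) ?_
    rw [← tsum_pow_size_le]
    have hs : ∀ a ∈ s, a.part (s.sup f) = 0 := fun a ha => hf a _ (Finset.le_sup ha)
    calc ∑ a ∈ s, x ^ a.size = ∑' a : s, x ^ a.1.size :=
          (Finset.tsum_subtype s fun a => x ^ a.size).symm
      _ ≤ _ := ENNReal.tsum_comp_le_tsum_of_injective
          (f := fun a : s => (⟨a.1, hs a.1 a.2⟩ : {a : Ptn // a.part (s.sup f) = 0}))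
          (fun a b hab => Subtype.ext (congrArg (fun c => c.1) hab))
          (fun a => x ^ a.1.size)
  · refine iSup_le fun N => ?_
    rw [← tsum_pow_size_le]
    exact ENNReal.tsum_comp_le_tsum_of_injective Subtype.val_injective (fun a : Ptn => x ^ a.size)

variable {x : ENNReal}

/-- The generating function of partitions. -/
noncomputable def partitionSum (x : ENNReal) : ENNReal := ∑' a : Ptn, x ^ a.size

theorem le_chainSum_downs (T : ℤ) (l : List ℤ) :
    ∑' a : Ptn, x ^ (T * a.size) ≤ chainSum x T (downs l) := by
  classical
  refine ENNReal.tsum_le_tsum fun a => ?_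
  induction l with
  | nil => simp [downs, transfer]
  | cons p l ih =>
    simp only [downs, List.map_cons, transfer] at ih ⊢
    refine le_trans ?_ (ENNReal.le_tsum a)
    simpa [hStrip_refl] using ih

theorem zpow_le_zpow_of_le_one (hx : x ≤ 1) {a b : ℤ} (h : a ≤ b) : x ^ b ≤ x ^ a := by
  have := ENNReal.zpow_le_of_le (ENNReal.one_le_inv.2 hx) (neg_le_neg h)
  simpa [ENNReal.inv_zpow'] using this

theorem transfer_downs_add_le (h0 : x ≠ 0) (hx : x ≤ 1) (T : ℤ) (l : List ℤ) (c : ℤ) (hc : 0 ≤ c)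
    (a : Ptn) :
    transfer x T (downs (l.map fun p => c + p)) a ≤ transfer x T (downs l) a ∧
    transfer x T (downs (l.map fun p => c + p)) a ≤
      x ^ (T * a.size) + x ^ c * transfer x T (downs l) a := by
  classical
  have ht : x ≠ ⊤ := ne_top_of_le_ne_top ENNReal.one_ne_top hx
  induction l generalizing a with
  | nil => simp [downs, transfer]
  | cons p l ih =>
    simp only [downs, List.map_cons, transfer, step_false] at ih ⊢
    constructor
    · refine ENNReal.tsum_le_tsum fun b => ?_
      split_ifs with h
      · refine mul_le_mul' (zpow_le_zpow_of_le_one hx ?_) (ih b).1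
        have : (b.size : ℤ) ≤ a.size := by exact_mod_cast size_le h
        nlinarith
      · exact le_rfl
    · have key : ∀ b : Ptn, (if HStrip b a then x ^ ((c + p) * (a.size - b.size : ℤ)) *
          transfer x T (List.map (fun p => (false, p)) (List.map (fun p => c + p) l)) b else 0) ≤
          (if b = a then x ^ (T * a.size) else 0) + x ^ c * (if HStrip b a then
            x ^ (p * (a.size - b.size : ℤ)) * transfer x T (List.map (fun p => (false, p)) l) b
              else 0) := by
        intro b
        by_cases hba : b = a
        · subst hba
          simpa [hStrip_refl] using (ih b).2
        by_cases h : HStrip b a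
        · simp only [h, if_true, hba, if_false, zero_add]
          rw [← mul_assoc, ← ENNReal.zpow_add h0 ht]
          refine mul_le_mul' (zpow_le_zpow_of_le_one hx ?_) (ih b).1
          have h1 : (b.size : ℤ) ≤ a.size := by exact_mod_cast size_le h
          have h2 : (b.size : ℤ) ≠ a.size := fun hh => hba (eq_of_size_eq h (by exact_mod_cast hh))
          have h3 : (1 : ℤ) ≤ a.size - b.size := by omega
          nlinarith
        · simp [h]
      refine (ENNReal.tsum_le_tsum key).trans ?_
      rw [ENNReal.tsum_add, tsum_ite_eq, ENNReal.tsum_mul_left]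

theorem chainSum_downs_add_le (h0 : x ≠ 0) (hx : x ≤ 1) (T : ℤ) (l : List ℤ) (c : ℤ)
    (hc : 0 ≤ c) :
    chainSum x T (downs (l.map fun p => c + p)) ≤
      ∑' a : Ptn, x ^ (T * a.size) + x ^ c * chainSum x T (downs l) := by
  rw [chainSum, chainSum, ← ENNReal.tsum_mul_left, ← ENNReal.tsum_add]
  exact ENNReal.tsum_le_tsum fun a => (transfer_downs_add_le h0 hx T l c hc a).2

end Ptn

namespace Ptn

variable {x : ENNReal}

/-- The steps with indices `k + 1, …, k + h` of a profile. -/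
def profileSteps (δ : ℕ → ℤ) (k : ℕ) : ℕ → List (Bool × ℤ)
  | 0 => []
  | h + 1 => (decide (δ (k + 1) = 1), (k : ℤ) + 1) :: profileSteps δ (k + 1) h

theorem isDSPP_cons (h : ℕ) (δ : ℕ → ℤ) (a : Ptn) (L : Fin (h + 1) → Ptn) :
    IsDSPP (h + 2) δ (Fin.cons a L) ↔
      Step (decide (δ 1 = 1)) a (L 0) ∧ IsDSPP (h + 1) (fun i => δ (i + 1)) L := by
  constructor
  · intro H
    refine ⟨?_, fun i hi => ?_⟩
    · have := H 0 (by omega)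
      simpa [Step] using this
    · exact H (i + 1) (by omega)
  · rintro ⟨h1, h2⟩ i hi
    cases i with
    | zero => simpa [Step] using h1
    | succ i => exact h2 i (by omega)

theorem tsum_fin_cons (h : ℕ) (F : (Fin (h + 1) → Ptn) → ENNReal) :
    ∑' L, F L = ∑' (a : Ptn) (L : Fin h → Ptn), F (Fin.cons a L) := by
  rw [← (Fin.consEquiv fun _ : Fin (h + 1) => Ptn).tsum_eq, ENNReal.tsum_prod']
  rfl

open Classical in
theorem transfer_profileSteps (h0 : x ≠ 0) (ht : x ≠ ⊤) (δ : ℕ → ℤ) (h k : ℕ) (a : Ptn) :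
    transfer x (k + h + 1 : ℕ) (profileSteps δ k h) a =
      x ^ ((k : ℤ) * a.size) * ∑' L : Fin h → Ptn,
        if IsDSPP (h + 1) (fun i => δ (k + i)) (Fin.cons a L) then
          x ^ (∑ i, ((Fin.cons a L : Fin (h + 1) → Ptn) i).size) else 0 := by
  induction h generalizing k a with
  | zero =>
    have : ∀ L : Fin 0 → Ptn, IsDSPP (0 + 1) (fun i => δ (k + i)) (Fin.cons a L) :=
      fun L i hi => absurd hi (by omega)
    simp only [profileSteps, transfer, this, if_true]
    rw [tsum_fintype]
    simp only [Finset.univ_unique, Finset.sum_singleton]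
    simp only [Fin.sum_univ_succ, Fin.cons_zero]
    rw [Finset.sum_of_isEmpty, add_zero, ← zpow_natCast, ← ENNReal.zpow_add h0 ht]
    congr 1
    push_cast
    ring
  | succ h ih =>
    simp only [profileSteps, transfer]
    rw [tsum_fin_cons, ← ENNReal.tsum_mul_left]
    refine tsum_congr fun b => ?_
    have e1 : k + (h + 1) + 1 = k + 1 + h + 1 := by ring
    rw [e1, ih, ← ENNReal.tsum_mul_left]
    simp only [isDSPP_cons, Fin.cons_zero]
    have e2 : (fun i => δ (k + (i + 1))) = fun i => δ (k + 1 + i) :=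
      funext fun i => congrArg δ (by ring)
    rw [e2]
    by_cases hs : Step (decide (δ (k + 1) = 1)) a b
    · simp only [hs, if_true, true_and]
      rw [← ENNReal.tsum_mul_left, ← ENNReal.tsum_mul_left]
      refine tsum_congr fun L => ?_
      split_ifs
      · rw [Fin.sum_univ_succ (n := h + 1), ← zpow_natCast, ← zpow_natCast,
          ← ENNReal.zpow_add h0 ht, ← ENNReal.zpow_add h0 ht, ← ENNReal.zpow_add h0 ht]
        simp only [Fin.cons_zero, Fin.cons_succ]
        congr 1
        push_cast
        ring
      · simp
    · simp [hs]

open Classical in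
theorem chainSum_profileSteps (h0 : x ≠ 0) (ht : x ≠ ⊤) (δ : ℕ → ℤ) (h : ℕ) :
    chainSum x (h + 1 : ℕ) (profileSteps δ 0 h) =
      ∑' L : Fin (h + 1) → Ptn, if IsDSPP (h + 1) δ L then x ^ (∑ i, (L i).size) else 0 := by
  rw [tsum_fin_cons, chainSum]
  refine tsum_congr fun a => ?_
  have := transfer_profileSteps h0 ht δ h 0 a
  simp only [zero_add] at this
  rw [this]
  simp

theorem transfer_profileSteps_le (h0 : x ≠ 0) (ht : x ≠ ⊤) (δ : ℕ → ℤ) (h k : ℕ) (a : Ptn) :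
    transfer x (k + h + 1 : ℕ) (profileSteps δ k h) a ≤
      x ^ (((k : ℤ) + 1) * a.size) * partitionSum x ^ h := by
  classical
  induction h generalizing k a with
  | zero => simp [profileSteps, transfer]
  | succ h ih =>
    simp only [profileSteps, transfer]
    rw [show k + (h + 1) + 1 = k + 1 + h + 1 by ring, pow_succ', partitionSum,
      ← ENNReal.tsum_mul_right, ← ENNReal.tsum_mul_left]
    refine ENNReal.tsum_le_tsum fun b => ?_
    split_ifs
    · refine (mul_le_mul_right (ih (k + 1) b) _).trans (le_of_eq ?_)
      rw [← mul_assoc, ← mul_assoc, ← zpow_natCast x b.size, ← ENNReal.zpow_add h0 ht,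
        ← ENNReal.zpow_add h0 ht, partitionSum]
      congr 2
      push_cast
      ring
    · exact zero_le

theorem chainSum_profileSteps_le (h0 : x ≠ 0) (ht : x ≠ ⊤) (δ : ℕ → ℤ) (h : ℕ) :
    chainSum x (h + 1 : ℕ) (profileSteps δ 0 h) ≤ partitionSum x ^ (h + 1) := by
  rw [pow_succ', partitionSum, ← ENNReal.tsum_mul_right]
  refine ENNReal.tsum_le_tsum fun a => ?_
  have := transfer_profileSteps_le h0 ht δ h 0 a
  simpa [partitionSum] using this

theorem tsum_DSPPcount (h0 : x ≠ 0) (ht : x ≠ ⊤) (hfin : partitionSum x ≠ ⊤) (δ : ℕ → ℤ) (h : ℕ) :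
    ∑' n : ℕ, (DSPPcount (h + 1) δ n : ENNReal) * x ^ n =
      chainSum x (h + 1 : ℕ) (profileSteps δ 0 h) := by
  classical
  have hle := chainSum_profileSteps_le h0 ht δ h
  have hne : chainSum x (h + 1 : ℕ) (profileSteps δ 0 h) ≠ ⊤ :=
    ne_top_of_le_ne_top (ENNReal.pow_ne_top hfin) hle
  have hsum : chainSum x (h + 1 : ℕ) (profileSteps δ 0 h) = ∑' n : ℕ,
      ∑' L : {L : Fin (h + 1) → Ptn // IsDSPP (h + 1) δ L ∧ ∑ i, (L i).size = n}, x ^ n := by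
    rw [chainSum_profileSteps h0 ht]
    have h1 : ∀ n : ℕ, ∑' L : {L : Fin (h + 1) → Ptn // IsDSPP (h + 1) δ L ∧
        ∑ i, (L i).size = n}, x ^ n = ∑' L : Fin (h + 1) → Ptn,
          if IsDSPP (h + 1) δ L ∧ ∑ i, (L i).size = n then x ^ n else 0 := fun n =>
      (tsum_subtype {L : Fin (h + 1) → Ptn | IsDSPP (h + 1) δ L ∧ ∑ i, (L i).size = n}
        (fun _ => x ^ n)).trans (tsum_congr fun L => by simp [Set.indicator_apply])
    simp_rw [h1]
    rw [ENNReal.tsum_comm]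
    refine tsum_congr fun L => ?_
    by_cases hL : IsDSPP (h + 1) δ L
    · simp only [hL, true_and, if_true]
      rw [tsum_eq_single (∑ i, (L i).size) fun n hn => if_neg (Ne.symm hn)]
      simp
    · simp [hL]
  rw [hsum] at hne ⊢
  refine tsum_congr fun n => ?_
  rw [ENNReal.tsum_const]
  have hn := ENNReal.ne_top_of_tsum_ne_top hne n
  rw [ENNReal.tsum_const] at hn
  have hfinite : Finite {L : Fin (h + 1) → Ptn // IsDSPP (h + 1) δ L ∧ ∑ i, (L i).size = n} := by
    by_contra hc
    rw [not_finite_iff_infinite] at hc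
    rw [ENat.card_eq_top_of_infinite] at hn
    simp [ENNReal.top_mul, h0] at hn
  rw [DSPPcount, ENat.card_eq_coe_natCard]
  simp

end Ptn

namespace Ptn

open Filter Topology

/-- The logarithm of `1 / (1 - z ^ e)`. -/
noncomputable def ell (z : ℝ) (e : ℤ) : ℝ := -Real.log (1 - z ^ e)

/-- The logarithm of the product of `1 / (1 - z ^ e)` over `e = t, t + M, t + 2 M, …`. -/
noncomputable def ellSum (z : ℝ) (M t : ℤ) : ℝ := ∑' k : ℕ, ell z (t + M * k)

variable {z : ℝ}

theorem ell_bounds (h0 : 0 < z) (h1 : z < 1) {e : ℤ} (he : 0 < e) :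
    0 ≤ ell z e ∧ ell z e ≤ z ^ e / (1 - z) := by
  have hp : 0 < z ^ e := zpow_pos h0 e
  have hle : z ^ e ≤ z := by
    simpa using zpow_le_zpow_right_of_le_one₀ h0 h1.le (show (1 : ℤ) ≤ e by omega)
  have hlt : 0 < 1 - z := by linarith
  constructor
  · have := Real.log_nonpos (x := 1 - z ^ e) (by linarith) (by linarith)
    simpa [ell] using this
  · have h2 := Real.one_sub_inv_le_log_of_pos (show 0 < 1 - z ^ e by linarith)
    have h3 : (1 - z ^ e)⁻¹ - 1 = z ^ e / (1 - z ^ e) := by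
      have : 1 - z ^ e ≠ 0 := by linarith
      field_simp
      ring
    have h4 : z ^ e / (1 - z ^ e) ≤ z ^ e / (1 - z) := by gcongr
    unfold ell
    linarith

theorem ell_progression_le (h0 : 0 < z) (h1 : z < 1) {M t : ℤ} (hM : 0 < M) (ht : 0 < t) (k : ℕ) :
    0 ≤ ell z (t + M * k) ∧ ell z (t + M * k) ≤ z ^ t / (1 - z) * z ^ k := by
  have hk : (k : ℤ) ≤ M * k := by nlinarith
  have hb := ell_bounds h0 h1 (show 0 < t + M * k by nlinarith)
  refine ⟨hb.1, hb.2.trans ?_⟩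
  have : z ^ (t + M * k) ≤ z ^ t * z ^ k := by
    rw [← zpow_natCast z k, ← zpow_add₀ h0.ne']
    exact zpow_le_zpow_right_of_le_one₀ h0 h1.le (by omega)
  have hlt : 0 < 1 - z := by linarith
  rw [div_mul_eq_mul_div]
  gcongr

theorem summable_ell (h0 : 0 < z) (h1 : z < 1) {M t : ℤ} (hM : 0 < M) (ht : 0 < t) :
    Summable fun k : ℕ => ell z (t + M * k) :=
  Summable.of_nonneg_of_le (fun k => (ell_progression_le h0 h1 hM ht k).1)
    (fun k => (ell_progression_le h0 h1 hM ht k).2)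
    ((summable_geometric_of_lt_one h0.le h1).mul_left _)

theorem ellSum_succ (h0 : 0 < z) (h1 : z < 1) {M t : ℤ} (hM : 0 < M) (ht : 0 < t) :
    ellSum z M t = ell z t + ellSum z M (M + t) := by
  rw [ellSum, (summable_ell h0 h1 hM ht).tsum_eq_zero_add, ellSum]
  simp only [Nat.cast_zero, mul_zero, add_zero]
  congr 1
  refine tsum_congr fun k => ?_
  congr 1
  push_cast
  ring

theorem tendsto_ellSum (h0 : 0 < z) (h1 : z < 1) {M t c : ℤ} (hM : 0 < M) (ht : 0 < t)
    (hc : 0 < c) : Tendsto (fun K : ℕ => ellSum z M (c * K + t)) atTop (𝓝 0) := by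
  have hpos : ∀ K : ℕ, 0 < c * K + t := fun K => by positivity
  refine squeeze_zero (g := fun K : ℕ => 1 / (1 - z) * (1 - z)⁻¹ * z ^ K)
    (fun K => tsum_nonneg fun k => (ell_progression_le h0 h1 hM (hpos K) k).1) (fun K => ?_) ?_
  · have h2 := (summable_ell h0 h1 hM (hpos K)).tsum_le_tsum
      (fun k => (ell_progression_le h0 h1 hM (hpos K) k).2)
      ((summable_geometric_of_lt_one h0.le h1).mul_left _)
    rw [tsum_mul_left, tsum_geometric_of_lt_one h0.le h1] at h2
    refine h2.trans ?_
    have h3 : z ^ (c * K + t) ≤ z ^ K := by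
      rw [← zpow_natCast]
      exact zpow_le_zpow_right_of_le_one₀ h0 h1.le (by nlinarith)
    have hlt : 0 < 1 - z := by linarith
    calc z ^ (c * K + t) / (1 - z) * (1 - z)⁻¹ ≤ z ^ K / (1 - z) * (1 - z)⁻¹ := by gcongr
      _ = _ := by ring
  · simpa using (tendsto_pow_atTop_nhds_zero_of_lt_one h0.le h1).const_mul
      (1 / (1 - z) * (1 - z)⁻¹)

theorem geo_ofReal (h0 : 0 < z) (h1 : z < 1) {e : ℤ} (he : 0 < e) :
    geo (ENNReal.ofReal z) e = ENNReal.ofReal (Real.exp (ell z e)) := by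
  obtain ⟨n, rfl⟩ := Int.eq_ofNat_of_zero_le he.le
  have hlt : z ^ n < 1 := pow_lt_one₀ h0.le h1 (by rintro rfl; simp at he)
  rw [geo, ell, zpow_natCast, zpow_natCast, Real.exp_neg,
    Real.exp_log (by linarith),
    ENNReal.ofReal_inv_of_pos (by linarith), ENNReal.ofReal_sub _ (by positivity),
    ENNReal.ofReal_one, ENNReal.ofReal_pow h0.le]

theorem ofReal_exp_add (a b : ℝ) : ENNReal.ofReal (Real.exp (a + b)) =
    ENNReal.ofReal (Real.exp a) * ENNReal.ofReal (Real.exp b) := by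
  rw [Real.exp_add, ENNReal.ofReal_mul (Real.exp_pos _).le]

theorem prod_map_geo (h0 : 0 < z) (h1 : z < 1) (l : List ℤ) (f : ℤ → ℤ) (hl : ∀ q ∈ l, 0 < f q) :
    (l.map fun q => geo (ENNReal.ofReal z) (f q)).prod =
      ENNReal.ofReal (Real.exp (l.map fun q => ell z (f q)).sum) := by
  induction l with
  | nil => simp
  | cons q l ih =>
    simp only [List.map_cons, List.prod_cons, List.sum_cons, ofReal_exp_add]
    rw [ih fun q hq => hl q (List.mem_cons_of_mem _ hq), geo_ofReal h0 h1 (hl q List.mem_cons_self)]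

/-- The sum of `f (p + q)` over pairs of entries of a list. -/
noncomputable def pairSum (f : ℤ → ℝ) : List ℤ → ℝ
  | [] => 0
  | p :: l => (l.map fun q => f (p + q)).sum + pairSum f l

theorem pairProd_geo (h0 : 0 < z) (h1 : z < 1) (l : List ℤ) (c : ℤ) (hc : 0 ≤ c)
    (hl : ∀ q ∈ l, 0 < q) :
    pairProd (fun e => geo (ENNReal.ofReal z) (c + e)) l =
      ENNReal.ofReal (Real.exp (pairSum (fun e => ell z (c + e)) l)) := by
  induction l with
  | nil => simp [pairProd, pairSum]
  | cons p l ih =>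
    have hp := hl p List.mem_cons_self
    have hl' : ∀ q ∈ l, 0 < q := fun q hq => hl q (List.mem_cons_of_mem _ hq)
    rw [pairProd, pairSum, ofReal_exp_add, ih hl',
      prod_map_geo h0 h1 l (fun q => c + (p + q)) fun q hq => by have := hl' q hq; omega]

/-- The logarithm of the infinite product attached to a chain of downward steps. -/
noncomputable def ellTotal (z : ℝ) (T : ℤ) (l : List ℤ) : ℝ :=
  (l.map fun p => ellSum z T p).sum + pairSum (ellSum z (2 * T)) l

theorem pairSum_ellSum (h0 : 0 < z) (h1 : z < 1) {M : ℤ} (hM : 0 < M) (l : List ℤ)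
    (hl : ∀ q ∈ l, 0 < q) :
    pairSum (ellSum z M) l =
      pairSum (ell z) l + pairSum (fun e => ellSum z M (M + e)) l := by
  induction l with
  | nil => simp [pairSum]
  | cons p l ih =>
    have hp := hl p List.mem_cons_self
    have hl' : ∀ q ∈ l, 0 < q := fun q hq => hl q (List.mem_cons_of_mem _ hq)
    simp only [pairSum]
    rw [ih hl', List.map_congr_left (g := fun q => ell z (p + q) + ellSum z M (M + (p + q)))
      fun q hq => ellSum_succ h0 h1 hM (by have := hl' q hq; omega), List.sum_map_add]
    ring

theorem pairSum_map_add (f : ℤ → ℝ) (c : ℤ) (l : List ℤ) :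
    pairSum f (l.map fun p => c + p) = pairSum (fun e => f (2 * c + e)) l := by
  induction l with
  | nil => simp [pairSum]
  | cons p l ih =>
    simp only [pairSum, List.map_cons, ih, List.map_map]
    congr 2
    refine List.map_congr_left fun q _ => ?_
    simp only [Function.comp_apply]
    congr 1
    ring

theorem ellTotal_shift (h0 : 0 < z) (h1 : z < 1) {T : ℤ} (hT : 0 < T) (l : List ℤ)
    (hl : ∀ q ∈ l, 0 < q) :
    ellTotal z T l = ((l.map fun p => ell z p + ell z (T + p)).sum + pairSum (ell z) l +
      pairSum (fun e => ell z (2 * T + e)) l) + ellTotal z T (l.map fun p => 2 * T + p) := by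
  have e1 : (l.map fun p => ellSum z T p).sum = (l.map fun p => ell z p + ell z (T + p)).sum +
      (l.map fun p => ellSum z T (2 * T + p)).sum := by
    rw [← List.sum_map_add]
    congr 1
    refine List.map_congr_left fun p hp => ?_
    have := hl p hp
    rw [ellSum_succ h0 h1 hT this, ellSum_succ h0 h1 hT (show 0 < T + p by omega),
      show T + (T + p) = 2 * T + p by ring]
    ring
  have e2 : pairSum (fun e => ellSum z (2 * T) (2 * T + e)) l =
      pairSum (fun e => ell z (2 * T + e)) l +
        pairSum (fun e => ellSum z (2 * T) (2 * (2 * T) + e)) l := by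
    have := pairSum_ellSum h0 h1 (show 0 < 2 * T by omega) (l.map fun p => T + p) (by
      intro q hq
      obtain ⟨p, hp, rfl⟩ := List.mem_map.1 hq
      have := hl p hp
      omega)
    simp only [pairSum_map_add] at this
    rw [this]
    congr 2
    funext e
    rw [← add_assoc]
    congr 1
    ring
  rw [ellTotal, ellTotal, e1, pairSum_ellSum h0 h1 (by omega) l hl, e2, pairSum_map_add,
    List.map_map]
  simp only [Function.comp_def]
  ring

theorem chainSum_downs_shift_ofReal (h0 : 0 < z) (h1 : z < 1) {T : ℤ} (hT : 0 < T) (l : List ℤ)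
    (hl : ∀ q ∈ l, 0 < q) :
    chainSum (ENNReal.ofReal z) T (downs l) =
      ENNReal.ofReal (Real.exp (ellTotal z T l - ellTotal z T (l.map fun p => 2 * T + p))) *
        chainSum (ENNReal.ofReal z) T (downs (l.map fun p => 2 * T + p)) := by
  rw [chainSum_downs_shift (by simpa using h0) ENNReal.ofReal_ne_top,
    ellTotal_shift h0 h1 hT l hl, add_sub_cancel_right, ofReal_exp_add, ofReal_exp_add,
    pairProd_geo h0 h1 l (2 * T) (by omega) hl, List.prod_map_mul,
    prod_map_geo h0 h1 l (fun p => p) hl,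
    prod_map_geo h0 h1 l (fun p => T + p) (fun q hq => by have := hl q hq; omega),
    ← ofReal_exp_add, ← List.sum_map_add]
  have := pairProd_geo h0 h1 l 0 le_rfl hl
  simp only [zero_add] at this
  rw [this]

theorem chainSum_downs_iterate (h0 : 0 < z) (h1 : z < 1) {T : ℤ} (hT : 0 < T) (l : List ℤ)
    (hl : ∀ q ∈ l, 0 < q) (K : ℕ) :
    chainSum (ENNReal.ofReal z) T (downs l) =
      ENNReal.ofReal (Real.exp (ellTotal z T l - ellTotal z T (l.map fun p => 2 * T * K + p))) *
        chainSum (ENNReal.ofReal z) T (downs (l.map fun p => 2 * T * K + p)) := by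
  induction K with
  | zero => simp
  | succ K ih =>
    rw [ih, chainSum_downs_shift_ofReal h0 h1 hT (l.map fun p => 2 * T * K + p) (by
      intro q hq
      obtain ⟨p, hp, rfl⟩ := List.mem_map.1 hq
      have := hl p hp
      positivity), ← mul_assoc, ← ofReal_exp_add]
    have : (l.map fun p => 2 * T * K + p).map (fun p => 2 * T + p) =
        l.map fun p => 2 * T * (K + 1 : ℕ) + p := by
      rw [List.map_map]
      refine List.map_congr_left fun p _ => ?_
      simp only [Function.comp_apply]
      push_cast
      ring
    rw [this]
    congr 3
    ring

theorem tendsto_list_sum {ι : Type*} (l : List ι) (f : ι → ℕ → ℝ)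
    (hf : ∀ i ∈ l, Tendsto (f i) atTop (𝓝 0)) :
    Tendsto (fun K => (l.map fun i => f i K).sum) atTop (𝓝 0) := by
  induction l with
  | nil => simp
  | cons a l ih =>
    simpa using (hf a List.mem_cons_self).add (ih fun i hi => hf i (List.mem_cons_of_mem _ hi))

theorem tendsto_ellTotal (h0 : 0 < z) (h1 : z < 1) {T : ℤ} (hT : 0 < T) (l : List ℤ)
    (hl : ∀ q ∈ l, 0 < q) :
    Tendsto (fun K : ℕ => ellTotal z T (l.map fun p => 2 * T * K + p)) atTop (𝓝 0) := by
  have e1 : Tendsto (fun K : ℕ => (l.map fun p => ellSum z T (2 * T * K + p)).sum) atTop (𝓝 0) :=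
    tendsto_list_sum l _ fun p hp => tendsto_ellSum h0 h1 hT (hl p hp) (by omega)
  have e2 : Tendsto (fun K : ℕ => pairSum (fun e => ellSum z (2 * T) (4 * T * K + e)) l) atTop
      (𝓝 0) := by
    clear e1
    induction l with
    | nil => simp [pairSum]
    | cons p l ih =>
      have hp := hl p List.mem_cons_self
      have hl' : ∀ q ∈ l, 0 < q := fun q hq => hl q (List.mem_cons_of_mem _ hq)
      simpa [pairSum] using (tendsto_list_sum l (fun q K => ellSum z (2 * T) (4 * T * K + (p + q)))
        fun q hq => tendsto_ellSum h0 h1 (by omega) (by have := hl' q hq; omega)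
          (by omega)).add (ih hl')
  have := e1.add e2
  rw [add_zero] at this
  refine this.congr fun K => ?_
  rw [ellTotal, pairSum_map_add, List.map_map]
  congr 2
  funext e
  congr 1
  ring

theorem partitionSum_ofReal (h0 : 0 < z) (h1 : z < 1) {T : ℕ} (hT : 0 < T) :
    partitionSum (ENNReal.ofReal z ^ T) = ENNReal.ofReal (Real.exp (ellSum z T T)) := by
  have hT' : (0 : ℤ) < T := by exact_mod_cast hT
  rw [partitionSum, tsum_pow_size]
  have hprod : ∀ N, ∏ i ∈ Finset.range N, (1 - (ENNReal.ofReal z ^ T) ^ (i + 1))⁻¹ =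
      ENNReal.ofReal (Real.exp (∑ i ∈ Finset.range N, ell z (T + T * i))) := by
    intro N
    induction N with
    | zero => simp
    | succ N ih =>
      rw [Finset.prod_range_succ, ih, Finset.sum_range_succ, ofReal_exp_add,
        ← geo_ofReal h0 h1 (by positivity), geo]
      congr 3
      rw [← pow_mul, ← zpow_natCast]
      congr 1
      push_cast
      ring
  simp_rw [hprod]
  refine iSup_eq_of_tendsto (fun a b hab => ?_) ?_
  · refine ENNReal.ofReal_le_ofReal (Real.exp_le_exp.2 ?_)
    exact Finset.sum_le_sum_of_subset_of_nonneg (Finset.range_mono hab)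
      fun i _ _ => (ell_progression_le h0 h1 hT' hT' i).1
  · exact (ENNReal.continuous_ofReal.tendsto _).comp ((Real.continuous_exp.tendsto _).comp
      (summable_ell h0 h1 hT' hT').hasSum.tendsto_sum_nat)

theorem chainSum_downs_eq (h0 : 0 < z) (h1 : z < 1) {T : ℕ} (hT : 0 < T) (l : List ℤ)
    (hl : ∀ q ∈ l, 0 < q) (hfin : chainSum (ENNReal.ofReal z) T (downs l) ≠ ⊤) :
    chainSum (ENNReal.ofReal z) T (downs l) =
      ENNReal.ofReal (Real.exp (ellTotal z T l + ellSum z T T)) := by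
  have hT' : (0 : ℤ) < T := by exact_mod_cast hT
  have hx0 : ENNReal.ofReal z ≠ 0 := by simpa using h0
  have hx1 : ENNReal.ofReal z ≤ 1 := by simpa using h1.le
  have hR : ∑' a : Ptn, ENNReal.ofReal z ^ ((T : ℤ) * a.size) =
      ENNReal.ofReal (Real.exp (ellSum z T T)) := by
    rw [← partitionSum_ofReal h0 h1 hT, partitionSum]
    refine tsum_congr fun a => ?_
    rw [← pow_mul, ← zpow_natCast]
    push_cast
    rfl
  have hlim : Tendsto (fun K : ℕ => chainSum (ENNReal.ofReal z) T
      (downs (l.map fun p => 2 * T * K + p))) atTop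
      (𝓝 (ENNReal.ofReal (Real.exp (ellSum z T T)))) := by
    refine tendsto_of_tendsto_of_tendsto_of_le_of_le (g := fun _ => _)
      (h := fun K : ℕ => ENNReal.ofReal (Real.exp (ellSum z T T)) +
        ENNReal.ofReal z ^ K * chainSum (ENNReal.ofReal z) T (downs l)) tendsto_const_nhds ?_ ?_ ?_
    · have : Tendsto (fun K : ℕ => ENNReal.ofReal z ^ K *
          chainSum (ENNReal.ofReal z) T (downs l)) atTop (𝓝 0) := by
        have := ENNReal.Tendsto.mul_const (b := chainSum (ENNReal.ofReal z) T (downs l))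
          (ENNReal.tendsto_pow_atTop_nhds_zero_of_lt_one (r := ENNReal.ofReal z)
            (by simpa using h1)) (Or.inr hfin)
        simpa using this
      simpa using this.const_add (ENNReal.ofReal (Real.exp (ellSum z T T)))
    · intro K
      rw [← hR]
      exact le_chainSum_downs _ _
    · intro K
      dsimp only
      rw [← hR]
      refine (chainSum_downs_add_le hx0 hx1 T l (2 * T * K) (by positivity)).trans ?_
      gcongr
      rw [← zpow_natCast]
      refine zpow_le_zpow_of_le_one hx1 ?_
      nlinarith
  have hexp : Tendsto (fun K : ℕ => ENNReal.ofReal (Real.exp (ellTotal z T l -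
      ellTotal z T (l.map fun p => 2 * T * K + p)))) atTop
      (𝓝 (ENNReal.ofReal (Real.exp (ellTotal z T l)))) := by
    refine (ENNReal.continuous_ofReal.tendsto _).comp ((Real.continuous_exp.tendsto _).comp ?_)
    simpa using (tendsto_ellTotal h0 h1 hT' l hl).const_sub (ellTotal z T l)
  have hmul := ENNReal.Tendsto.mul hexp (Or.inr ENNReal.ofReal_ne_top) hlim
    (Or.inr ENNReal.ofReal_ne_top)
  rw [ofReal_exp_add]
  refine tendsto_nhds_unique (tendsto_const_nhds.congr fun K => ?_) hmul
  exact chainSum_downs_iterate h0 h1 hT' l hl K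

end Ptn

namespace Ptn

variable {z : ℝ}

theorem mem_canon_profileSteps {T : ℤ} (δ : ℕ → ℤ) (k h : ℕ) (hT : (k : ℤ) + h + 1 ≤ T) {q : ℤ}
    (hq : q ∈ canon T (profileSteps δ k h)) : (k : ℤ) < q ∧ q < 2 * T - k := by
  induction h generalizing k with
  | zero => simp [profileSteps, canon] at hq
  | succ h ih =>
    have ih' := ih (k + 1) (by push_cast at hT ⊢; omega)
    push_cast at ih' hT
    by_cases hd : δ (k + 1) = 1
    · simp only [profileSteps, hd, decide_true, canon, List.mem_append, List.mem_singleton] at hq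
      rcases hq with hq | rfl
      · have := ih' hq; omega
      · omega
    · simp only [profileSteps, hd, decide_false, canon, List.mem_cons] at hq
      rcases hq with rfl | hq
      · omega
      · have := ih' hq; omega

/-- The logarithm of the factor arising when turning all steps into downward ones. -/
noncomputable def canonLog (z : ℝ) (T : ℤ) : List (Bool × ℤ) → ℝ
  | [] => 0
  | (false, _) :: l => canonLog z T l
  | (true, p) :: l =>
      canonLog z T l + (((canon T l).map fun q => ell z (q - p)).sum + ell z (T - p))

theorem canonFactor_profileSteps (h0 : 0 < z) (h1 : z < 1) {T : ℤ} (δ : ℕ → ℤ) (k h : ℕ)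
    (hT : (k : ℤ) + h + 1 ≤ T) :
    canonFactor (ENNReal.ofReal z) T (profileSteps δ k h) =
      ENNReal.ofReal (Real.exp (canonLog z T (profileSteps δ k h))) := by
  induction h generalizing k with
  | zero => simp [profileSteps, canonFactor, canonLog]
  | succ h ih =>
    push_cast at hT
    have hT' : ((k + 1 : ℕ) : ℤ) + h + 1 ≤ T := by push_cast; omega
    by_cases hd : δ (k + 1) = 1
    · simp only [profileSteps, hd, decide_true, canonFactor, canonLog]
      rw [ih _ hT', ofReal_exp_add, ofReal_exp_add, geo_ofReal h0 h1 (by omega),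
        prod_map_geo h0 h1 _ (fun q => q - (k + 1))]
      intro q hq
      have := mem_canon_profileSteps δ (k + 1) h hT' hq
      push_cast at this
      omega
    · simp only [profileSteps, hd, decide_false, canonFactor, canonLog]
      exact ih _ hT'

theorem sum_map_canon (T : ℤ) (δ : ℕ → ℤ) (k h : ℕ) (f : ℤ → ℝ) :
    ((canon T (profileSteps δ k h)).map f).sum =
      ∑ i ∈ Finset.Ico (k + 1) (k + h + 1), f (if δ i = 1 then 2 * T - i else i) := by
  induction h generalizing k with
  | zero => simp [profileSteps, canon]
  | succ h ih =>
    rw [Finset.sum_eq_sum_Ico_succ_bot (by omega)]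
    have := ih (k + 1)
    rw [show k + 1 + h + 1 = k + (h + 1) + 1 by ring] at this
    rw [← this]
    by_cases hd : δ (k + 1) = 1
    · simp [profileSteps, hd, canon, add_comm]
    · simp [profileSteps, hd, canon]

theorem pairSum_concat (f : ℤ → ℝ) (l : List ℤ) (r : ℤ) :
    pairSum f (l ++ [r]) = pairSum f l + (l.map fun q => f (q + r)).sum := by
  induction l with
  | nil => simp [pairSum]
  | cons p l ih =>
    simp only [List.cons_append, pairSum, ih, List.map_append, List.map_cons, List.map_nil,
      List.sum_append, List.sum_cons, List.sum_nil]
    ring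

/-- The element of the multiset `W2` attached to the pair of indices `i < j`. -/
def pairWeight (T : ℤ) (δ : ℕ → ℤ) (i j : ℕ) : ℤ :=
  if δ i = 1 then (if δ j = 1 then 2 * T - i - j else j - i)
  else (if δ j = 1 then 2 * T + i - j else i + j)

theorem canonLog_add_ellTotal (h0 : 0 < z) (h1 : z < 1) {T : ℤ} (δ : ℕ → ℤ) (k h : ℕ)
    (hT : (k : ℤ) + h + 1 ≤ T) :
    canonLog z T (profileSteps δ k h) + ellTotal z T (canon T (profileSteps δ k h)) =
      ∑ i ∈ Finset.Ico (k + 1) (k + h + 1),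
        (ellSum z T (if δ i = 1 then T - i else i) +
          ∑ j ∈ Finset.Ico (i + 1) (k + h + 1), ellSum z (2 * T) (pairWeight T δ i j)) := by
  induction h generalizing k with
  | zero => simp [profileSteps, canonLog, ellTotal, canon, pairSum]
  | succ h ih =>
    push_cast at hT
    have hT' : ((k + 1 : ℕ) : ℤ) + h + 1 ≤ T := by push_cast; omega
    rw [Finset.sum_eq_sum_Ico_succ_bot (by omega)]
    have ih' := ih (k + 1) hT'
    have hs := fun f => sum_map_canon T δ (k + 1) h f
    rw [show k + 1 + h + 1 = k + (h + 1) + 1 by ring] at ih' hs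
    rw [← ih']
    simp only [ellTotal, pairWeight]
    by_cases hd : δ (k + 1) = 1
    · simp only [profileSteps, hd, decide_true, canonLog, canon, if_true]
      rw [List.map_append, List.sum_append, pairSum_concat]
      have e1 : ∑ j ∈ Finset.Ico (k + 1 + 1) (k + (h + 1) + 1), ellSum z (2 * T)
          (if δ j = 1 then 2 * T - ((k + 1 : ℕ) : ℤ) - j else j - ((k + 1 : ℕ) : ℤ)) =
          ((canon T (profileSteps δ (k + 1) h)).map
            fun q => ell z (q - (k + 1)) + ellSum z (2 * T) (q + (2 * T - (k + 1)))).sum := by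
        rw [List.map_congr_left (g := fun q => ellSum z (2 * T) (q - (k + 1)))]
        · rw [hs]
          refine Finset.sum_congr rfl fun j _ => ?_
          split_ifs
          · congr 1; push_cast; ring
          · congr 1
        · intro q hq
          have := mem_canon_profileSteps δ (k + 1) h hT' hq
          push_cast at this
          rw [ellSum_succ h0 h1 (t := q - (k + 1)) (by omega) (by omega)]
          congr 2
          ring
      have e2 : ellSum z T (T - (k + 1 : ℕ)) = ell z (T - (k + 1)) +
          ellSum z T (2 * T - (k + 1)) := by
        push_cast
        rw [ellSum_succ h0 h1 (t := T - (k + 1)) (by omega) (by omega)]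
        congr 2
        ring
      rw [e1, e2, List.sum_map_add]
      simp only [List.map_cons, List.map_nil, List.sum_cons, List.sum_nil]
      ring
    · simp only [profileSteps, hd, decide_false, canonLog, canon, if_false]
      rw [List.map_cons, List.sum_cons, pairSum, hs fun q => ellSum z (2 * T) (k + 1 + q)]
      have e1 : ∑ j ∈ Finset.Ico (k + 1 + 1) (k + (h + 1) + 1), ellSum z (2 * T)
          (k + 1 + (if δ j = 1 then 2 * T - j else j)) =
          ∑ j ∈ Finset.Ico (k + 1 + 1) (k + (h + 1) + 1), ellSum z (2 * T)
          (if δ j = 1 then 2 * T + ((k + 1 : ℕ) : ℤ) - j else ((k + 1 : ℕ) : ℤ) + j) := by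
        refine Finset.sum_congr rfl fun j _ => ?_
        split_ifs
        · congr 1; push_cast; ring
        · congr 1
      rw [e1]
      push_cast
      ring

theorem sum_map_W1 {m : ℕ} {δ : ℕ → ℤ} (hδ : IsProfile (m - 1) δ) (f : ℤ → ℝ) :
    ((W1 m δ).map fun t : ℕ => f t).sum =
      f m + ∑ i ∈ Finset.Icc 1 (m - 1), f (if δ i = 1 then (m : ℤ) - i else i) := by
  rw [W1, Multiset.map_cons, Multiset.sum_cons, Multiset.map_map]
  congr 1
  refine Finset.sum_congr rfl fun i hi => ?_
  rw [Finset.mem_Icc] at hi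
  rcases hδ i hi.1 hi.2 with h | h
  · simp [h]
    congr 1
    omega
  · simp [h]

theorem sum_map_W2 {m : ℕ} {δ : ℕ → ℤ} (hδ : IsProfile (m - 1) δ) (f : ℤ → ℝ) :
    ((W2 m δ).map fun t : ℕ => f t).sum =
      ∑ i ∈ Finset.Icc 1 (m - 1), ∑ j ∈ Finset.Ico (i + 1) m, f (pairWeight m δ i j) := by
  rw [W2, Multiset.map_map]
  change ∑ q ∈ _, _ = _
  rw [Finset.sum_filter, Finset.sum_product]
  refine Finset.sum_congr rfl fun i hi => ?_
  rw [Finset.mem_Icc] at hi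
  rw [← Finset.sum_filter]
  have : (Finset.Icc 1 (m - 1)).filter (fun j => i < j) = Finset.Ico (i + 1) m := by
    ext j
    simp only [Finset.mem_filter, Finset.mem_Icc, Finset.mem_Ico]
    omega
  rw [this]
  refine Finset.sum_congr rfl fun j hj => ?_
  rw [Finset.mem_Ico] at hj
  simp only [Function.comp_apply, pairWeight]
  congr 1
  rcases hδ i hi.1 hi.2 with h | h <;> rcases hδ j (by omega) (by omega) with h' | h' <;>
    simp [h, h'] <;> omega

theorem tsum_DSPPcount_ofReal (h0 : 0 < z) (h1 : z < 1) {m : ℕ} (hm : 1 ≤ m) {δ : ℕ → ℤ}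
    (hδ : IsProfile (m - 1) δ) :
    ∑' n : ℕ, (DSPPcount m δ n : ENNReal) * ENNReal.ofReal z ^ n =
      ENNReal.ofReal (Real.exp (((W1 m δ).map fun t : ℕ => ellSum z m t).sum +
        ((W2 m δ).map fun t : ℕ => ellSum z (2 * m) t).sum)) := by
  obtain ⟨h, rfl⟩ := Nat.exists_eq_add_of_le' hm
  have hx0 : ENNReal.ofReal z ≠ 0 := by simpa using h0
  have hfin : partitionSum (ENNReal.ofReal z) ≠ ⊤ := by
    have := partitionSum_ofReal h0 h1 one_pos
    rw [pow_one] at this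
    rw [this]
    exact ENNReal.ofReal_ne_top
  have hT : ((0 : ℕ) : ℤ) + h + 1 ≤ ((h + 1 : ℕ) : ℤ) := by push_cast; omega
  have hne : chainSum (ENNReal.ofReal z) (h + 1 : ℕ) (profileSteps δ 0 h) ≠ ⊤ :=
    ne_top_of_le_ne_top (ENNReal.pow_ne_top hfin)
      (chainSum_profileSteps_le hx0 ENNReal.ofReal_ne_top δ h)
  rw [tsum_DSPPcount hx0 ENNReal.ofReal_ne_top hfin]
  rw [chainSum_canon hx0 ENNReal.ofReal_ne_top, canonFactor_profileSteps h0 h1 δ 0 h hT] at hne ⊢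
  have hne' : chainSum (ENNReal.ofReal z) (h + 1 : ℕ)
      (downs (canon (h + 1 : ℕ) (profileSteps δ 0 h))) ≠ ⊤ := by
    intro H
    rw [H, ENNReal.mul_top (by simpa using Real.exp_pos _)] at hne
    exact hne rfl
  rw [chainSum_downs_eq h0 h1 (by omega) _ (fun q hq => by
    simpa using (mem_canon_profileSteps δ 0 h hT hq).1) hne', ← ofReal_exp_add, ← add_assoc,
    canonLog_add_ellTotal h0 h1 δ 0 h hT, Finset.sum_add_distrib, sum_map_W1 hδ, sum_map_W2 hδ]
  have hI : Finset.Ico (0 + 1) (0 + h + 1) = Finset.Icc 1 (h + 1 - 1) := by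
    ext j
    simp only [Finset.mem_Icc, Finset.mem_Ico]
    omega
  rw [hI]
  congr 2
  simp only [zero_add]
  ring

end Ptn

namespace Ptn

open Filter Topology

/-- The geometric progression `w ^ t + w ^ (t + M) + …` in closed form. -/
noncomputable def lam (M t : ℕ) (w : ℂ) : ℂ := w ^ t / (1 - w ^ M)

/-- The logarithm of the product of `1 / (1 - z ^ e)` over `e = t, t + M, t + 2 M, …`, as a
function of a complex variable. -/
noncomputable def lamLog (M t : ℕ) (z : ℂ) : ℂ := ∑' j : ℕ, lam M t (z ^ (j + 1)) / (j + 1)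

variable {M t : ℕ}

theorem hasSum_lam (hM : 0 < M) {w : ℂ} (hw : ‖w‖ < 1) :
    HasSum (fun l : ℕ => w ^ (t + M * l)) (lam M t w) := by
  have h : ‖w ^ M‖ < 1 := by rw [norm_pow]; exact pow_lt_one₀ (norm_nonneg _) hw hM.ne'
  have := (hasSum_geometric_of_norm_lt_one h).mul_left (w ^ t)
  simpa only [lam, div_eq_mul_inv, pow_add, pow_mul] using this

theorem norm_lam_le (hM : 0 < M) (ht : 0 < t) {w : ℂ} {r : ℝ} (hw : ‖w‖ ≤ r) (hr : r < 1) :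
    ‖lam M t w‖ ≤ r / (1 - r) := by
  have h0 := norm_nonneg w
  have hM' : ‖w‖ ^ M ≤ ‖w‖ := pow_le_of_le_one h0 (by linarith) hM.ne'
  have ht' : ‖w‖ ^ t ≤ ‖w‖ := pow_le_of_le_one h0 (by linarith) ht.ne'
  have h1 : 1 - ‖w‖ ≤ ‖1 - w ^ M‖ := by
    have := norm_sub_norm_le (1 : ℂ) (w ^ M)
    rw [norm_one, norm_pow] at this
    linarith
  rw [lam, norm_div, norm_pow]
  have : 0 < 1 - r := by linarith
  exact div_le_div₀ (by linarith) (by linarith) this (by linarith)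

theorem norm_lamLog_term_le (hM : 0 < M) (ht : 0 < t) {z : ℂ} {r : ℝ} (hz : ‖z‖ ≤ r) (hr : r < 1)
    (j : ℕ) : ‖lam M t (z ^ (j + 1)) / (j + 1)‖ ≤ r ^ j / (1 - r) := by
  have h0 : 0 ≤ r := (norm_nonneg z).trans hz
  have hp : r ^ (j + 1) ≤ r := pow_le_of_le_one h0 hr.le (by omega)
  have h1 := norm_lam_le hM ht (w := z ^ (j + 1)) (r := r ^ (j + 1))
    (by rw [norm_pow]; gcongr) (by linarith)
  have hj : (1 : ℝ) ≤ ‖(j : ℂ) + 1‖ := by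
    have : ((j : ℂ) + 1) = ((j + 1 : ℕ) : ℂ) := by push_cast; ring
    rw [this, Complex.norm_natCast]
    exact_mod_cast Nat.le_add_left 1 j
  have hr' : 0 < 1 - r := by linarith
  rw [norm_div]
  calc _ ≤ ‖lam M t (z ^ (j + 1))‖ / 1 := by gcongr
    _ ≤ r ^ (j + 1) / (1 - r ^ (j + 1)) := by simpa using h1
    _ ≤ r ^ j / (1 - r) :=
      div_le_div₀ (by positivity) (pow_le_pow_of_le_one h0 hr.le (by omega)) hr' (by linarith)

theorem summable_lamLog (hM : 0 < M) (ht : 0 < t) {z : ℂ} (hz : ‖z‖ < 1) :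
    Summable fun j : ℕ => lam M t (z ^ (j + 1)) / (j + 1) :=
  Summable.of_norm_bounded ((summable_geometric_of_lt_one (norm_nonneg z) hz).div_const _)
    (norm_lamLog_term_le hM ht le_rfl hz)

theorem differentiableOn_lamLog (hM : 0 < M) (ht : 0 < t) :
    DifferentiableOn ℂ (lamLog M t) (Metric.ball 0 1) := by
  intro z hz
  rw [mem_ball_zero_iff] at hz
  obtain ⟨r, hzr, hr⟩ := exists_between hz
  have hr0 : 0 ≤ r := (norm_nonneg z).trans hzr.le
  have hd : DifferentiableOn ℂ (lamLog M t) (Metric.ball 0 r) := by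
    refine Complex.differentiableOn_tsum_of_summable_norm
      ((summable_geometric_of_lt_one hr0 hr).div_const (1 - r)) (fun j w hw => ?_)
      Metric.isOpen_ball fun j w hw => ?_
    · rw [mem_ball_zero_iff] at hw
      refine DifferentiableAt.differentiableWithinAt ?_
      unfold lam
      have : 1 - (w ^ (j + 1)) ^ M ≠ 0 := by
        rw [← pow_mul]
        intro h
        have h2 : ‖w ^ ((j + 1) * M)‖ < 1 := by
          rw [norm_pow]
          exact pow_lt_one₀ (norm_nonneg _) (hw.trans hr) (by positivity)
        rw [← sub_eq_zero.1 h] at h2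
        simp at h2
      fun_prop (disch := assumption)
    · rw [mem_ball_zero_iff] at hw
      exact norm_lamLog_term_le hM ht hw.le hr j
  exact ((hd.differentiableAt (Metric.isOpen_ball.mem_nhds (by simpa using hzr)))
    ).differentiableWithinAt

theorem lamLog_ofReal (hM : 0 < M) (ht : 0 < t) {x : ℝ} (h0 : 0 < x) (h1 : x < 1) :
    lamLog M t x = (ellSum x M t : ℝ) := by
  have hlt : ∀ n : ℕ, 0 < n → |x ^ n| < 1 := fun n hn => by
    rw [abs_of_pos (by positivity)]
    exact pow_lt_one₀ h0.le h1 hn.ne'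
  have hfib : ∀ k : ℕ, HasSum (fun j : ℕ => (x ^ (t + M * k)) ^ (j + 1) / ((j : ℝ) + 1))
      (ell x (t + M * k)) := fun k => by
    have := Real.hasSum_pow_div_log_of_abs_lt_one (hlt (t + M * k) (by omega))
    rw [ell]
    exact_mod_cast this
  have hsum : Summable fun p : ℕ × ℕ => (x ^ (t + M * p.1)) ^ (p.2 + 1) / ((p.2 : ℝ) + 1) := by
    rw [summable_prod_of_nonneg fun p => by positivity]
    refine ⟨fun k => (hfib k).summable, ?_⟩
    simp only [(hfib _).tsum_eq]
    exact summable_ell h0 h1 (by exact_mod_cast hM) (by exact_mod_cast ht)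
  have h2 : ∑' (j : ℕ) (k : ℕ), (x ^ (t + M * k)) ^ (j + 1) / ((j : ℝ) + 1) =
      ∑' (k : ℕ) (j : ℕ), (x ^ (t + M * k)) ^ (j + 1) / ((j : ℝ) + 1) :=
    Summable.tsum_comm (f := fun k j : ℕ => (x ^ (t + M * k)) ^ (j + 1) / ((j : ℝ) + 1)) hsum
  simp only [(hfib _).tsum_eq] at h2
  rw [ellSum, ← h2, lamLog, Complex.ofReal_tsum]
  refine tsum_congr fun j => ?_
  have h3 := (hasSum_lam (t := t) hM (w := (x : ℂ) ^ (j + 1)) (by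
    rw [← Complex.ofReal_pow, Complex.norm_real]; exact hlt _ (by omega))).div_const ((j : ℂ) + 1)
  rw [← h3.tsum_eq, Complex.ofReal_tsum]
  refine tsum_congr fun k => ?_
  push_cast
  rw [← pow_mul, ← pow_mul, mul_comm]

theorem hasSum_re_lam (hM : 0 < M) {r θ : ℝ} (h0 : 0 ≤ r) (h1 : r < 1) :
    HasSum (fun l : ℕ => r ^ (t + M * l) * (1 - Real.cos ((t + M * l : ℕ) * θ)))
      ((lam M t r).re - (lam M t (r * Complex.exp (θ * Complex.I))).re) := by
  have hn : ‖(r : ℂ)‖ < 1 := by simpa [abs_of_nonneg h0] using h1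
  have hn' : ‖(r : ℂ) * Complex.exp (θ * Complex.I)‖ < 1 := by
    rw [norm_mul, Complex.norm_exp_ofReal_mul_I, mul_one]; exact hn
  have := ((Complex.hasSum_re (hasSum_lam (t := t) hM hn)).sub
    (Complex.hasSum_re (hasSum_lam (t := t) hM hn')))
  refine this.congr_fun ?_ |> id
  intro l
  rw [mul_pow, ← Complex.exp_nat_mul, ← Complex.ofReal_pow, Complex.re_ofReal_mul,
    Complex.ofReal_re, mul_sub, mul_one,
    show ((t + M * l : ℕ) : ℂ) * (θ * Complex.I) = (((t + M * l : ℕ) * θ : ℝ) : ℂ) * Complex.I by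
      push_cast; ring, Complex.exp_ofReal_mul_I_re]

theorem re_lam_le (hM : 0 < M) {r θ : ℝ} (h0 : 0 ≤ r) (h1 : r < 1) :
    (lam M t (r * Complex.exp (θ * Complex.I))).re ≤ (lam M t r).re := by
  have := (hasSum_re_lam (t := t) hM (θ := θ) h0 h1).nonneg fun l =>
    mul_nonneg (by positivity) (by linarith [Real.cos_le_one ((t + M * l : ℕ) * θ)])
  linarith

theorem re_lamLog_le (hM : 0 < M) (ht : 0 < t) {r θ : ℝ} (h0 : 0 ≤ r) (h1 : r < 1) :
    (lamLog M t (r * Complex.exp (θ * Complex.I))).re +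
      ((lam M t r).re - (lam M t (r * Complex.exp (θ * Complex.I))).re) ≤ (lamLog M t r).re := by
  have hn : ‖(r : ℂ)‖ < 1 := by simpa [abs_of_nonneg h0] using h1
  have hn' : ‖(r : ℂ) * Complex.exp (θ * Complex.I)‖ < 1 := by
    rw [norm_mul, Complex.norm_exp_ofReal_mul_I, mul_one]; exact hn
  have hs := (Complex.hasSum_re (summable_lamLog hM ht hn).hasSum).sub
    (Complex.hasSum_re (summable_lamLog hM ht hn').hasSum)
  have hnn : ∀ j : ℕ, 0 ≤ (lam M t ((r : ℂ) ^ (j + 1)) / (j + 1)).re -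
      (lam M t ((r * Complex.exp (θ * Complex.I)) ^ (j + 1)) / (j + 1)).re := by
    intro j
    have e : ((j : ℂ) + 1) = ((j + 1 : ℝ) : ℂ) := by push_cast; ring
    rw [e, Complex.div_ofReal_re, Complex.div_ofReal_re, ← sub_div]
    refine div_nonneg ?_ (by positivity)
    rw [mul_pow, ← Complex.exp_nat_mul, ← Complex.ofReal_pow,
      show ((j + 1 : ℕ) : ℂ) * (θ * Complex.I) = (((j + 1 : ℕ) * θ : ℝ) : ℂ) * Complex.I by
        push_cast; ring]
    have := re_lam_le (t := t) hM (θ := (j + 1 : ℕ) * θ) (pow_nonneg h0 (j + 1))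
      (pow_lt_one₀ h0 h1 (by omega))
    linarith
  have hle := hs.summable.le_tsum 0 fun j _ => hnn j
  rw [hs.tsum_eq] at hle
  simp only [Nat.cast_zero, zero_add, pow_one, div_one] at hle
  unfold lamLog
  linarith

theorem hasSum_exp_lamLog {ι : Type*} [Fintype ι] {M t : ι → ℕ} (hM : ∀ i, 0 < M i)
    (ht : ∀ i, 0 < t i) {c : ℕ → ℝ}
    (hc : ∀ x : ℝ, 0 < x → x < 1 →
      HasSum (fun n => c n * x ^ n) (Real.exp (∑ i, ellSum x (M i) (t i))))
    {z : ℂ} (hz : ‖z‖ < 1) :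
    HasSum (fun n => (c n : ℂ) * z ^ n) (Complex.exp (∑ i, lamLog (M i) (t i) z)) := by
  have hsum : ∀ w : ℂ, ‖w‖ < 1 → Summable fun n => ‖(c n : ℂ) * w ^ n‖ := by
    intro w hw
    obtain ⟨x, hwx, hx⟩ := exists_between hw
    have hx0 : 0 < x := (norm_nonneg w).trans_lt hwx
    have := (hc x hx0 hx).summable.norm
    refine Summable.of_nonneg_of_le (fun _ => norm_nonneg _) (fun n => ?_) this
    rw [norm_mul, norm_mul, norm_pow, Complex.norm_real]
    gcongr
    rw [norm_pow, Real.norm_of_nonneg hx0.le]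
    gcongr
  have hF : DifferentiableOn ℂ (fun w : ℂ => ∑' n, (c n : ℂ) * w ^ n) (Metric.ball 0 1) := by
    intro w hw
    rw [mem_ball_zero_iff] at hw
    obtain ⟨r, hwr, hr⟩ := exists_between hw
    have hr0 : 0 ≤ r := (norm_nonneg w).trans hwr.le
    have hd : DifferentiableOn ℂ (fun w : ℂ => ∑' n, (c n : ℂ) * w ^ n) (Metric.ball 0 r) := by
      refine Complex.differentiableOn_tsum_of_summable_norm
        (hsum r (by simpa [abs_of_nonneg hr0] using hr)) (fun n => by fun_prop)
        Metric.isOpen_ball fun n v hv => ?_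
      rw [mem_ball_zero_iff] at hv
      simp only [norm_mul, norm_pow, Complex.norm_real, Real.norm_of_nonneg hr0]
      gcongr
    exact ((hd.differentiableAt (Metric.isOpen_ball.mem_nhds (by simpa using hwr)))
      ).differentiableWithinAt
  have hG : DifferentiableOn ℂ (fun w : ℂ => Complex.exp (∑ i, lamLog (M i) (t i) w))
      (Metric.ball 0 1) :=
    (DifferentiableOn.fun_sum fun i _ => differentiableOn_lamLog (hM i) (ht i)).cexp
  have hreal : ∀ x : ℝ, 0 < x → x < 1 →
      ∑' n, (c n : ℂ) * (x : ℂ) ^ n = Complex.exp (∑ i, lamLog (M i) (t i) x) := by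
    intro x h0 h1
    have h2 := Complex.hasSum_ofReal.2 (hc x h0 h1)
    simp only [lamLog_ofReal (hM _) (ht _) h0 h1]
    rw [← Complex.ofReal_sum, ← Complex.ofReal_exp, ← h2.tsum_eq]
    refine tsum_congr fun n => ?_
    push_cast
    rfl
  have hfreq : ∃ᶠ w in 𝓝[≠] ((1 / 2 : ℝ) : ℂ),
      ∑' n, (c n : ℂ) * w ^ n = Complex.exp (∑ i, lamLog (M i) (t i) w) := by
    have htend : Tendsto (fun x : ℝ => (x : ℂ)) (𝓝[≠] (1 / 2 : ℝ)) (𝓝[≠] ((1 / 2 : ℝ) : ℂ)) :=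
      tendsto_nhdsWithin_iff.2 ⟨(Complex.continuous_ofReal.tendsto _).mono_left inf_le_left,
        by filter_upwards [self_mem_nhdsWithin] with x hx using
          fun h => hx (Complex.ofReal_injective h)⟩
    refine htend.frequently (Eventually.frequently ?_)
    have : Set.Ioo (0 : ℝ) 1 ∈ 𝓝[≠] (1 / 2 : ℝ) :=
      mem_nhdsWithin_of_mem_nhds (Ioo_mem_nhds (by norm_num) (by norm_num))
    filter_upwards [this] with x hx using hreal x hx.1 hx.2
  have heq := AnalyticOnNhd.eqOn_of_preconnected_of_frequently_eq
    (hF.analyticOnNhd Metric.isOpen_ball) (hG.analyticOnNhd Metric.isOpen_ball)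
    (convex_ball (0 : ℂ) 1).isPreconnected
    (by rw [mem_ball_zero_iff, Complex.norm_real]; norm_num [abs_of_pos]) hfreq
  have hz' := heq (x := z) (by simpa using hz)
  dsimp only at hz'
  rw [← hz']
  exact (hsum z hz).of_norm.hasSum

end Ptn

namespace Ptn

open Filter Topology MeasureTheory

/-- The remainder in the expansion of `exp (-a x) / (1 - exp (-x))`, divided by `x`. -/
noncomputable def lamRem (a : ℝ) (x : ℂ) : ℂ :=
  (Complex.exp (-(a * x)) / (1 - Complex.exp (-x)) - 1 / x - (1 / 2 - a) * Complex.exp (-x)) / x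

theorem one_sub_exp_neg_ne_zero {x : ℂ} (hx : 0 < x.re) : 1 - Complex.exp (-x) ≠ 0 := by
  intro h
  have : ‖Complex.exp (-x)‖ = 1 := by rw [← sub_eq_zero.1 h, norm_one]
  rw [Complex.norm_exp, Complex.neg_re, Real.exp_eq_one_iff] at this
  linarith

theorem norm_lamRem_small_le (a : ℝ) (ha : 0 < a) : ∃ C : ℝ, ∀ x : ℂ, x ≠ 0 → ‖x‖ ≤ 1 / 2 →
    ‖lamRem a x‖ ≤ C := by
  refine ⟨2 * (a ^ 2 * Real.exp a + Real.exp 1 + |1 / 2 - a| * (1 / 2 + Real.exp 1 + 4)),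
    fun x hx hx1 => ?_⟩
  have hx0 : 0 < ‖x‖ := norm_pos_iff.2 hx
  obtain ⟨P, hP⟩ : ∃ P, Complex.exp (-(a * x)) = 1 - a * x + P := ⟨_, (add_sub_cancel _ _).symm⟩
  obtain ⟨ρ, hρ⟩ : ∃ ρ, Complex.exp (-x) = 1 - x + x ^ 2 / 2 - ρ :=
    ⟨1 - x + x ^ 2 / 2 - Complex.exp (-x), by ring⟩
  have bP : ‖P‖ ≤ ‖x‖ ^ 2 * (a ^ 2 * Real.exp a) := by
    have := Complex.norm_exp_sub_sum_le_norm_mul_exp (-(a * x)) 2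
    rw [hP] at this
    have e : (1 - a * x + P - ∑ m ∈ Finset.range 2, (-(a * x)) ^ m / (m.factorial : ℂ)) = P := by
      simp [Finset.sum_range_succ]
      ring
    rw [e] at this
    refine this.trans ?_
    rw [norm_neg, norm_mul, Complex.norm_real, Real.norm_of_nonneg ha.le, mul_pow]
    have : Real.exp (a * ‖x‖) ≤ Real.exp a := Real.exp_le_exp.2 (by nlinarith)
    calc a ^ 2 * ‖x‖ ^ 2 * Real.exp (a * ‖x‖) ≤ a ^ 2 * ‖x‖ ^ 2 * Real.exp a := by gcongr
      _ = _ := by ring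
  have bρ : ‖ρ‖ ≤ ‖x‖ ^ 3 * Real.exp 1 := by
    have := Complex.norm_exp_sub_sum_le_norm_mul_exp (-x) 3
    rw [hρ] at this
    have e : (1 - x + x ^ 2 / 2 - ρ - ∑ m ∈ Finset.range 3, (-x) ^ m / (m.factorial : ℂ)) = -ρ := by
      simp [Finset.sum_range_succ, Nat.factorial]
      ring
    rw [e, norm_neg, norm_neg] at this
    refine this.trans ?_
    gcongr
    linarith
  have hq1 : ‖Complex.exp (-x) - 1 - -x‖ ≤ ‖x‖ ^ 2 := by
    simpa using Complex.norm_exp_sub_one_sub_id_le (x := -x) (by rw [norm_neg]; linarith)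
  have hq2 : ‖x‖ / 2 ≤ ‖1 - Complex.exp (-x)‖ := by
    have h2 : x = (1 - Complex.exp (-x)) + (Complex.exp (-x) - 1 - -x) := by ring
    have h3 := norm_add_le (1 - Complex.exp (-x)) (Complex.exp (-x) - 1 - -x)
    rw [← h2] at h3
    nlinarith
  have hq3 : ‖1 - Complex.exp (-x)‖ ≤ 2 * ‖x‖ := by
    have h2 : 1 - Complex.exp (-x) = x - (Complex.exp (-x) - 1 - -x) := by ring
    rw [h2]
    have h3 := norm_sub_le x (Complex.exp (-x) - 1 - -x)
    nlinarith
  have hq0 : 1 - Complex.exp (-x) ≠ 0 := by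
    rw [← norm_pos_iff]; linarith
  have key : lamRem a x = (x * P - ρ + (1 / 2 - a) * (x ^ 3 / 2 - x * ρ +
      x * (1 - Complex.exp (-x)) ^ 2)) / (x ^ 2 * (1 - Complex.exp (-x))) := by
    rw [lamRem]
    field_simp
    rw [hP, hρ]
    ring
  rw [key, norm_div, norm_mul, norm_pow, div_le_iff₀ (by positivity)]
  have hA : ‖x * P - ρ + (1 / 2 - a) * (x ^ 3 / 2 - x * ρ + x * (1 - Complex.exp (-x)) ^ 2)‖ ≤
      ‖x‖ * ‖P‖ + ‖ρ‖ + |1 / 2 - a| * (‖x‖ ^ 3 / 2 + ‖x‖ * ‖ρ‖ +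
        ‖x‖ * ‖1 - Complex.exp (-x)‖ ^ 2) := by
    refine (norm_add_le _ _).trans (add_le_add ((norm_sub_le _ _).trans ?_) ?_)
    · rw [norm_mul]
    · rw [norm_mul]
      have : ‖(1 / 2 - a : ℂ)‖ = |1 / 2 - a| := by
        rw [← Real.norm_eq_abs, ← Complex.norm_real]; push_cast; rfl
      rw [this]
      gcongr
      refine (norm_add_le _ _).trans (add_le_add ((norm_sub_le _ _).trans ?_) ?_)
      · rw [norm_mul, norm_div, norm_pow]; simp
      · rw [norm_mul, norm_pow]
  refine hA.trans ?_
  have hB : ‖x‖ * ‖P‖ + ‖ρ‖ + |1 / 2 - a| * (‖x‖ ^ 3 / 2 + ‖x‖ * ‖ρ‖ +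
        ‖x‖ * ‖1 - Complex.exp (-x)‖ ^ 2) ≤
      ‖x‖ * (‖x‖ ^ 2 * (a ^ 2 * Real.exp a)) + ‖x‖ ^ 3 * Real.exp 1 +
        |1 / 2 - a| * (‖x‖ ^ 3 / 2 + 1 * (‖x‖ ^ 3 * Real.exp 1) +
        ‖x‖ * (2 * ‖x‖) ^ 2) := by
    gcongr
    linarith
  refine hB.trans ?_
  set K := a ^ 2 * Real.exp a + Real.exp 1 + |1 / 2 - a| * (1 / 2 + Real.exp 1 + 4)
  have hK : 0 ≤ K := by positivity
  calc _ = K * ‖x‖ ^ 3 := by ring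
    _ = 2 * K * (‖x‖ ^ 2 * (‖x‖ / 2)) := by ring
    _ ≤ _ := by gcongr

theorem norm_lamRem_le (a : ℝ) (ha : 0 < a) : ∃ C : ℝ, 0 ≤ C ∧ ∀ x : ℂ, 0 < x.re → |x.im| ≤ x.re →
    ‖lamRem a x‖ ≤ C / (1 + x.re ^ 2) := by
  obtain ⟨C₁, hC₁⟩ := norm_lamRem_small_le a ha
  set q := 1 - Real.exp (-(1 / 4)) with hq
  have hq0 : 0 < q := by
    have : Real.exp (-(1 / 4)) < 1 := Real.exp_lt_one_iff.2 (by norm_num)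
    linarith
  set C₂ := 1 / (a * q) + 1 + |1 / 2 - a|
  have hC₂ : 0 ≤ C₂ := by positivity
  refine ⟨2 * |C₁| + 17 * C₂, by positivity, fun x hx hxi => ?_⟩
  have hx0 : x ≠ 0 := by rintro rfl; simp at hx
  have hnx : x.re ≤ ‖x‖ := Complex.re_le_norm x
  by_cases hs : ‖x‖ ≤ 1 / 2
  · have h1 := (hC₁ x hx0 hs).trans (le_abs_self _)
    refine h1.trans ?_
    rw [le_div_iff₀ (by positivity)]
    have : x.re ^ 2 ≤ 1 := by nlinarith
    nlinarith [abs_nonneg C₁]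
  · have hR : 1 / 4 ≤ x.re := by
      have := Complex.norm_le_abs_re_add_abs_im x
      rw [abs_of_pos hx] at this
      linarith
    have hden : q ≤ ‖1 - Complex.exp (-x)‖ := by
      have := norm_sub_norm_le (1 : ℂ) (Complex.exp (-x))
      rw [norm_one, Complex.norm_exp, Complex.neg_re] at this
      have : Real.exp (-x.re) ≤ Real.exp (-(1 / 4)) := Real.exp_le_exp.2 (by linarith)
      linarith
    have hnum : ‖Complex.exp (-(a * x))‖ ≤ 1 / (a * x.re) := by
      rw [Complex.norm_exp, Complex.neg_re, Complex.re_ofReal_mul, Real.exp_neg, inv_eq_one_div]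
      have := Real.add_one_le_exp (a * x.re)
      exact one_div_le_one_div_of_le (by positivity) (by linarith)
    have h3 : ‖lamRem a x‖ ≤ C₂ / x.re ^ 2 := by
      rw [lamRem, norm_div]
      calc _ ≤ (1 / (a * x.re) / q + 1 / x.re + |1 / 2 - a| * (1 / x.re)) / x.re := by
            gcongr
            refine (norm_sub_le _ _).trans (add_le_add ((norm_sub_le _ _).trans
              (add_le_add ?_ ?_)) ?_)
            · rw [norm_div]; gcongr
            · rw [norm_div, norm_one]; gcongr
            · rw [norm_mul]
              have : ‖(1 / 2 - a : ℂ)‖ = |1 / 2 - a| := by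
                rw [← Real.norm_eq_abs, ← Complex.norm_real]; push_cast; rfl
              rw [this]
              gcongr
              rw [Complex.norm_exp, Complex.neg_re, Real.exp_neg, inv_eq_one_div]
              have := Real.add_one_le_exp (x.re)
              exact one_div_le_one_div_of_le (by positivity) (by linarith)
        _ = _ := by
            simp only [C₂]
            field_simp
    refine h3.trans ?_
    rw [div_le_div_iff₀ (by positivity) (by positivity)]
    have : 1 + x.re ^ 2 ≤ 17 * x.re ^ 2 := by nlinarith
    nlinarith [abs_nonneg C₁, mul_le_mul_of_nonneg_left this hC₂,
      mul_nonneg (abs_nonneg C₁) (sq_nonneg x.re)]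

theorem hasSum_lamRem {a : ℝ} (ha : 0 < a) {h : ℂ} (h0 : 0 < h.re) (hi : |h.im| ≤ h.re) :
    Summable (fun j : ℕ => lamRem a ((j + 1) * h)) ∧
    HasSum (fun j : ℕ => Complex.exp (-(a * ((j + 1) * h))) /
        (1 - Complex.exp (-((j + 1) * h))) / (j + 1))
      (Real.pi ^ 2 / 6 / h - (1 / 2 - a) * Complex.log (1 - Complex.exp (-h)) +
        h * ∑' j : ℕ, lamRem a ((j + 1) * h)) := by
  obtain ⟨C, hC0, hC⟩ := norm_lamRem_le a ha
  have hh : h ≠ 0 := by rintro rfl; simp at h0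
  have hj : ∀ j : ℕ, ((j : ℂ) + 1) ≠ 0 := fun j => by exact_mod_cast Nat.succ_ne_zero j
  have hre : ∀ j : ℕ, (((j : ℂ) + 1) * h).re = (j + 1) * h.re := fun j => by
    rw [show ((j : ℂ) + 1) = ((j + 1 : ℝ) : ℂ) by push_cast; ring, Complex.re_ofReal_mul]
  have him : ∀ j : ℕ, (((j : ℂ) + 1) * h).im = (j + 1) * h.im := fun j => by
    rw [show ((j : ℂ) + 1) = ((j + 1 : ℝ) : ℂ) by push_cast; ring, Complex.im_ofReal_mul]
  have hz2 : HasSum (fun j : ℕ => 1 / ((j : ℝ) + 1) ^ 2) (Real.pi ^ 2 / 6) := by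
    have := (hasSum_nat_add_iff' 1).2 hasSum_zeta_two
    simpa using this
  have hsum : Summable (fun j : ℕ => lamRem a ((j + 1) * h)) := by
    refine Summable.of_norm_bounded (hz2.summable.mul_left (C / h.re ^ 2)) fun j => ?_
    have := hC (((j : ℂ) + 1) * h) (by rw [hre]; positivity) (by
      rw [hre, him, abs_mul, abs_of_pos (by positivity)]; gcongr)
    refine this.trans ?_
    rw [hre, div_mul_div_comm, mul_one]
    gcongr
    nlinarith
  refine ⟨hsum, ?_⟩
  have hlt : ‖Complex.exp (-h)‖ < 1 := by
    rw [Complex.norm_exp, Complex.neg_re]; exact Real.exp_lt_one_iff.2 (by linarith)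
  have hlog : HasSum (fun j : ℕ => Complex.exp (-h) ^ (j + 1) / ((j : ℂ) + 1))
      (-Complex.log (1 - Complex.exp (-h))) := by
    have := (hasSum_nat_add_iff' 1).2 (Complex.hasSum_taylorSeries_neg_log hlt)
    simpa using this
  have H := (((Complex.hasSum_ofReal.2 hz2).div_const h).add
    (hlog.mul_left (1 / 2 - (a : ℂ)))).add (hsum.hasSum.mul_left h)
  have e : (Real.pi ^ 2 / 6 / h - (1 / 2 - a) * Complex.log (1 - Complex.exp (-h)) +
        h * ∑' j : ℕ, lamRem a ((j + 1) * h)) = (((Real.pi ^ 2 / 6 : ℝ) : ℂ) / h +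
        (1 / 2 - (a : ℂ)) * -Complex.log (1 - Complex.exp (-h)) +
        h * ∑' j : ℕ, lamRem a ((j + 1) * h)) := by push_cast; ring
  rw [e]
  refine H.congr_fun ?_ |> id
  intro j
  have hne := one_sub_exp_neg_ne_zero (x := ((j : ℂ) + 1) * h) (by rw [hre]; positivity)
  have h1 := hj j
  rw [lamRem, ← Complex.exp_nat_mul]
  push_cast
  rw [show ((j : ℂ) + 1) * -h = -((j + 1) * h) by ring]
  field_simp
  ring

end Ptn

namespace Ptn

open Filter Topology MeasureTheory

theorem integral_natCeil (g : ℕ → ℂ) (hg : Summable fun j => ‖g (j + 1)‖) :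
    ∫ y in Set.Ioi (0 : ℝ), g ⌈y⌉₊ = ∑' j : ℕ, g (j + 1) := by
  have hU : Set.Ioi (0 : ℝ) = ⋃ j : ℕ, Set.Ioc (j : ℝ) (j + 1) := by
    ext y
    simp only [Set.mem_Ioi, Set.mem_iUnion, Set.mem_Ioc]
    constructor
    · intro hy
      have hc : 0 < ⌈y⌉₊ := Nat.ceil_pos.2 hy
      obtain ⟨j, hj⟩ := Nat.exists_eq_add_of_le' hc
      refine ⟨j, ?_, ?_⟩
      · exact Nat.lt_ceil.1 (by omega)
      · have := Nat.le_ceil y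
        rw [hj] at this
        exact_mod_cast this
    · rintro ⟨j, hj, _⟩
      exact lt_of_le_of_lt (Nat.cast_nonneg j) hj
  have hc : ∀ j : ℕ, ∀ y ∈ Set.Ioc (j : ℝ) (j + 1), ⌈y⌉₊ = j + 1 := by
    intro j y hy
    rw [Nat.ceil_eq_iff (by omega)]
    refine ⟨?_, ?_⟩
    · simpa using hy.1
    · push_cast; exact hy.2
  have hd : Pairwise (Function.onFun Disjoint fun j : ℕ => Set.Ioc (j : ℝ) (j + 1)) := by
    intro i j hij
    refine Set.disjoint_left.2 fun y hi hj => hij ?_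
    have h1 := hc i y hi
    have h2 := hc j y hj
    omega
  have hf_int : ∀ j : ℕ, IntegrableOn (fun y : ℝ => g ⌈y⌉₊) (Set.Ioc (j : ℝ) (j + 1)) := fun j =>
    (integrableOn_const (C := g (j + 1)) (by simp) (by simp)).congr_fun
      (fun y hy => by rw [hc j y hy]) measurableSet_Ioc
  have hval : ∀ j : ℕ, ∫ y in Set.Ioc (j : ℝ) (j + 1), g ⌈y⌉₊ = g (j + 1) := fun j => by
    rw [setIntegral_congr_fun measurableSet_Ioc (g := fun _ => g (j + 1))
      fun y hy => by dsimp only; rw [hc j y hy]]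
    simp
  have hvaln : ∀ j : ℕ, ∫ y in Set.Ioc (j : ℝ) (j + 1), ‖g ⌈y⌉₊‖ = ‖g (j + 1)‖ := fun j => by
    rw [setIntegral_congr_fun measurableSet_Ioc (g := fun _ => ‖g (j + 1)‖)
      fun y hy => by dsimp only; rw [hc j y hy]]
    simp
  have hI : IntegrableOn (fun y : ℝ => g ⌈y⌉₊) (⋃ j : ℕ, Set.Ioc (j : ℝ) (j + 1)) := by
    refine integrableOn_iUnion_of_summable_integral_norm hf_int ?_
    simpa only [hvaln] using hg
  rw [hU, integral_iUnion (fun _ => measurableSet_Ioc) hd hI]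
  simp only [hval]

theorem tendsto_riemann {f : ℂ → ℂ} {C : ℝ} (hC0 : 0 ≤ C)
    (hC : ∀ x : ℂ, 0 < x.re → |x.im| ≤ x.re → ‖f x‖ ≤ C / (1 + x.re ^ 2))
    (hf : ∀ x : ℂ, 0 < x.re → ContinuousAt f x)
    {α : Type*} {l : Filter α} [l.IsCountablyGenerated] {s : α → ℝ} {w : α → ℂ}
    (hs : Tendsto s l (𝓝[>] 0)) (hw : Tendsto w l (𝓝 1)) :
    Tendsto (fun i => (s i : ℂ) * ∑' j : ℕ, f ((j + 1) * (s i * w i))) l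
      (𝓝 (∫ x in Set.Ioi (0 : ℝ), f x)) := by
  have hs0 : ∀ᶠ i in l, 0 < s i := hs self_mem_nhdsWithin
  have hs' : Tendsto s l (𝓝 0) := hs.mono_right inf_le_left
  have hwre : ∀ᶠ i in l, 1 / 2 < (w i).re :=
    ((Complex.continuous_re.tendsto _).comp hw).eventually (lt_mem_nhds (by norm_num))
  have hwim : ∀ᶠ i in l, |(w i).im| < 1 / 2 :=
    (((continuous_abs.comp Complex.continuous_im).tendsto _).comp hw).eventually
      (gt_mem_nhds (by simp))
  have hbound : ∀ (i : α) (n : ℕ), 0 < s i → 1 / 2 < (w i).re → |(w i).im| < 1 / 2 → 0 < n →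
      ‖f ((n : ℂ) * (s i * w i))‖ ≤ C / (1 + ((n : ℝ) * s i / 2) ^ 2) := by
    intro i n h1 h2 h3 hn
    have hn' : (0 : ℝ) < n := by exact_mod_cast hn
    have e : (n : ℂ) * (s i * w i) = ((n * s i : ℝ) : ℂ) * w i := by push_cast; ring
    have hre : ((n : ℂ) * (s i * w i)).re = n * s i * (w i).re := by
      rw [e, Complex.re_ofReal_mul]
    have him : ((n : ℂ) * (s i * w i)).im = n * s i * (w i).im := by
      rw [e, Complex.im_ofReal_mul]
    have hp : 0 < n * s i := by positivity
    refine (hC _ (by rw [hre]; nlinarith) ?_).trans ?_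
    · rw [hre, him, abs_mul, abs_of_pos hp]
      gcongr
      linarith
    · rw [hre]
      have : n * s i / 2 ≤ n * s i * (w i).re := by nlinarith
      gcongr
  have hbase : Integrable (fun x : ℝ => C * (1 + (x / 2) ^ 2)⁻¹) :=
    ((integrable_inv_one_add_sq).comp_div two_ne_zero).const_mul C
  have hEq : ∀ᶠ i in l, (s i : ℂ) * ∑' j : ℕ, f ((j + 1) * (s i * w i)) =
      ∫ x in Set.Ioi (0 : ℝ), f ((⌈x / s i⌉₊ : ℂ) * (s i * w i)) := by
    filter_upwards [hs0, hwre, hwim] with i h1 h2 h3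
    have hsum : Summable fun j : ℕ => ‖f (((j + 1 : ℕ) : ℂ) * (s i * w i))‖ := by
      have hz2 : Summable (fun j : ℕ => 1 / ((j : ℝ) + 1) ^ 2) := by
        have := (summable_nat_add_iff 1).2 (hasSum_zeta_two.summable)
        simpa using this
      refine Summable.of_nonneg_of_le (fun _ => norm_nonneg _) (fun j => ?_)
        (hz2.mul_left (C * 4 / s i ^ 2))
      refine (hbound i (j + 1) h1 h2 h3 (by omega)).trans ?_
      rw [div_mul_div_comm, mul_one, div_le_div_iff₀ (by positivity) (by positivity)]
      push_cast
      have : 0 ≤ C * 4 := by positivity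
      nlinarith
    have h := integral_natCeil (fun n => f ((n : ℂ) * (s i * w i))) hsum
    have h2 := integral_comp_mul_left_Ioi (fun y : ℝ => f ((⌈y⌉₊ : ℂ) * (s i * w i))) 0
      (inv_pos.2 h1)
    rw [mul_zero, h, inv_inv, Complex.real_smul] at h2
    simp only [inv_mul_eq_div, Nat.cast_add, Nat.cast_one] at h2
    exact h2.symm
  refine Tendsto.congr' (EventuallyEq.symm hEq) ?_
  refine tendsto_integral_filter_of_dominated_convergence (fun x : ℝ => C * (1 + (x / 2) ^ 2)⁻¹)
    ?_ ?_ hbase.integrableOn ?_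
  · refine Eventually.of_forall fun i => Measurable.aestronglyMeasurable ?_
    exact (measurable_from_nat (f := fun n : ℕ => f ((n : ℂ) * (s i * w i)))).comp
      (Nat.measurable_ceil.comp (measurable_id.div_const _))
  · filter_upwards [hs0, hwre, hwim] with i h1 h2 h3
    refine (ae_restrict_iff' measurableSet_Ioi).2 (Eventually.of_forall fun x hx => ?_)
    have hx' : 0 < x / s i := div_pos hx h1
    refine (hbound i _ h1 h2 h3 (Nat.ceil_pos.2 hx')).trans ?_
    rw [div_eq_mul_inv]
    have : x ≤ ⌈x / s i⌉₊ * s i := (div_le_iff₀ h1).1 (Nat.le_ceil _)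
    have hx0 : 0 < x := hx
    gcongr
  · refine (ae_restrict_iff' measurableSet_Ioi).2 (Eventually.of_forall fun x hx => ?_)
    have hx0 : 0 < x := hx
    have hlim : Tendsto (fun i => ((⌈x / s i⌉₊ * s i : ℝ))) l (𝓝 x) := by
      refine tendsto_of_tendsto_of_tendsto_of_le_of_le' (g := fun _ => x) (h := fun i => x + s i)
        tendsto_const_nhds (by simpa using hs'.const_add x) ?_ ?_
      · filter_upwards [hs0] with i h1 using (div_le_iff₀ h1).1 (Nat.le_ceil _)
      · filter_upwards [hs0] with i h1
        have := (Nat.ceil_lt_add_one (div_pos hx0 h1).le).le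
        calc (⌈x / s i⌉₊ : ℝ) * s i ≤ (x / s i + 1) * s i := by gcongr
          _ = x + s i := by field_simp
    have hlim2 : Tendsto (fun i => ((⌈x / s i⌉₊ : ℂ) * (s i * w i))) l (𝓝 (x : ℂ)) := by
      have := ((Complex.continuous_ofReal.tendsto _).comp hlim).mul hw
      rw [mul_one] at this
      refine this.congr fun i => ?_
      simp only [Function.comp_apply]
      push_cast
      ring
    exact (hf x (by simpa using hx0)).tendsto.comp hlim2

theorem continuousAt_lamRem (a : ℝ) {x : ℂ} (hx : 0 < x.re) : ContinuousAt (lamRem a) x := by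
  have h1 := one_sub_exp_neg_ne_zero hx
  have h2 : x ≠ 0 := by rintro rfl; simp at hx
  unfold lamRem
  fun_prop (disch := assumption)

/-- The constant term in the asymptotic expansion of the logarithm of a product over an
arithmetic progression. -/
noncomputable def lamConst (a : ℝ) : ℂ := ∫ x in Set.Ioi (0 : ℝ), lamRem a x

/-- The logarithm of the product of `1 / (1 - exp (-(a + l) h))` over natural numbers `l`. -/
noncomputable def expLog (a : ℝ) (h : ℂ) : ℂ :=
  ∑' j : ℕ, Complex.exp (-(a * ((j + 1) * h))) / (1 - Complex.exp (-((j + 1) * h))) / (j + 1)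

section

variable {α : Type*} {l : Filter α} {s : α → ℝ} {w : α → ℂ}

theorem eventually_wedge (hs : Tendsto s l (𝓝[>] 0)) (hw : Tendsto w l (𝓝 1)) :
    ∀ᶠ i in l, 0 < s i ∧ 0 < ((s i : ℂ) * w i).re ∧
      |((s i : ℂ) * w i).im| ≤ ((s i : ℂ) * w i).re := by
  have hs0 : ∀ᶠ i in l, 0 < s i := hs self_mem_nhdsWithin
  have hwre : ∀ᶠ i in l, 1 / 2 < (w i).re :=
    ((Complex.continuous_re.tendsto _).comp hw).eventually (lt_mem_nhds (by norm_num))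
  have hwim : ∀ᶠ i in l, |(w i).im| < 1 / 2 :=
    (((continuous_abs.comp Complex.continuous_im).tendsto _).comp hw).eventually
      (gt_mem_nhds (by simp))
  filter_upwards [hs0, hwre, hwim] with i h1 h2 h3
  rw [Complex.re_ofReal_mul, Complex.im_ofReal_mul, abs_mul, abs_of_pos h1]
  exact ⟨h1, by positivity, by gcongr; linarith⟩

theorem tendsto_one_sub_exp_neg_div (hs : Tendsto s l (𝓝[>] 0)) (hw : Tendsto w l (𝓝 1)) :
    Tendsto (fun i => (1 - Complex.exp (-(s i * w i))) / s i) l (𝓝 1) := by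
  have hs' : Tendsto (fun i => (s i : ℂ)) l (𝓝 0) :=
    (Complex.continuous_ofReal.tendsto' 0 0 (by simp)).comp (hs.mono_right inf_le_left)
  have hne : ∀ᶠ i in l, -((s i : ℂ) * w i) ≠ 0 := by
    filter_upwards [eventually_wedge hs hw] with i hi h
    rw [neg_eq_zero.1 h] at hi
    simp at hi
  have h0 : Tendsto (fun i => -((s i : ℂ) * w i)) l (𝓝[≠] 0) :=
    tendsto_nhdsWithin_iff.2 ⟨by simpa using (hs'.mul hw).neg, hne⟩
  have hd := (hasDerivAt_iff_tendsto_slope.1 (Complex.hasDerivAt_exp 0)).comp h0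
  rw [Complex.exp_zero] at hd
  have := hd.mul hw
  rw [one_mul] at this
  refine this.congr' ?_
  filter_upwards [hne, eventually_wedge hs hw] with i hi h2
  have hsi : (s i : ℂ) ≠ 0 := by exact_mod_cast h2.1.ne'
  have hwi : w i ≠ 0 := by rintro h; simp [h] at hi
  simp only [Function.comp_apply, slope_def_field, Complex.exp_zero, sub_zero]
  field_simp
  ring

theorem tendsto_expLog [l.IsCountablyGenerated] {a : ℝ} (ha : 0 < a)
    (hs : Tendsto s l (𝓝[>] 0)) (hw : Tendsto w l (𝓝 1)) :
    Tendsto (fun i => expLog a (s i * w i) - Real.pi ^ 2 / 6 / (s i * w i) +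
      (1 / 2 - a) * Real.log (s i)) l (𝓝 (lamConst a)) := by
  obtain ⟨C, hC0, hC⟩ := norm_lamRem_le a ha
  have h1 := (tendsto_riemann hC0 hC (fun x hx => continuousAt_lamRem a hx) hs hw).mul hw
  have h2 := tendsto_one_sub_exp_neg_div hs hw
  have h3 := ((continuousAt_clog (x := 1) (by simp)).tendsto.comp h2).const_mul (1 / 2 - (a : ℂ))
  have h4 := h1.sub h3
  rw [Complex.log_one, mul_zero, sub_zero, mul_one] at h4
  refine h4.congr' ?_
  filter_upwards [eventually_wedge hs hw] with i ⟨hi, hre, him⟩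
  have hsi : (s i : ℂ) ≠ 0 := by exact_mod_cast hi.ne'
  have hL : Complex.log (1 - Complex.exp (-(s i * w i))) =
      Real.log (s i) + Complex.log ((1 - Complex.exp (-(s i * w i))) / s i) := by
    rw [← Complex.log_ofReal_mul hi (div_ne_zero (one_sub_exp_neg_ne_zero hre) hsi)]
    congr 1
    field_simp
  rw [expLog, (hasSum_lamRem ha hre him).2.tsum_eq, hL]
  simp only [Function.comp_apply]
  ring

end

end Ptn

namespace Ptn

open Filter Topology MeasureTheory

/-- The terms of `expLog` at a real argument. -/
noncomputable def expTerm (a s : ℝ) (j : ℕ) : ℝ :=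
  Real.exp (-(a * ((j + 1) * s))) / (1 - Real.exp (-((j + 1) * s))) / (j + 1)

theorem summable_expTerm {a s : ℝ} (ha : 0 < a) (hs : 0 < s) : Summable (expTerm a s) := by
  have := (hasSum_lamRem ha (h := s) (by simpa using hs) (by simpa using hs.le)).2.summable
  rw [← Complex.summable_ofReal]
  refine this.congr fun j => ?_
  simp [expTerm]

theorem expLog_ofReal (a s : ℝ) : expLog a s = ((∑' j, expTerm a s j : ℝ) : ℂ) := by
  rw [expLog, Complex.ofReal_tsum]
  refine tsum_congr fun j => ?_
  simp [expTerm]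

/-- The normalised logarithm whose limit at zero is the constant term. -/
noncomputable def expNorm (a s : ℝ) : ℝ :=
  ∑' j, expTerm a s j - Real.pi ^ 2 / 6 / s + (1 / 2 - a) * Real.log s

theorem tendsto_expNorm_complex {a : ℝ} (ha : 0 < a) :
    Tendsto (fun s : ℝ => (expNorm a s : ℂ)) (𝓝[>] 0) (𝓝 (lamConst a)) := by
  have := tendsto_expLog (l := 𝓝[>] (0 : ℝ)) (s := id) (w := fun _ => 1) ha tendsto_id
    tendsto_const_nhds
  refine this.congr fun s => ?_
  simp [expNorm, expLog_ofReal]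

theorem tendsto_expNorm {a : ℝ} (ha : 0 < a) :
    Tendsto (expNorm a) (𝓝[>] 0) (𝓝 (lamConst a).re) := by
  simpa [Function.comp_def] using
    (Complex.continuous_re.tendsto _).comp (tendsto_expNorm_complex ha)

theorem lamConst_eq_ofReal {a : ℝ} (ha : 0 < a) : lamConst a = ((lamConst a).re : ℂ) :=
  tendsto_nhds_unique (tendsto_expNorm_complex ha)
    ((Complex.continuous_ofReal.tendsto _).comp (tendsto_expNorm ha))

theorem exp_neg_mul_lt_one {s : ℝ} (hs : 0 < s) (j : ℕ) : Real.exp (-((j + 1) * s)) < 1 :=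
  Real.exp_lt_one_iff.2 (by have : 0 < ((j : ℝ) + 1) * s := by positivity
                            linarith)

theorem lamConst_add_one {a : ℝ} (ha : 0 < a) :
    (lamConst (a + 1)).re = Real.log a + (lamConst a).re := by
  have h1 : ∀ᶠ s : ℝ in 𝓝[>] 0, expNorm (a + 1) s =
      Real.log ((1 - Real.exp (-(a * s))) / s) + expNorm a s := by
    filter_upwards [self_mem_nhdsWithin] with s hs
    have hs : 0 < s := hs
    have hlt : Real.exp (-(a * s)) < 1 := Real.exp_lt_one_iff.2 (by nlinarith)
    have hlog := Real.hasSum_pow_div_log_of_abs_lt_one (x := Real.exp (-(a * s)))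
      (by rwa [abs_of_pos (Real.exp_pos _)])
    have h2 : ∑' j, expTerm (a + 1) s j =
        ∑' j, expTerm a s j + Real.log (1 - Real.exp (-(a * s))) := by
      have h3 := (summable_expTerm ha hs).hasSum.sub hlog
      rw [sub_neg_eq_add] at h3
      rw [← h3.tsum_eq]
      refine tsum_congr fun j => ?_
      have hne : 1 - Real.exp (-((j + 1) * s)) ≠ 0 := by
        have := exp_neg_mul_lt_one hs j
        linarith
      have e1 : Real.exp (-((a + 1) * ((j + 1) * s))) =
          Real.exp (-(a * ((j + 1) * s))) * Real.exp (-((j + 1) * s)) := by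
        rw [← Real.exp_add]; congr 1; ring
      have e2 : Real.exp (-(a * s)) ^ (j + 1) = Real.exp (-(a * ((j + 1) * s))) := by
        rw [← Real.exp_nat_mul]; congr 1; push_cast; ring
      rw [expTerm, expTerm, e1, e2]
      field_simp
      ring
    rw [expNorm, expNorm, h2, Real.log_div (by linarith) hs.ne']
    ring
  have h2 : Tendsto (fun s : ℝ => (1 - Real.exp (-(a * s))) / s) (𝓝[>] 0) (𝓝 a) := by
    have hd : HasDerivAt (fun s : ℝ => 1 - Real.exp (-(a * s))) a 0 := by
      have := (((hasDerivAt_id (0 : ℝ)).const_mul a).neg.exp).const_sub 1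
      simpa using this
    have := (hasDerivAt_iff_tendsto_slope.1 hd).mono_left
      (nhdsWithin_mono 0 fun x (hx : 0 < x) => hx.ne')
    refine this.congr fun s => ?_
    simp [slope_def_field]
  have h3 := ((Real.continuousAt_log ha.ne').tendsto.comp h2).add (tendsto_expNorm ha)
  exact tendsto_nhds_unique ((tendsto_expNorm (by linarith : 0 < a + 1)).congr' h1) h3

theorem convexOn_lamConst : ConvexOn ℝ (Set.Ioi 0) fun a => (lamConst a).re := by
  refine ⟨convex_Ioi 0, fun x hx y hy p q hp hq hpq => ?_⟩
  have hx : 0 < x := hx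
  have hy : 0 < y := hy
  have hxy : 0 < p • x + q • y := (convex_Ioi (0 : ℝ)) hx hy hp hq hpq
  refine le_of_tendsto_of_tendsto (tendsto_expNorm hxy)
    (((tendsto_expNorm hx).const_mul p).add ((tendsto_expNorm hy).const_mul q)) ?_
  filter_upwards [self_mem_nhdsWithin] with s hs
  have hs : 0 < s := hs
  have h1 : ∑' j, expTerm (p • x + q • y) s j ≤
      p * ∑' j, expTerm x s j + q * ∑' j, expTerm y s j := by
    rw [← tsum_mul_left, ← tsum_mul_left,
      ← ((summable_expTerm hx hs).mul_left p).tsum_add ((summable_expTerm hy hs).mul_left q)]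
    refine (summable_expTerm hxy hs).tsum_le_tsum (fun j => ?_)
      (((summable_expTerm hx hs).mul_left p).add ((summable_expTerm hy hs).mul_left q))
    have hc := convexOn_exp.2 (Set.mem_univ (-(x * ((j + 1) * s))))
      (Set.mem_univ (-(y * ((j + 1) * s)))) hp hq hpq
    simp only [smul_eq_mul] at hc ⊢
    have hpos : 0 < 1 - Real.exp (-((j + 1) * s)) := by
      have := exp_neg_mul_lt_one hs j
      linarith
    simp only [expTerm]
    rw [← mul_div_assoc, ← mul_div_assoc, ← mul_div_assoc, ← mul_div_assoc, ← add_div, ← add_div]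
    gcongr
    convert hc using 2
    ring
  have h2 : ∀ A B : ℝ, p * (A + B) + q * (A + B) = A + B := fun A B => by
    rw [← add_mul, hpq, one_mul]
  simp only [expNorm, smul_eq_mul] at h1 ⊢
  have h3 : Real.pi ^ 2 / 6 / s = p * (Real.pi ^ 2 / 6 / s) + q * (Real.pi ^ 2 / 6 / s) := by
    rw [← add_mul, hpq, one_mul]
  have h4 : (1 / 2 - (p * x + q * y)) * Real.log s =
      p * ((1 / 2 - x) * Real.log s) + q * ((1 / 2 - y) * Real.log s) := by
    have : q = 1 - p := by linarith
    subst this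
    ring
  rw [h4]
  linarith

theorem lamConst_eq_log_Gamma_add {a : ℝ} (ha : 0 < a) :
    (lamConst a).re = Real.log (Real.Gamma a) + (lamConst 1).re := by
  have h := Real.eq_Gamma_of_log_convex
    (f := fun a => Real.exp ((lamConst a).re - (lamConst 1).re)) ?_ ?_
    (fun _ => Real.exp_pos _) (by simp) ha
  · rw [← h, Real.log_exp]
    ring
  · have := convexOn_lamConst.sub (concaveOn_const (lamConst 1).re (convex_Ioi (0 : ℝ)))
    refine this.congr fun x _ => ?_
    simp
  · intro y hy
    rw [lamConst_add_one hy, add_sub_assoc, Real.exp_add, Real.exp_log hy]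

theorem lamConst_half : (lamConst (1 / 2)).re = -(Real.log 2 / 2) := by
  have h1 : ∀ᶠ s : ℝ in 𝓝[>] 0, expNorm 1 (s / 2) =
      expNorm 1 s + expNorm (1 / 2) s + Real.log 2 / 2 := by
    filter_upwards [self_mem_nhdsWithin] with s hs
    have hs : 0 < s := hs
    have h2 : ∑' j, expTerm 1 (s / 2) j = ∑' j, expTerm 1 s j + ∑' j, expTerm (1 / 2) s j := by
      rw [← (summable_expTerm one_pos hs).tsum_add (summable_expTerm one_half_pos hs)]
      refine tsum_congr fun j => ?_
      have h3 := exp_neg_mul_lt_one (half_pos hs) j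
      have e1 : Real.exp (-((j + 1) * s)) = Real.exp (-((j + 1) * (s / 2))) ^ 2 := by
        rw [← Real.exp_nat_mul]; congr 1; push_cast; ring
      have e2 : Real.exp (-(1 / 2 * ((j + 1) * s))) = Real.exp (-((j + 1) * (s / 2))) := by
        congr 1; ring
      have hpos := Real.exp_pos (-((j + 1) * (s / 2)))
      simp only [expTerm, one_mul, e1, e2]
      set y := Real.exp (-((j + 1) * (s / 2)))
      have hy1 : 1 - y ≠ 0 := by linarith
      have hy2 : 1 - y ^ 2 ≠ 0 := by
        have : (1 - y ^ 2) = (1 - y) * (1 + y) := by ring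
        rw [this]
        exact mul_ne_zero hy1 (by linarith)
      field_simp
      ring
    rw [expNorm, expNorm, expNorm, h2, Real.log_div hs.ne' two_ne_zero]
    field_simp
    ring
  have h2 : Tendsto (fun s : ℝ => expNorm 1 (s / 2)) (𝓝[>] 0) (𝓝 (lamConst 1).re) := by
    refine (tendsto_expNorm one_pos).comp (tendsto_nhdsWithin_iff.2 ⟨?_, ?_⟩)
    · exact ((continuous_id.div_const 2).tendsto' (0 : ℝ) 0 (by simp)).mono_left inf_le_left
    · filter_upwards [self_mem_nhdsWithin] with s hs using half_pos (Set.mem_Ioi.1 hs)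
  have h3 := ((tendsto_expNorm one_pos).add (tendsto_expNorm one_half_pos)).add_const
    (Real.log 2 / 2)
  have := tendsto_nhds_unique (h2.congr' h1) h3
  linarith

theorem lamConst_eq {a : ℝ} (ha : 0 < a) :
    lamConst a = ((Real.log (Real.Gamma a / Real.sqrt (2 * Real.pi)) : ℝ) : ℂ) := by
  have h1 := lamConst_eq_log_Gamma_add one_half_pos
  rw [lamConst_half, Real.Gamma_one_half_eq, Real.log_sqrt Real.pi_pos.le] at h1
  rw [lamConst_eq_ofReal ha, lamConst_eq_log_Gamma_add ha, Real.log_div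
    (Real.Gamma_pos_of_pos ha).ne'
    (by positivity), Real.log_sqrt (by positivity), Real.log_mul two_ne_zero Real.pi_ne_zero]
  congr 1
  linarith

end Ptn

namespace Ptn

open Filter Topology

theorem one_sub_cos_two_mul_sub_le (α γ : ℝ) :
    1 - Real.cos (2 * α - γ) ≤ 6 * (1 - Real.cos α) + 3 * (1 - Real.cos γ) := by
  have h : ∀ x : ℝ, 1 - Real.cos x = 2 * Real.sin (x / 2) ^ 2 := fun x => by
    have h1 := Real.cos_two_mul (x / 2)
    have h2 := Real.sin_sq_add_cos_sq (x / 2)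
    rw [show 2 * (x / 2) = x by ring] at h1
    linarith
  rw [h, h α, h γ]
  set A := Real.sin (α / 2)
  set G := Real.sin (γ / 2)
  have h1 : Real.sin ((2 * α - γ) / 2) =
      2 * A * Real.cos (α / 2) * Real.cos (γ / 2) - Real.cos α * G := by
    rw [show (2 * α - γ) / 2 = α - γ / 2 by ring, Real.sin_sub,
      show Real.sin α = 2 * A * Real.cos (α / 2) by
        rw [← Real.sin_two_mul]; congr 1; ring]
  have h2 : |Real.sin ((2 * α - γ) / 2)| ≤ 2 * |A| + |G| := by
    rw [h1]
    refine (abs_sub _ _).trans (add_le_add ?_ ?_)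
    · rw [abs_mul, abs_mul, abs_mul, abs_two]
      have := Real.abs_cos_le_one (α / 2)
      have := Real.abs_cos_le_one (γ / 2)
      calc _ ≤ 2 * |A| * 1 * 1 := by gcongr
        _ = _ := by ring
    · rw [abs_mul]
      have := Real.abs_cos_le_one α
      nlinarith [abs_nonneg G]
  have h3 : Real.sin ((2 * α - γ) / 2) ^ 2 ≤ (2 * |A| + |G|) ^ 2 := by
    rw [← sq_abs (Real.sin _)]
    gcongr
  rw [← sq_abs A, ← sq_abs G]
  nlinarith [sq_nonneg (|A| - |G|)]

theorem mul_one_sub_cos_le_sum (M : ℕ) (θ : ℝ) {p n : ℕ} (hp : p ≤ n) :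
    n * (1 - Real.cos ((1 + M * p : ℕ) * θ)) ≤
      9 * ∑ l ∈ Finset.range (3 * n), (1 - Real.cos ((1 + M * l : ℕ) * θ)) := by
  set D : ℕ → ℝ := fun l => 1 - Real.cos ((1 + M * l : ℕ) * θ) with hD
  have hnn : ∀ l, 0 ≤ D l := fun l => by
    have := Real.cos_le_one ((1 + M * l : ℕ) * θ)
    simp only [hD]
    linarith
  have h1 : ∀ i, D p ≤ 6 * D (p + i) + 3 * D (p + 2 * i) := fun i => by
    have := one_sub_cos_two_mul_sub_le ((1 + M * (p + i) : ℕ) * θ) ((1 + M * (p + 2 * i) : ℕ) * θ)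
    refine le_trans (le_of_eq ?_) this
    simp only [hD]
    congr 2
    push_cast
    ring
  have h2 : ∀ k, 0 < k → k ≤ 2 →
      ∑ i ∈ Finset.range n, D (p + k * i) ≤ ∑ l ∈ Finset.range (3 * n), D l := by
    intro k hk hk2
    have hinj : Function.Injective fun i => p + k * i := fun i j hij => by
      have : k * i = k * j := by simpa using hij
      exact Nat.eq_of_mul_eq_mul_left hk this
    rw [← Finset.sum_image (f := D) (s := Finset.range n) (g := fun i => p + k * i)
      fun i _ j _ hij => hinj hij]
    refine Finset.sum_le_sum_of_subset_of_nonneg ?_ fun l _ _ => hnn l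
    intro l hl
    obtain ⟨i, hi, rfl⟩ := Finset.mem_image.1 hl
    rw [Finset.mem_range] at hi ⊢
    have : k * i ≤ 2 * i := Nat.mul_le_mul_right i hk2
    omega
  have h3 : ∑ _i ∈ Finset.range n, D p ≤
      ∑ i ∈ Finset.range n, (6 * D (p + i) + 3 * D (p + 2 * i)) :=
    Finset.sum_le_sum fun i _ => h1 i
  rw [Finset.sum_const, Finset.card_range, nsmul_eq_mul, Finset.sum_add_distrib,
    ← Finset.mul_sum, ← Finset.mul_sum] at h3
  have h4 := h2 1 one_pos one_le_two
  have h5 := h2 2 two_pos le_rfl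
  simp only [one_mul] at h4
  linarith

theorem exists_one_sub_cos_ge {M : ℕ} (hM : 0 < M) (n : ℕ) {θ R : ℝ} (hR : 0 ≤ R)
    (hRn : R ≤ 2 * n) (hθ : |θ| ≤ Real.pi) :
    ∃ p ≤ n, 1 / (2 * Real.pi ^ 2 * (M + 1) ^ 2) * min (θ ^ 2 * R ^ 2) 1 ≤
      1 - Real.cos ((1 + M * p : ℕ) * θ) := by
  have hM' : (1 : ℝ) ≤ M := by exact_mod_cast hM
  have hpi := Real.pi_pos
  have hcos : ∀ p : ℕ, ((1 + M * p : ℕ) : ℝ) * |θ| ≤ Real.pi →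
      2 / Real.pi ^ 2 * (((1 + M * p : ℕ) : ℝ) * |θ|) ^ 2 ≤
        1 - Real.cos ((1 + M * p : ℕ) * θ) := fun p hp => by
    have := Real.cos_le_one_sub_mul_cos_sq (x := ((1 + M * p : ℕ) : ℝ) * θ)
      (by rwa [abs_mul, Nat.abs_cast])
    rw [mul_pow, sq_abs, ← mul_pow]
    linarith
  by_cases hn : ((1 + M * n : ℕ) : ℝ) * |θ| ≤ Real.pi
  · refine ⟨n, le_rfl, le_trans ?_ (hcos n hn)⟩
    have h1 : R / 2 ≤ ((1 + M * n : ℕ) : ℝ) := by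
      push_cast
      nlinarith [Nat.cast_nonneg (α := ℝ) n]
    calc _ ≤ 1 / (2 * Real.pi ^ 2 * 1 ^ 2) * (θ ^ 2 * R ^ 2) := by
          gcongr
          · linarith
          · exact min_le_left _ _
      _ = 2 / Real.pi ^ 2 * (R / 2 * |θ|) ^ 2 := by
          rw [mul_pow, sq_abs]
          field_simp
      _ ≤ _ := by gcongr
  · push Not at hn
    have hex : ∃ k, Real.pi < ((1 + M * k : ℕ) : ℝ) * |θ| := ⟨n, hn⟩
    classical
    have hk := Nat.find_spec hex
    have hkn : Nat.find hex ≤ n := Nat.find_min' hex hn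
    have hk0 : Nat.find hex ≠ 0 := fun h => by
      rw [h] at hk
      simp at hk
      linarith
    obtain ⟨p, hp⟩ := Nat.exists_eq_succ_of_ne_zero hk0
    have hpmin : ((1 + M * p : ℕ) : ℝ) * |θ| ≤ Real.pi :=
      not_lt.1 (Nat.find_min hex (by omega))
    rw [hp] at hk
    refine ⟨p, by omega, le_trans ?_ (hcos p hpmin)⟩
    have h1 : Real.pi / (M + 1) ≤ ((1 + M * p : ℕ) : ℝ) * |θ| := by
      rw [div_le_iff₀ (by positivity)]
      refine hk.le.trans ?_
      push_cast
      have : 0 ≤ (M : ℝ) * M * p * |θ| := by positivity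
      nlinarith [abs_nonneg θ]
    calc _ ≤ 1 / (2 * Real.pi ^ 2 * (M + 1) ^ 2) * 1 := by
          gcongr
          exact min_le_right _ _
      _ ≤ 2 / Real.pi ^ 2 * (Real.pi / (M + 1)) ^ 2 := by
          rw [div_pow, div_mul_div_comm, mul_one,
            div_le_div_iff₀ (by positivity) (by positivity)]
          have h2 : (1 : ℝ) ≤ Real.pi ^ 2 := by nlinarith [Real.pi_gt_three]
          have : 0 ≤ Real.pi ^ 2 * ((M : ℝ) + 1) ^ 2 := by positivity
          nlinarith
      _ ≤ _ := by gcongr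

theorem exists_le_re_lam_sub {M : ℕ} (hM : 0 < M) : ∃ κ : ℝ, 0 < κ ∧ ∀ s θ : ℝ, 0 < s → s ≤ 1 →
    |θ| ≤ Real.pi → κ * min (θ ^ 2 / s ^ 3) (1 / s) ≤
      (lam M 1 (Real.exp (-s) : ℝ)).re -
        (lam M 1 ((Real.exp (-s) : ℝ) * Complex.exp (θ * Complex.I))).re := by
  refine ⟨Real.exp (-(1 + 3 * M)) * (1 / (2 * Real.pi ^ 2 * (M + 1) ^ 2)) / 18, by positivity,
    fun s θ hs hs1 hθ => ?_⟩
  have hsum := hasSum_re_lam (t := 1) hM (θ := θ) (Real.exp_pos (-s)).le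
    (Real.exp_lt_one_iff.2 (by linarith))
  set D : ℕ → ℝ := fun l => 1 - Real.cos ((1 + M * l : ℕ) * θ) with hD
  have hnn : ∀ l, 0 ≤ D l := fun l => by
    have := Real.cos_le_one ((1 + M * l : ℕ) * θ)
    simp only [hD]
    linarith
  set n := ⌊1 / s⌋₊ with hn
  have hn1 : 1 ≤ n := Nat.le_floor (by rw [Nat.cast_one, le_div_iff₀ hs]; linarith)
  have hn1' : (1 : ℝ) ≤ n := by exact_mod_cast hn1
  have hns : (n : ℝ) * s ≤ 1 := by
    rw [← le_div_iff₀ hs]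
    exact Nat.floor_le (by positivity)
  have hns2 : 1 / s ≤ 2 * n := by
    have := (Nat.lt_floor_add_one (1 / s)).le
    linarith
  obtain ⟨p, hp, hDp⟩ := exists_one_sub_cos_ge hM n (θ := θ) (R := 1 / s) (by positivity) hns2 hθ
  have h1 := mul_one_sub_cos_le_sum M θ hp
  have h2 : ∑ l ∈ Finset.range (3 * n), Real.exp (-(1 + 3 * M)) * D l ≤
      (lam M 1 (Real.exp (-s) : ℝ)).re -
        (lam M 1 ((Real.exp (-s) : ℝ) * Complex.exp (θ * Complex.I))).re := by
    refine le_trans (Finset.sum_le_sum fun l hl => ?_)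
      (sum_le_hasSum (Finset.range (3 * n)) (fun l _ => mul_nonneg (by positivity) (hnn l)) hsum)
    refine mul_le_mul_of_nonneg_right ?_ (hnn l)
    rw [← Real.exp_nat_mul]
    refine Real.exp_le_exp.2 ?_
    rw [Finset.mem_range] at hl
    have hl' : (l : ℝ) ≤ 3 * n := by exact_mod_cast hl.le
    push_cast
    have : (M : ℝ) * l * s ≤ M * 3 := by
      calc (M : ℝ) * l * s ≤ M * (3 * n) * s := by gcongr
        _ = M * 3 * (n * s) := by ring
        _ ≤ M * 3 * 1 := by gcongr
        _ = _ := by ring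
    nlinarith
  refine le_trans ?_ h2
  rw [← Finset.mul_sum]
  set c := 1 / (2 * Real.pi ^ 2 * ((M : ℝ) + 1) ^ 2)
  have hc : 0 ≤ c := by positivity
  have h3 : min (θ ^ 2 / s ^ 3) (1 / s) = 1 / s * min (θ ^ 2 * (1 / s) ^ 2) 1 := by
    rw [mul_min_of_nonneg _ _ (by positivity)]
    congr 1
    · field_simp
    · ring
  have h4 : 1 / s * (c * min (θ ^ 2 * (1 / s) ^ 2) 1) ≤
      2 * (9 * ∑ l ∈ Finset.range (3 * n), D l) := by
    have h0 : 0 ≤ c * min (θ ^ 2 * (1 / s) ^ 2) 1 := by positivity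
    calc _ ≤ 2 * n * D p := mul_le_mul hns2 hDp h0 (by positivity)
      _ ≤ _ := by linarith
  rw [h3]
  calc _ = Real.exp (-(1 + 3 * M)) * (1 / s * (c * min (θ ^ 2 * (1 / s) ^ 2) 1) / 18) := by ring
    _ ≤ _ := by
      gcongr
      linarith

end Ptn

namespace Ptn

open Filter Topology MeasureTheory

theorem lamLog_exp_neg {M t : ℕ} (hM : 0 < M) (h : ℂ) :
    lamLog M t (Complex.exp (-h)) = expLog (t / M) (M * h) := by
  have hM' : (M : ℂ) ≠ 0 := by exact_mod_cast hM.ne'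
  refine tsum_congr fun j => ?_
  rw [lam, ← pow_mul, ← pow_mul, ← Complex.exp_nat_mul, ← Complex.exp_nat_mul]
  have e1 : (((j + 1) * t : ℕ) : ℂ) * -h =
      -(((t / M : ℝ) : ℂ) * ((j + 1) * (M * h))) := by
    push_cast
    field_simp
  have e2 : (((j + 1) * M : ℕ) : ℂ) * -h = -((j + 1) * (M * h)) := by
    push_cast
    ring
  rw [e1, e2]

section

variable {ι : Type*} [Fintype ι]

/-- The residue at zero of `∑ lamLog` in the exponential variable. -/
noncomputable def poleCoeff (M : ι → ℕ) : ℝ := ∑ i, Real.pi ^ 2 / 6 / M i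

/-- The coefficient of the logarithm in the expansion of `∑ lamLog` at zero. -/
noncomputable def logCoeff (M t : ι → ℕ) : ℝ := ∑ i, (1 / 2 - (t i : ℝ) / M i)

/-- The constant term in the expansion of `∑ lamLog` at zero. -/
noncomputable def constCoeff (M t : ι → ℕ) : ℝ :=
  ∑ i, (Real.log (Real.Gamma ((t i : ℝ) / M i) / Real.sqrt (2 * Real.pi)) -
    (1 / 2 - (t i : ℝ) / M i) * Real.log (M i))

variable {M t : ι → ℕ}

theorem tendsto_sum_lamLog (hM : ∀ i, 0 < M i) (ht : ∀ i, 0 < t i)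
    {α : Type*} {l : Filter α} [l.IsCountablyGenerated] {s : α → ℝ} {w : α → ℂ}
    (hs : Tendsto s l (𝓝[>] 0)) (hw : Tendsto w l (𝓝 1)) :
    Tendsto (fun x => ∑ i, lamLog (M i) (t i) (Complex.exp (-(s x * w x))) -
      poleCoeff M / (s x * w x) + logCoeff M t * Real.log (s x)) l (𝓝 (constCoeff M t)) := by
  have key : ∀ i, Tendsto (fun x => lamLog (M i) (t i) (Complex.exp (-(s x * w x))) -
      (Real.pi ^ 2 / 6 / M i : ℝ) / (s x * w x) + (1 / 2 - (t i : ℝ) / M i : ℝ) * Real.log (s x)) l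
      (𝓝 ((Real.log (Real.Gamma ((t i : ℝ) / M i) / Real.sqrt (2 * Real.pi)) -
        (1 / 2 - (t i : ℝ) / M i) * Real.log (M i) : ℝ) : ℂ)) := fun i => by
    have hMi : (0 : ℝ) < M i := by exact_mod_cast hM i
    have hti : (0 : ℝ) < t i := by exact_mod_cast ht i
    have hMs : Tendsto (fun x => M i * s x) l (𝓝[>] 0) := by
      refine tendsto_nhdsWithin_iff.2 ⟨?_, ?_⟩
      · simpa using (hs.mono_right inf_le_left).const_mul (M i : ℝ)
      · filter_upwards [hs self_mem_nhdsWithin] with x hx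
        exact mul_pos hMi hx
    have h1 := (tendsto_expLog (div_pos hti hMi) hMs hw).sub_const
      (((1 / 2 - (t i : ℝ) / M i) * Real.log (M i) : ℝ) : ℂ)
    rw [lamConst_eq (div_pos hti hMi), ← Complex.ofReal_sub] at h1
    refine h1.congr' ?_
    filter_upwards [hs self_mem_nhdsWithin] with x hx
    have hx : 0 < s x := hx
    rw [lamLog_exp_neg (hM i), Real.log_mul hMi.ne' hx.ne', Complex.ofReal_mul, mul_assoc,
      Complex.ofReal_natCast, ← div_div (Real.pi ^ 2 / 6 : ℂ)]
    push_cast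
    ring
  have := tendsto_finsetSum Finset.univ fun i _ => key i
  rw [← Complex.ofReal_sum] at this
  refine this.congr fun x => ?_
  rw [Finset.sum_add_distrib, Finset.sum_sub_distrib, ← Finset.sum_mul, ← Finset.sum_div,
    poleCoeff, logCoeff, Complex.ofReal_sum, Complex.ofReal_sum]

end

theorem integral_exp_int_mul (k : ℤ) :
    ∫ θ in -Real.pi..Real.pi, Complex.exp (k * θ * Complex.I) =
      if k = 0 then 2 * (Real.pi : ℂ) else 0 := by
  split_ifs with hk
  · simp [hk, two_mul]
  · have hk' : (k : ℂ) * Complex.I ≠ 0 := by simp [hk]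
    have h1 : ∀ θ : ℝ, Complex.exp (k * θ * Complex.I) = Complex.exp (k * Complex.I * θ) :=
      fun θ => by ring_nf
    simp_rw [h1]
    rw [integral_exp_mul_complex hk', div_eq_zero_iff]
    left
    rw [sub_eq_zero, Complex.exp_eq_exp_iff_exists_int]
    exact ⟨k, by push_cast; ring⟩

theorem integral_circle_eq_coeff {c : ℕ → ℂ} {F : ℂ → ℂ} {r : ℝ} (hr : 0 ≤ r)
    (h : ∀ z : ℂ, ‖z‖ = r → HasSum (fun k => c k * z ^ k) (F z)) (n : ℕ) :
    ∫ θ in -Real.pi..Real.pi, F (r * Complex.exp (θ * Complex.I)) *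
      Complex.exp (-(n * θ * Complex.I)) = 2 * Real.pi * (c n * r ^ n) := by
  have hsum : Summable fun k => ‖c k * (r : ℂ) ^ k‖ :=
    (h r (by simp [abs_of_nonneg hr])).summable.norm
  have h1 : ∀ (k : ℕ) (θ : ℝ), c k * (r * Complex.exp (θ * Complex.I)) ^ k *
      Complex.exp (-(n * θ * Complex.I)) =
        c k * r ^ k * Complex.exp (((k - n : ℤ) : ℂ) * θ * Complex.I) := fun k θ => by
    rw [mul_pow, ← Complex.exp_nat_mul, mul_assoc, mul_assoc, ← Complex.exp_add, ← mul_assoc]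
    congr 2
    push_cast
    ring
  have h2 : HasSum (fun k => ∫ θ in -Real.pi..Real.pi, c k * r ^ k *
      Complex.exp (((k - n : ℤ) : ℂ) * θ * Complex.I))
      (∫ θ in -Real.pi..Real.pi, F (r * Complex.exp (θ * Complex.I)) *
        Complex.exp (-(n * θ * Complex.I))) := by
    refine intervalIntegral.hasSum_integral_of_dominated_convergence
      (fun k _ => ‖c k * (r : ℂ) ^ k‖) (fun k => ?_) (fun k => ?_) ?_ ?_ ?_
    · exact Continuous.aestronglyMeasurable (by fun_prop)
    · refine Eventually.of_forall fun θ _ => ?_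
      rw [norm_mul, Complex.norm_exp]
      simp
    · exact Eventually.of_forall fun θ _ => hsum
    · exact intervalIntegrable_const
    · refine Eventually.of_forall fun θ _ => ?_
      simp_rw [← h1]
      refine (h _ ?_).mul_right _
      rw [norm_mul, Complex.norm_exp_ofReal_mul_I, mul_one, Complex.norm_real,
        Real.norm_of_nonneg hr]
  refine h2.unique ?_
  simp_rw [intervalIntegral.integral_const_mul, integral_exp_int_mul]
  convert hasSum_ite_eq n (2 * Real.pi * (c n * (r : ℂ) ^ n)) using 2 with k
  by_cases hkn : k = n
  · subst hkn
    simp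
    ring
  · have : (k : ℤ) - n ≠ 0 := by omega
    simp [hkn, this]

end Ptn

namespace Ptn

open Filter Topology MeasureTheory

theorem exp_neg_mul_min_le {κ s u : ℝ} (hκ : 0 < κ) (hs : 0 < s)
  (hu : u ^ 2 ≤ Real.pi ^ 2 / s ^ 3) :
    Real.exp (-(κ * min (u ^ 2) (1 / s))) ≤
      (2 + 1 / κ + 6 * Real.pi ^ 2 / κ ^ 3) * (1 + u ^ 2)⁻¹ := by
  rw [← div_eq_mul_inv, Real.exp_neg, inv_eq_one_div,
    div_le_div_iff₀ (Real.exp_pos _) (by positivity), one_mul]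
  have hB : 0 ≤ 6 * Real.pi ^ 2 / κ ^ 3 := by positivity
  have hA : 0 ≤ 1 / κ := by positivity
  rcases min_choice (u ^ 2) (1 / s) with h | h <;> rw [h]
  · have h1 := Real.add_one_le_exp (κ * u ^ 2)
    have h2 : 1 + u ^ 2 ≤ (1 + 1 / κ) * (κ * u ^ 2 + 1) := by
      have : (1 + 1 / κ) * (κ * u ^ 2 + 1) = κ * u ^ 2 + 1 / κ + (1 + u ^ 2) := by
        field_simp
        ring
      rw [this]
      have : 0 ≤ κ * u ^ 2 := by positivity
      linarith
    exact h2.trans (mul_le_mul (by linarith) h1 (by positivity) (by positivity))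
  · have hx : 0 ≤ κ * (1 / s) := by positivity
    have h1 := Real.pow_div_factorial_le_exp (κ * (1 / s)) hx 3
    have h2 := Real.one_le_exp hx
    have h3 : Real.pi ^ 2 / s ^ 3 =
      6 * Real.pi ^ 2 / κ ^ 3 * ((κ * (1 / s)) ^ 3 / (3).factorial) := by
      simp [Nat.factorial]
      field_simp
    calc 1 + u ^ 2 ≤ 1 * Real.exp (κ * (1 / s)) +
          6 * Real.pi ^ 2 / κ ^ 3 * Real.exp (κ * (1 / s)) := by
          rw [one_mul]
          refine add_le_add h2 (hu.trans ?_)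
          rw [h3]
          gcongr
      _ ≤ _ := by
        rw [← add_mul]
        gcongr
        linarith

section

variable {ι : Type*} [Fintype ι] {M t : ι → ℕ}

/-- The normalised Cauchy integrand on the circle of radius `exp (-q ^ 2)`, in the scaled angular
variable. -/
noncomputable def saddle (M t : ι → ℕ) (n : ℕ) (q u : ℝ) : ℂ :=
  Complex.exp (∑ i, lamLog (M i) (t i)
      ((Real.exp (-q ^ 2) : ℝ) * Complex.exp ((q ^ 3 * u : ℝ) * Complex.I)) -
    ∑ i, lamLog (M i) (t i) (Real.exp (-q ^ 2) : ℝ)) *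
    Complex.exp (-(n * (q ^ 3 * u : ℝ) * Complex.I))

theorem continuous_saddle (hM : ∀ i, 0 < M i) (ht : ∀ i, 0 < t i) (n : ℕ) {q : ℝ} (hq : 0 < q) :
    Continuous (saddle M t n q) := by
  have h1 : ∀ i, Continuous fun u : ℝ => lamLog (M i) (t i)
      ((Real.exp (-q ^ 2) : ℝ) * Complex.exp ((q ^ 3 * u : ℝ) * Complex.I)) := fun i => by
    refine (differentiableOn_lamLog (hM i) (ht i)).continuousOn.comp_continuous (by fun_prop)
      fun u => ?_
    rw [mem_ball_zero_iff, norm_mul, Complex.norm_exp_ofReal_mul_I, mul_one, Complex.norm_real,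
      Real.norm_of_nonneg (Real.exp_pos _).le, Real.exp_lt_one_iff]
    have := pow_pos hq 2
    linarith
  unfold saddle
  fun_prop

theorem integral_saddle (hM : ∀ i, 0 < M i) (ht : ∀ i, 0 < t i) {c : ℕ → ℝ}
    (hc : ∀ x : ℝ, 0 < x → x < 1 →
      HasSum (fun n => c n * x ^ n) (Real.exp (∑ i, ellSum x (M i) (t i))))
    (n : ℕ) {q : ℝ} (hq : 0 < q) :
    ∫ u in -(Real.pi / q ^ 3)..Real.pi / q ^ 3, saddle M t n q u =
      ((2 * Real.pi * c n / (q ^ 3 * Real.exp (n * q ^ 2 +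
        ∑ i, ellSum (Real.exp (-q ^ 2)) (M i) (t i))) : ℝ) : ℂ) := by
  have hq2 := pow_pos hq 2
  have hq3 := pow_pos hq 3
  set r := Real.exp (-q ^ 2) with hr
  have hr0 : 0 < r := Real.exp_pos _
  have hr1 : r < 1 := Real.exp_lt_one_iff.2 (by linarith)
  have h1 := integral_circle_eq_coeff (c := fun k => (c k : ℂ))
    (F := fun z => Complex.exp (∑ i, lamLog (M i) (t i) z)) hr0.le
    (fun z hz => hasSum_exp_lamLog hM ht hc (hz.trans_lt hr1)) n
  have h2 : ∑ i, lamLog (M i) (t i) (r : ℂ) = ((∑ i, ellSum r (M i) (t i) : ℝ) : ℂ) := by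
    rw [Complex.ofReal_sum]
    exact Finset.sum_congr rfl fun i _ => lamLog_ofReal (hM i) (ht i) hr0 hr1
  have h3 := intervalIntegral.integral_comp_mul_left (a := -(Real.pi / q ^ 3))
    (b := Real.pi / q ^ 3) (fun θ : ℝ => Complex.exp (∑ i, lamLog (M i) (t i)
      (r * Complex.exp (θ * Complex.I))) * Complex.exp (-(n * θ * Complex.I))) hq3.ne'
  rw [mul_neg, mul_div_cancel₀ _ hq3.ne', h1] at h3
  have h4 : ∀ u, saddle M t n q u = (Complex.exp (∑ i, ellSum r (M i) (t i) : ℝ))⁻¹ *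
      (Complex.exp (∑ i, lamLog (M i) (t i) (r * Complex.exp ((q ^ 3 * u : ℝ) * Complex.I))) *
        Complex.exp (-(n * (q ^ 3 * u : ℝ) * Complex.I))) := fun u => by
    rw [saddle, ← hr, h2, Complex.exp_sub]
    ring
  simp_rw [h4]
  rw [intervalIntegral.integral_const_mul, h3]
  have h5 : r ^ n = (Real.exp (n * q ^ 2))⁻¹ := by
    rw [hr, ← Real.exp_nat_mul, ← Real.exp_neg, mul_neg]
  rw [← Complex.ofReal_pow, h5, Real.exp_add, Complex.real_smul]
  push_cast
  field_simp

theorem norm_saddle_le (hM : ∀ i, 0 < M i) (ht : ∀ i, 0 < t i) {κ : ℝ} {k : ι} (hk : t k = 1)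
    (hκ : ∀ s θ : ℝ, 0 < s → s ≤ 1 → |θ| ≤ Real.pi → κ * min (θ ^ 2 / s ^ 3) (1 / s) ≤
      (lam (M k) 1 (Real.exp (-s) : ℝ)).re -
        (lam (M k) 1 ((Real.exp (-s) : ℝ) * Complex.exp (θ * Complex.I))).re)
    (n : ℕ) {q u : ℝ} (hq : 0 < q) (hq1 : q ≤ 1) (hu : |q ^ 3 * u| ≤ Real.pi) :
    ‖saddle M t n q u‖ ≤ Real.exp (-(κ * min (u ^ 2) (1 / q ^ 2))) := by
  have hq2 := pow_pos hq 2
  have hr0 : 0 ≤ Real.exp (-q ^ 2) := (Real.exp_pos _).le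
  have hr1 : Real.exp (-q ^ 2) < 1 := Real.exp_lt_one_iff.2 (by linarith)
  rw [saddle, norm_mul, Complex.norm_exp, Complex.norm_exp]
  have h0 : (-(n * (q ^ 3 * u : ℝ) * Complex.I)).re = 0 := by
    rw [← Complex.ofReal_natCast, ← Complex.ofReal_mul, ← neg_mul, ← Complex.ofReal_neg,
      Complex.re_ofReal_mul, Complex.I_re, mul_zero]
  rw [h0, Real.exp_zero, mul_one, Real.exp_le_exp, Complex.sub_re, Complex.re_sum, Complex.re_sum]
  have h1 := hκ (q ^ 2) (q ^ 3 * u) hq2 (pow_le_one₀ hq.le hq1) hu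
  have h2 : (q ^ 3 * u) ^ 2 / (q ^ 2) ^ 3 = u ^ 2 := by field_simp
  rw [h2] at h1
  have h3 : ∑ i, (lamLog (M i) (t i)
        ((Real.exp (-q ^ 2) : ℝ) * Complex.exp ((q ^ 3 * u : ℝ) * Complex.I))).re +
      ((lam (M k) 1 (Real.exp (-q ^ 2) : ℝ)).re - (lam (M k) 1
        ((Real.exp (-q ^ 2) : ℝ) * Complex.exp ((q ^ 3 * u : ℝ) * Complex.I))).re) ≤
      ∑ i, (lamLog (M i) (t i) (Real.exp (-q ^ 2) : ℝ)).re := by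
    have h4 : ∀ i, (lamLog (M i) (t i)
        ((Real.exp (-q ^ 2) : ℝ) * Complex.exp ((q ^ 3 * u : ℝ) * Complex.I))).re +
      ((lam (M i) (t i) (Real.exp (-q ^ 2) : ℝ)).re - (lam (M i) (t i)
        ((Real.exp (-q ^ 2) : ℝ) * Complex.exp ((q ^ 3 * u : ℝ) * Complex.I))).re) ≤
      (lamLog (M i) (t i) (Real.exp (-q ^ 2) : ℝ)).re := fun i =>
        re_lamLog_le (hM i) (ht i) hr0 hr1
    have h5 := Finset.sum_le_sum fun i (_ : i ∈ Finset.univ) => h4 i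
    rw [Finset.sum_add_distrib] at h5
    refine le_trans (add_le_add_right ?_ _) h5
    rw [← hk]
    exact Finset.single_le_sum (f := fun i => (lam (M i) (t i) (Real.exp (-q ^ 2) : ℝ)).re -
      (lam (M i) (t i) ((Real.exp (-q ^ 2) : ℝ) * Complex.exp ((q ^ 3 * u : ℝ) * Complex.I))).re)
      (fun i _ => sub_nonneg.2 (re_lam_le (hM i) hr0 hr1)) (Finset.mem_univ k)
  linarith

theorem tendsto_saddle (hM : ∀ i, 0 < M i) (ht : ∀ i, 0 < t i) {q : ℕ → ℝ}
    (hq : Tendsto q atTop (𝓝[>] 0)) (hqn : ∀ᶠ n : ℕ in atTop, n * q n ^ 4 = poleCoeff M) (u : ℝ) :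
    Tendsto (fun n => saddle M t n (q n) u) atTop
      (𝓝 ((Real.exp (-poleCoeff M * u ^ 2) : ℝ) : ℂ)) := by
  have hq0 : ∀ᶠ n in atTop, 0 < q n := hq self_mem_nhdsWithin
  have hqz : Tendsto q atTop (𝓝 0) := hq.mono_right inf_le_left
  have hs : Tendsto (fun n => q n ^ 2) atTop (𝓝[>] 0) := by
    refine tendsto_nhdsWithin_iff.2 ⟨by simpa using hqz.pow 2, ?_⟩
    filter_upwards [hq0] with n hn
    exact pow_pos hn 2
  have hw : Tendsto (fun n => 1 - Complex.I * (q n * u)) atTop (𝓝 1) := by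
    have : Tendsto (fun n => (q n : ℂ)) atTop (𝓝 ((0 : ℝ) : ℂ)) :=
      (Complex.continuous_ofReal.tendsto 0).comp hqz
    simpa using (this.mul_const (u : ℂ)).const_mul Complex.I |>.const_sub 1
  have hw0 : ∀ᶠ n in atTop, 1 - Complex.I * (q n * u) ≠ 0 := hw.eventually_ne one_ne_zero
  have h1 := tendsto_sum_lamLog hM ht hs hw
  have h2 := tendsto_sum_lamLog hM ht hs (w := fun _ => 1) tendsto_const_nhds
  have h3 := hw.inv₀ one_ne_zero
  have h4 := ((h1.sub h2).add (h3.const_mul (-(poleCoeff M : ℂ) * u ^ 2))).cexp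
  rw [sub_self, zero_add, inv_one, mul_one] at h4
  push_cast
  refine h4.congr' ?_
  filter_upwards [hq0, hw0, hqn] with n hn hwn hnA
  have hnq : (q n : ℂ) ≠ 0 := by exact_mod_cast hn.ne'
  have e1 : Complex.exp (-(((q n ^ 2 : ℝ) : ℂ) * (1 - Complex.I * (q n * u)))) =
      (Real.exp (-q n ^ 2) : ℝ) * Complex.exp ((q n ^ 3 * u : ℝ) * Complex.I) := by
    rw [Complex.ofReal_exp, ← Complex.exp_add]
    congr 1
    push_cast
    ring
  have e2 : Complex.exp (-(((q n ^ 2 : ℝ) : ℂ) * 1)) = (Real.exp (-q n ^ 2) : ℝ) := by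
    rw [Complex.ofReal_exp]
    congr 1
    push_cast
    ring
  rw [e1, e2, saddle, ← Complex.exp_add]
  congr 1
  have hA : (n : ℂ) * (q n : ℂ) ^ 4 = poleCoeff M := by exact_mod_cast hnA
  have hA' : (n : ℂ) * ((q n ^ 3 * u : ℝ) : ℂ) * Complex.I =
      poleCoeff M / q n * u * Complex.I := by
    rw [← hA]
    push_cast
    field_simp
  rw [hA']
  have e3 : -(poleCoeff M : ℂ) / (((q n ^ 2 : ℝ) : ℂ) * (1 - Complex.I * (q n * u))) +
      poleCoeff M / (((q n ^ 2 : ℝ) : ℂ) * 1) +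
      -(poleCoeff M : ℂ) * u ^ 2 * (1 - Complex.I * (q n * u))⁻¹ =
      -(poleCoeff M / q n * u * Complex.I) := by
    have hI := Complex.I_sq
    generalize hW : 1 - Complex.I * (q n * u) = W at hwn ⊢
    push_cast
    field_simp
    rw [← hW]
    linear_combination (-(poleCoeff M * u ^ 2 * q n ^ 2) : ℂ) * hI
  linear_combination e3

end

end Ptn

namespace Ptn

open Filter Topology MeasureTheory

section

variable {ι : Type*} [Fintype ι] {M t : ι → ℕ}

theorem poleCoeff_pos [Nonempty ι] (hM : ∀ i, 0 < M i) : 0 < poleCoeff M := by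
  refine Finset.sum_pos (fun i _ => ?_) Finset.univ_nonempty
  have : (0 : ℝ) < M i := by exact_mod_cast hM i
  have := Real.pi_pos
  positivity

theorem tendsto_integral_saddle (hM : ∀ i, 0 < M i) (ht : ∀ i, 0 < t i) (h1 : ∃ i, t i = 1)
    {q : ℕ → ℝ} (hq : Tendsto q atTop (𝓝[>] 0))
    (hqn : ∀ᶠ n : ℕ in atTop, n * q n ^ 4 = poleCoeff M) :
    Tendsto (fun n => ∫ u in -(Real.pi / q n ^ 3)..Real.pi / q n ^ 3, saddle M t n (q n) u) atTop
      (𝓝 (Real.sqrt (Real.pi / poleCoeff M) : ℝ)) := by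
  obtain ⟨k, hk⟩ := h1
  obtain ⟨κ, hκ0, hκ⟩ := exists_le_re_lam_sub (hM k)
  have hpi := Real.pi_pos
  have hq0 : ∀ᶠ n in atTop, 0 < q n := hq self_mem_nhdsWithin
  have hqz : Tendsto q atTop (𝓝 0) := hq.mono_right inf_le_left
  have hq1 : ∀ᶠ n in atTop, q n ≤ 1 := hqz.eventually (ge_mem_nhds one_pos)
  have hlim : Tendsto (fun n => Real.pi / q n ^ 3) atTop atTop := by
    refine Tendsto.const_mul_atTop hpi (tendsto_inv_nhdsGT_zero.comp ?_)
    refine tendsto_nhdsWithin_iff.2 ⟨by simpa using hqz.pow 3, ?_⟩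
    filter_upwards [hq0] with n hn
    exact pow_pos hn 3
  have hmem : ∀ {n : ℕ} {u : ℝ}, 0 < q n →
      u ∈ Set.Ioc (-(Real.pi / q n ^ 3)) (Real.pi / q n ^ 3) → |u| ≤ Real.pi / q n ^ 3 :=
    fun hn hu => abs_le.2 ⟨hu.1.le, hu.2⟩
  rw [← integral_gaussian, ← integral_complex_ofReal]
  have key := tendsto_integral_filter_of_dominated_convergence (μ := volume) (l := atTop)
    (F := fun n => (Set.Ioc (-(Real.pi / q n ^ 3)) (Real.pi / q n ^ 3)).indicator
      (saddle M t n (q n)))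
    (f := fun u => ((Real.exp (-poleCoeff M * u ^ 2) : ℝ) : ℂ))
    (fun u => (2 + 1 / κ + 6 * Real.pi ^ 2 / κ ^ 3) * (1 + u ^ 2)⁻¹) ?_ ?_
    (integrable_inv_one_add_sq.const_mul _) ?_
  · refine key.congr' ?_
    filter_upwards [hq0] with n hn
    rw [integral_indicator measurableSet_Ioc, intervalIntegral.integral_of_le]
    have : 0 < Real.pi / q n ^ 3 := by positivity
    linarith
  · filter_upwards [hq0] with n hn
    exact (continuous_saddle hM ht n hn).aestronglyMeasurable.indicator measurableSet_Ioc
  · filter_upwards [hq0, hq1] with n hn hn1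
    refine Eventually.of_forall fun u => ?_
    by_cases hu : u ∈ Set.Ioc (-(Real.pi / q n ^ 3)) (Real.pi / q n ^ 3)
    · rw [Set.indicator_of_mem hu]
      have hu' := hmem hn hu
      have h3 : |q n ^ 3 * u| ≤ Real.pi := by
        rw [abs_mul, abs_of_pos (pow_pos hn 3), mul_comm]
        exact (le_div_iff₀ (pow_pos hn 3)).1 hu'
      refine (norm_saddle_le hM ht hk hκ n hn hn1 h3).trans
        (exp_neg_mul_min_le hκ0 (pow_pos hn 2) ?_)
      rw [← sq_abs]
      calc |u| ^ 2 ≤ (Real.pi / q n ^ 3) ^ 2 := by gcongr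
        _ = _ := by rw [div_pow, ← pow_mul, ← pow_mul]
    · rw [Set.indicator_of_notMem hu, norm_zero]
      positivity
  · refine Eventually.of_forall fun u => ?_
    refine (tendsto_saddle hM ht hq hqn u).congr' ?_
    filter_upwards [hlim.eventually_gt_atTop |u|] with n hn
    rw [Set.indicator_of_mem]
    exact ⟨(abs_lt.1 hn).1, (abs_lt.1 hn).2.le⟩

theorem tendsto_sum_ellSum (hM : ∀ i, 0 < M i) (ht : ∀ i, 0 < t i)
    {q : ℕ → ℝ} (hq : Tendsto q atTop (𝓝[>] 0)) :
    Tendsto (fun n => ∑ i, ellSum (Real.exp (-q n ^ 2)) (M i) (t i) - poleCoeff M / q n ^ 2 +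
      logCoeff M t * Real.log (q n ^ 2)) atTop (𝓝 (constCoeff M t)) := by
  have hq0 : ∀ᶠ n in atTop, 0 < q n := hq self_mem_nhdsWithin
  have hs : Tendsto (fun n => q n ^ 2) atTop (𝓝[>] 0) := by
    refine tendsto_nhdsWithin_iff.2 ⟨by simpa using (hq.mono_right inf_le_left).pow 2, ?_⟩
    filter_upwards [hq0] with n hn
    exact pow_pos hn 2
  have h1 := (Complex.continuous_re.tendsto _).comp
    (tendsto_sum_lamLog hM ht hs (w := fun _ => 1) tendsto_const_nhds)
  rw [Complex.ofReal_re] at h1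
  refine h1.congr' ?_
  filter_upwards [hq0] with n hn
  have hr1 : Real.exp (-q n ^ 2) < 1 := Real.exp_lt_one_iff.2 (by
    have := pow_pos hn 2
    linarith)
  have h2 : ∑ i, lamLog (M i) (t i) (Complex.exp (-(((q n ^ 2 : ℝ) : ℂ) * 1))) =
      ((∑ i, ellSum (Real.exp (-q n ^ 2)) (M i) (t i) : ℝ) : ℂ) := by
    rw [Complex.ofReal_sum]
    refine Finset.sum_congr rfl fun i _ => ?_
    rw [← lamLog_ofReal (hM i) (ht i) (Real.exp_pos _) hr1, mul_one, Complex.ofReal_exp,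
      Complex.ofReal_neg]
  rw [Function.comp_apply, h2, mul_one, ← Complex.ofReal_div, ← Complex.ofReal_mul,
    ← Complex.ofReal_sub, ← Complex.ofReal_add, Complex.ofReal_re]

/-- Asymptotics of the coefficients of a finite product of factors `∏ 1 / (1 - x ^ e)` over
arithmetic progressions of exponents, when the logarithmic coefficient is `-1 / 2`. -/
theorem tendsto_coeff_div (hM : ∀ i, 0 < M i) (ht : ∀ i, 0 < t i) (h1 : ∃ i, t i = 1)
    (hD : logCoeff M t = -(1 / 2)) {c : ℕ → ℝ}
    (hc : ∀ x : ℝ, 0 < x → x < 1 →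
      HasSum (fun n => c n * x ^ n) (Real.exp (∑ i, ellSum x (M i) (t i)))) :
    Tendsto (fun n : ℕ => c n / (Real.exp (constCoeff M t) * Real.sqrt (poleCoeff M) /
      (2 * Real.sqrt Real.pi) * (1 / n) * Real.exp (2 * Real.sqrt (poleCoeff M * n))))
      atTop (𝓝 1) := by
  have hne : Nonempty ι := ⟨h1.choose⟩
  have hA := poleCoeff_pos hM
  set A := poleCoeff M with hAdef
  have hpi := Real.pi_pos
  set q : ℕ → ℝ := fun n => Real.sqrt (Real.sqrt (A / n)) with hqdef
  have hq2 : ∀ n, q n ^ 2 = Real.sqrt (A / n) := fun n => Real.sq_sqrt (Real.sqrt_nonneg _)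
  have hq4 : ∀ n, q n ^ 4 = A / n := fun n => by
    rw [show q n ^ 4 = (q n ^ 2) ^ 2 by ring, hq2, Real.sq_sqrt (by positivity)]
  have hq : Tendsto q atTop (𝓝[>] 0) := by
    refine tendsto_nhdsWithin_iff.2 ⟨?_, ?_⟩
    · simpa only [Real.sqrt_zero] using (tendsto_const_div_atTop_nhds_zero_nat A).sqrt.sqrt
    · filter_upwards [eventually_gt_atTop 0] with n hn
      have : (0 : ℝ) < n := by exact_mod_cast hn
      exact Real.sqrt_pos.2 (Real.sqrt_pos.2 (by positivity))
  have hqn : ∀ᶠ n : ℕ in atTop, n * q n ^ 4 = A := by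
    filter_upwards [eventually_gt_atTop 0] with n hn
    have : (0 : ℝ) < n := by exact_mod_cast hn
    rw [hq4]
    field_simp
  have hq0 : ∀ᶠ n in atTop, 0 < q n := hq self_mem_nhdsWithin
  have e1 : Tendsto (fun n : ℕ => 2 * Real.pi * c n / (q n ^ 3 * Real.exp (n * q n ^ 2 +
      ∑ i, ellSum (Real.exp (-q n ^ 2)) (M i) (t i)))) atTop (𝓝 (Real.sqrt (Real.pi / A))) := by
    have := tendsto_integral_saddle hM ht h1 hq hqn
    have h2 := (Complex.continuous_re.tendsto _).comp this
    rw [Complex.ofReal_re] at h2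
    refine h2.congr' ?_
    filter_upwards [hq0] with n hn
    rw [Function.comp_apply, integral_saddle hM ht hc n hn, Complex.ofReal_re]
  have e2 := ((tendsto_sum_ellSum hM ht hq).sub_const (constCoeff M t)).rexp
  rw [sub_self, Real.exp_zero] at e2
  have e3 := (e1.mul e2).mul_const (Real.sqrt (Real.pi / A))⁻¹
  rw [mul_one, mul_inv_cancel₀ (Real.sqrt_pos.2 (by positivity)).ne'] at e3
  refine e3.congr' ?_
  filter_upwards [hq0, hqn, eventually_gt_atTop 0] with n hn hnA hn0
  have hn0 : (0 : ℝ) < n := by exact_mod_cast hn0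
  generalize ∑ i, ellSum (Real.exp (-q n ^ 2)) (M i) (t i) = S
  have hsA : 0 < Real.sqrt A := Real.sqrt_pos.2 hA
  have hsp : 0 < Real.sqrt Real.pi := Real.sqrt_pos.2 hpi
  have f1 : A / q n ^ 2 = n * q n ^ 2 := by
    rw [← hnA]
    field_simp
  have f2 : Real.sqrt (A * n) = n * q n ^ 2 := by
    rw [← Real.sqrt_sq (x := n * q n ^ 2) (by positivity)]
    congr 1
    rw [← hnA]
    ring
  have f3 : Real.exp (-(1 / 2) * Real.log (q n ^ 2)) = (q n)⁻¹ := by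
    rw [Real.log_pow, ← Real.exp_log (inv_pos.2 hn), Real.log_inv]
    congr 1
    push_cast
    ring
  have f4 : Real.exp (S - A / q n ^ 2 + logCoeff M t * Real.log (q n ^ 2) - constCoeff M t) =
      Real.exp S * (q n)⁻¹ / (Real.exp (n * q n ^ 2) * Real.exp (constCoeff M t)) := by
    rw [hD, Real.exp_sub, Real.exp_add, f3, Real.exp_sub, f1]
    field_simp
  have f5 : Real.sqrt A * Real.sqrt A = n * q n ^ 4 := by rw [Real.mul_self_sqrt hA.le, hnA]
  have f6 : Real.sqrt Real.pi * Real.sqrt Real.pi = Real.pi := Real.mul_self_sqrt hpi.le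
  rw [f4, f2, Real.exp_add, Real.sqrt_div hpi.le, two_mul (_ * _), Real.exp_add]
  generalize Real.sqrt A = a at *
  generalize Real.sqrt Real.pi = p at *
  rw [← f6]
  have := Real.exp_pos (n * q n ^ 2)
  have := Real.exp_pos (constCoeff M t)
  have := Real.exp_pos S
  field_simp
  linear_combination (c n) * f5

end

end Ptn

namespace Ptn

open Filter Topology

section

variable {m : ℕ} {δ : ℕ → ℤ}

theorem sum_pairs_add (m : ℕ) (g h : ℕ → ℝ) :
    ∑ i ∈ Finset.Icc 1 (m - 1), ∑ j ∈ Finset.Ico (i + 1) m, (g i + h j) =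
      ∑ i ∈ Finset.Icc 1 (m - 1), ((m - 1 - i) * g i + (i - 1) * h i) := by
  have hI : Finset.Icc 1 (m - 1) = Finset.Ico 1 m := by
    ext i
    simp only [Finset.mem_Icc, Finset.mem_Ico]
    omega
  rw [hI]
  simp_rw [Finset.sum_add_distrib]
  congr 1
  · refine Finset.sum_congr rfl fun i hi => ?_
    rw [Finset.mem_Ico] at hi
    rw [Finset.sum_const, Nat.card_Ico, nsmul_eq_mul, Nat.cast_sub (by omega)]
    push_cast
    ring
  · rw [Finset.sum_Ico_Ico_comm']
    refine Finset.sum_congr rfl fun i hi => ?_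
    rw [Finset.mem_Ico] at hi
    rw [Finset.sum_const, Nat.card_Ico, nsmul_eq_mul, Nat.cast_sub (by omega), Nat.cast_one]

theorem card_W1 (hm : 1 ≤ m) : (W1 m δ).card = m := by
  simp [W1]
  omega

theorem card_W2 (hm : 1 ≤ m) (hδ : IsProfile (m - 1) δ) :
    ((W2 m δ).card : ℝ) = (m - 1) * (m - 2) / 2 := by
  have h1 := sum_map_W2 hδ fun _ => 1
  have h2 := sum_pairs_add m (fun _ => 1 / 2) (fun _ => 1 / 2)
  norm_num only at h2
  rw [Multiset.map_const', Multiset.sum_replicate, nsmul_one, h2] at h1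
  rw [h1, Finset.sum_congr rfl fun (i : ℕ) _ =>
    show ((m : ℝ) - 1 - i) * (1 / 2) + (i - 1) * (1 / 2) = (m - 2) / 2 by ring,
    Finset.sum_const, Nat.card_Icc, nsmul_eq_mul, Nat.add_sub_cancel, Nat.cast_sub hm]
  push_cast
  ring

theorem profile_cast (hδ : IsProfile (m - 1) δ) {i : ℕ} (hi : i ∈ Finset.Icc 1 (m - 1)) :
    δ i = 1 ∨ δ i = -1 :=
  hδ i (Finset.mem_Icc.1 hi).1 (Finset.mem_Icc.1 hi).2

theorem sum_half_sub_W1 (hm : 1 ≤ m) (hδ : IsProfile (m - 1) δ) :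
    ((W1 m δ).map fun t : ℕ => 1 / 2 - (t : ℝ) / m).sum =
      -(1 / 2) - ∑ i ∈ Finset.Icc 1 (m - 1), (δ i : ℝ) * (1 / 2 - i / m) := by
  have hm' : (m : ℝ) ≠ 0 := by exact_mod_cast (by omega : m ≠ 0)
  have h := sum_map_W1 hδ fun t => 1 / 2 - (t : ℝ) / m
  simp only [Int.cast_natCast] at h
  rw [h, sub_eq_add_neg (-(1 / 2) : ℝ), ← Finset.sum_neg_distrib, div_self hm']
  congr 1
  · norm_num
  refine Finset.sum_congr rfl fun i hi => ?_
  rcases profile_cast hδ hi with h | h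
  · simp [h]
    field_simp
    ring
  · simp [h]

theorem sum_half_sub_W2 (hm : 1 ≤ m) (hδ : IsProfile (m - 1) δ) :
    ((W2 m δ).map fun t : ℕ => 1 / 2 - (t : ℝ) / (2 * m : ℕ)).sum =
      ∑ i ∈ Finset.Icc 1 (m - 1), (δ i : ℝ) * (1 / 2 - i / m) := by
  have hm' : (m : ℝ) ≠ 0 := by exact_mod_cast (by omega : m ≠ 0)
  have h := sum_map_W2 hδ fun t => 1 / 2 - (t : ℝ) / (2 * m : ℕ)
  simp only [Int.cast_natCast] at h
  have h2 := sum_pairs_add m (fun i => (δ i : ℝ) * (1 / 4 - (1 / 2 - i / m) / 2))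
    (fun i => (δ i : ℝ) * (-(1 / 4) - (1 / 2 - i / m) / 2))
  rw [h]
  refine Eq.trans ?_ (h2.trans ?_)
  · refine Finset.sum_congr rfl fun i hi => Finset.sum_congr rfl fun j hj => ?_
    have hj' : j ∈ Finset.Icc 1 (m - 1) := by
      rw [Finset.mem_Icc] at hi ⊢
      rw [Finset.mem_Ico] at hj
      omega
    rcases profile_cast hδ hi with h | h <;> rcases profile_cast hδ hj' with h' | h' <;>
      simp [pairWeight, h, h'] <;> field_simp <;> ring
  · refine Finset.sum_congr rfl fun i _ => ?_
    field_simp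
    ring

theorem sum_profile_mul (hm : 1 ≤ m) (hδ : IsProfile (m - 1) δ) :
    ∑ i ∈ Finset.Icc 1 (m - 1), (δ i : ℝ) * (1 / 2 - i / m) =
      onesProfile m δ - (m - 1) / 2 + epsProfile m δ / m := by
  have h1 : (onesProfile m δ : ℝ) - (m - 1) / 2 =
      ∑ i ∈ Finset.Icc 1 (m - 1), (δ i : ℝ) * (1 / 2) := by
    have h2 : ((m : ℝ) - 1) / 2 = ∑ _i ∈ Finset.Icc 1 (m - 1), (1 / 2 : ℝ) := by
      rw [Finset.sum_const, Nat.card_Icc, nsmul_eq_mul, Nat.add_sub_cancel, Nat.cast_sub hm]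
      push_cast
      ring
    rw [onesProfile, Finset.card_filter, h2, Nat.cast_sum, ← Finset.sum_sub_distrib]
    refine Finset.sum_congr rfl fun i hi => ?_
    rcases profile_cast hδ hi with h | h <;> norm_num [h]
  rw [h1, epsProfile]
  push_cast
  rw [neg_div, Finset.sum_div, ← sub_eq_add_neg, ← Finset.sum_sub_distrib]
  refine Finset.sum_congr rfl fun i _ => ?_
  ring

theorem pos_of_mem_W1 {t : ℕ} (hm : 1 ≤ m) (ht : t ∈ W1 m δ) : 0 < t := by
  rw [W1, Multiset.mem_cons, Multiset.mem_map] at ht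
  rcases ht with rfl | ⟨i, hi, rfl⟩
  · exact hm
  · rw [Finset.mem_val, Finset.mem_Icc] at hi
    split_ifs <;> omega

theorem pos_of_mem_W2 {t : ℕ} (ht : t ∈ W2 m δ) : 0 < t := by
  rw [W2, Multiset.mem_map] at ht
  obtain ⟨q, hq, rfl⟩ := ht
  simp only [Finset.mem_val, Finset.mem_filter, Finset.mem_product, Finset.mem_Icc] at hq
  split_ifs <;> omega

theorem one_mem_W1_or_W2 (hm : 2 ≤ m) (hδ : IsProfile (m - 1) δ) :
    1 ∈ W1 m δ ∨ 1 ∈ W2 m δ := by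
  by_cases hl : δ (m - 1) = 1
  · left
    refine Multiset.mem_cons_of_mem (Multiset.mem_map.2 ⟨m - 1, ?_, ?_⟩)
    · simp
      omega
    · rw [hl, if_neg (by norm_num)]
      omega
  have hex : ∃ j, 1 ≤ j ∧ δ j ≠ 1 := ⟨m - 1, by omega, hl⟩
  classical
  obtain ⟨hj1, hj⟩ := Nat.find_spec hex
  have hjm : Nat.find hex ≤ m - 1 := Nat.find_min' hex ⟨by omega, hl⟩
  have hmin := fun k => Nat.find_min (H := hex) (m := k)
  generalize Nat.find hex = j at *
  have hj' : δ j = -1 := (hδ j hj1 hjm).resolve_left hj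
  rcases eq_or_lt_of_le hj1 with rfl | hj2
  · left
    refine Multiset.mem_cons_of_mem (Multiset.mem_map.2 ⟨1, ?_, ?_⟩)
    · simp
      omega
    · rw [if_pos hj']
  · right
    have hp : δ (j - 1) = 1 := by
      by_contra h
      exact hmin (j - 1) (by omega) ⟨by omega, h⟩
    refine Multiset.mem_map.2 ⟨(j - 1, j), ?_, ?_⟩
    · simp only [Finset.mem_val, Finset.mem_filter, Finset.mem_product, Finset.mem_Icc]
      omega
    · simp only [hp, hj']
      norm_num
      omega

/-- The moduli and residues of the exponents in the generating product. -/
def factors (m : ℕ) (δ : ℕ → ℤ) : Multiset (ℕ × ℕ) :=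
  (W1 m δ).map (fun t => (m, t)) + (W2 m δ).map (fun t => (2 * m, t))

theorem sum_factors (m : ℕ) (δ : ℕ → ℤ) (f : ℕ → ℕ → ℝ) :
    ∑ i : (factors m δ).ToType, f i.1.1 i.1.2 =
      ((W1 m δ).map (f m)).sum + ((W2 m δ).map (f (2 * m))).sum := by
  have h : ∑ i : (factors m δ).ToType, f i.1.1 i.1.2 =
      ((factors m δ).map fun p => f p.1 p.2).sum := by
    conv_rhs => rw [← Multiset.map_univ_coe (factors m δ), Multiset.map_map]
    rfl
  rw [h, factors, Multiset.map_add, Multiset.sum_add, Multiset.map_map, Multiset.map_map]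
  rfl

theorem mem_factors (hm : 1 ≤ m) (i : (factors m δ).ToType) : 0 < i.1.1 ∧ 0 < i.1.2 := by
  have h : ∀ p ∈ factors m δ, 0 < p.1 ∧ 0 < p.2 := fun p hp => by
    rw [factors, Multiset.mem_add, Multiset.mem_map, Multiset.mem_map] at hp
    rcases hp with ⟨t, ht, rfl⟩ | ⟨t, ht, rfl⟩
    · exact ⟨hm, pos_of_mem_W1 hm ht⟩
    · exact ⟨by simp only; omega, pos_of_mem_W2 ht⟩
  exact h _ Multiset.coe_mem

theorem exists_factors_eq_one (hm : 2 ≤ m) (hδ : IsProfile (m - 1) δ) :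
    ∃ i : (factors m δ).ToType, i.1.2 = 1 := by
  have h : ∃ p ∈ factors m δ, p.2 = 1 := by
    rcases one_mem_W1_or_W2 hm hδ with h | h
    · exact ⟨(m, 1), Multiset.mem_add.2 (Or.inl (Multiset.mem_map_of_mem _ h)), rfl⟩
    · exact ⟨(2 * m, 1), Multiset.mem_add.2 (Or.inr (Multiset.mem_map_of_mem _ h)), rfl⟩
  obtain ⟨p, hp, hp1⟩ := h
  exact ⟨⟨p, 0, Multiset.count_pos.2 hp⟩, hp1⟩

theorem hasSum_DSPPcount (hm : 1 ≤ m) (hδ : IsProfile (m - 1) δ) {x : ℝ} (h0 : 0 < x)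
    (h1 : x < 1) : HasSum (fun n => (DSPPcount m δ n : ℝ) * x ^ n)
      (Real.exp (∑ i : (factors m δ).ToType, ellSum x i.1.1 i.1.2)) := by
  have h := tsum_DSPPcount_ofReal h0 h1 hm hδ
  rw [sum_factors m δ fun M t => ellSum x M t]
  have h2 := ENNReal.hasSum_toReal (h.trans_ne ENNReal.ofReal_ne_top)
  rw [← ENNReal.tsum_toReal_eq fun n => ENNReal.mul_ne_top (by simp) (by simp), h,
    ENNReal.toReal_ofReal (Real.exp_pos _).le] at h2
  simpa [ENNReal.toReal_ofReal h0.le] using h2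

theorem poleCoeff_factors (hm : 1 ≤ m) (hδ : IsProfile (m - 1) δ) :
    poleCoeff (fun i : (factors m δ).ToType => i.1.1) =
      Real.pi ^ 2 / (8 * m) * (((m : ℝ) ^ 2 + m + 2) / 3) := by
  have hm' : (m : ℝ) ≠ 0 := by exact_mod_cast (by omega : m ≠ 0)
  rw [poleCoeff, sum_factors m δ fun M _ => Real.pi ^ 2 / 6 / M]
  simp only [Multiset.map_const', Multiset.sum_replicate, nsmul_eq_mul]
  rw [card_W1 hm, card_W2 hm hδ]
  push_cast
  field_simp
  ring

theorem logCoeff_factors (hm : 1 ≤ m) (hδ : IsProfile (m - 1) δ) :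
    logCoeff (fun i : (factors m δ).ToType => i.1.1) (fun i => i.1.2) = -(1 / 2) := by
  rw [logCoeff, sum_factors m δ fun M t => 1 / 2 - (t : ℝ) / M, sum_half_sub_W1 hm hδ,
    sum_half_sub_W2 hm hδ]
  ring

theorem sum_map_const_terms (W : Multiset ℕ) (hW : ∀ t ∈ W, 0 < t) {M : ℕ} (hM : 0 < M) :
    (W.map fun t : ℕ => Real.log (Real.Gamma ((t : ℝ) / M) / Real.sqrt (2 * Real.pi)) -
      (1 / 2 - (t : ℝ) / M) * Real.log M).sum =
    (W.map fun t : ℕ => Real.log (Real.Gamma ((t : ℝ) / M))).sum -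
      W.card * (Real.log (2 * Real.pi) / 2) -
      (W.map fun t : ℕ => 1 / 2 - (t : ℝ) / M).sum * Real.log M := by
  have h : ∀ t ∈ W, Real.log (Real.Gamma ((t : ℝ) / M) / Real.sqrt (2 * Real.pi)) -
      (1 / 2 - (t : ℝ) / M) * Real.log M = Real.log (Real.Gamma ((t : ℝ) / M)) -
        Real.log (2 * Real.pi) / 2 - (1 / 2 - (t : ℝ) / M) * Real.log M := fun t ht => by
    have h1 : (0 : ℝ) < t := by exact_mod_cast hW t ht
    have h2 : (0 : ℝ) < M := by exact_mod_cast hM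
    have hpi := Real.pi_pos
    rw [Real.log_div (Real.Gamma_pos_of_pos (by positivity)).ne' (by positivity),
      Real.log_sqrt (by positivity)]
  rw [Multiset.map_congr rfl h, Multiset.sum_map_sub, Multiset.sum_map_sub,
    Multiset.sum_map_mul_right, Multiset.map_const', Multiset.sum_replicate, nsmul_eq_mul]

theorem exp_sum_log_Gamma (W : Multiset ℕ) (hW : ∀ t ∈ W, 0 < t) {M : ℝ} (hM : 0 < M) :
    Real.exp (W.map fun t : ℕ => Real.log (Real.Gamma ((t : ℝ) / M))).sum =
      (W.map fun t : ℕ => Real.Gamma ((t : ℝ) / M)).prod := by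
  rw [Real.exp_multiset_sum, Multiset.map_map]
  refine congrArg _ (Multiset.map_congr rfl fun t ht => ?_)
  have h1 : (0 : ℝ) < t := by exact_mod_cast hW t ht
  exact Real.exp_log (Real.Gamma_pos_of_pos (by positivity))

theorem prod_map_lift (W : Multiset ℕ) (f : ℝ → ℝ) :
    (Multiset.map f (do let a ← W; pure (a : ℝ))).prod = (W.map fun t : ℕ => f t).prod := by
  simp [Multiset.bind_def, Multiset.pure_def, Multiset.bind_singleton, Multiset.map_map]

theorem constCoeff_factors (hm : 1 ≤ m) (hδ : IsProfile (m - 1) δ) :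
    Real.exp (constCoeff (fun i : (factors m δ).ToType => i.1.1) (fun i => i.1.2)) =
      ((W1 m δ).map (fun t : ℕ => Real.Gamma ((t : ℝ) / m))).prod *
      ((W2 m δ).map (fun t : ℕ => Real.Gamma ((t : ℝ) / (2 * m)))).prod *
      Real.exp (Real.log m / 2 - ((m : ℝ) ^ 2 - m + 2) / 4 * Real.log (2 * Real.pi) -
        (onesProfile m δ - (m - 1) / 2 + epsProfile m δ / m) * Real.log 2) := by
  have hm' : (0 : ℝ) < m := by exact_mod_cast hm
  rw [constCoeff, sum_factors m δ fun M t =>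
    Real.log (Real.Gamma ((t : ℝ) / M) / Real.sqrt (2 * Real.pi)) -
      (1 / 2 - (t : ℝ) / M) * Real.log M,
    sum_map_const_terms _ (fun t ht => pos_of_mem_W1 hm ht) hm,
    sum_map_const_terms _ (fun t ht => pos_of_mem_W2 ht) (by omega), sum_half_sub_W1 hm hδ,
    sum_half_sub_W2 hm hδ, sum_profile_mul hm hδ, card_W1 hm, card_W2 hm hδ,
    ← exp_sum_log_Gamma _ (fun t ht => pos_of_mem_W1 hm ht) hm',
    ← exp_sum_log_Gamma _ (fun t ht => pos_of_mem_W2 ht) (by positivity : (0 : ℝ) < 2 * m),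
    ← Real.exp_add, ← Real.exp_add]
  push_cast
  rw [Real.log_mul two_ne_zero hm'.ne']
  congr 1
  ring

theorem leading_constant_eq (hm : 1 ≤ m) (hδ : IsProfile (m - 1) δ) :
    Real.exp (constCoeff (fun i : (factors m δ).ToType => i.1.1) (fun i => i.1.2)) *
      Real.sqrt (poleCoeff fun i : (factors m δ).ToType => i.1.1) / (2 * Real.sqrt Real.pi) =
      C1 m δ * C2 m := by
  have hm' : (0 : ℝ) < m := by exact_mod_cast hm
  have hpi := Real.pi_pos
  have hsq : ∀ {x : ℝ}, 0 < x → Real.sqrt x = Real.exp (Real.log x / 2) := fun hx => by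
    rw [← Real.log_sqrt hx.le, Real.exp_log (Real.sqrt_pos.2 hx)]
  rw [poleCoeff_factors hm hδ, constCoeff_factors hm hδ, C1, C2, prod_map_lift,
    prod_map_lift, mul_div_right_comm,
    Real.sqrt_mul (by positivity), Real.mul_rpow (by positivity) (by positivity),
    ← Real.rpow_mul zero_le_two, ← Real.rpow_mul hpi.le, Real.rpow_def_of_pos two_pos,
    Real.rpow_def_of_pos two_pos, Real.rpow_def_of_pos hpi]
  generalize ((W1 m δ).map (fun t : ℕ => Real.Gamma ((t : ℝ) / m))).prod = G₁
  generalize ((W2 m δ).map (fun t : ℕ => Real.Gamma ((t : ℝ) / (2 * m)))).prod = G₂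
  generalize Real.sqrt (((m : ℝ) ^ 2 + m + 2) / 3) = R
  rw [hsq (by positivity : 0 < Real.pi ^ 2 / (8 * m)), hsq hpi,
    Real.log_div (by positivity) (by positivity), Real.log_pow,
    Real.log_mul (by norm_num) hm'.ne', show (8 : ℝ) = 2 ^ 3 by norm_num, Real.log_pow,
    Real.log_mul two_ne_zero hpi.ne', div_eq_mul_inv _ (2 * _), mul_inv, ← Real.exp_neg]
  have h2 : (2 : ℝ)⁻¹ = Real.exp (-Real.log 2) := by rw [Real.exp_neg, Real.exp_log two_pos]
  rw [h2]
  have h3 : ∀ a b c d e f g : ℝ, a + b + c + d = e + f + g →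
      G₁ * G₂ * Real.exp a * (Real.exp b * Real.exp c) * (Real.exp d * R) =
        Real.exp e * G₁ * G₂ * (Real.exp f * Real.exp g * R) := fun a b c d e f g h => by
    calc _ = G₁ * G₂ * R * Real.exp (a + b + c + d) := by
          simp only [Real.exp_add]
          ring
      _ = _ := by
          rw [h]
          simp only [Real.exp_add]
          ring
  refine h3 _ _ _ _ _ _ _ ?_
  push_cast
  ring

end

end Ptn

/-- **Theorem 5.2**: for `m ≥ 2` and a profile `δ = (δ_1, …, δ_{m-1})`,
as `n → ∞`,
`DSPP_δ(n) ~ C_1(δ) C_2(m) · (1/n) · exp(π √((m²+m+2)n/(6m)))`. -/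
theorem asymptotic_skew_doubled_shifted_plane_partitions (m : ℕ) (hm : 2 ≤ m)
    (δ : ℕ → ℤ) (hδ : IsProfile (m - 1) δ) :
    Filter.Tendsto
      (fun n : ℕ => (DSPPcount m δ n : ℝ) /
        (C1 m δ * C2 m * (1 / (n : ℝ)) *
          Real.exp (Real.pi * Real.sqrt ((((m : ℝ) ^ 2 + m + 2) * n) / (6 * m)))))
      Filter.atTop (nhds 1) := by
  have hm1 : 1 ≤ m := by omega
  have h := Ptn.tendsto_coeff_div (fun i => (Ptn.mem_factors hm1 i).1)
    (fun i => (Ptn.mem_factors hm1 i).2) (Ptn.exists_factors_eq_one hm hδ)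
    (Ptn.logCoeff_factors hm1 hδ) (fun x h0 h1 => Ptn.hasSum_DSPPcount hm1 hδ h0 h1)
  rw [Ptn.leading_constant_eq hm1 hδ, Ptn.poleCoeff_factors hm1 hδ] at h
  refine h.congr fun n => ?_
  have hpi := Real.pi_pos
  have h1 : Real.pi ^ 2 / (8 * m) * (((m : ℝ) ^ 2 + m + 2) / 3) * n =
      (Real.pi / 2) ^ 2 * ((((m : ℝ) ^ 2 + m + 2) * n) / (6 * m)) := by
    field_simp
    ring
  rw [h1, Real.sqrt_mul (by positivity), Real.sqrt_sq (by positivity), ← mul_assoc,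
    mul_div_cancel₀ _ two_ne_zero]
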